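/- Let (Ω, u) be a solution of Δu = −2 in Ω, u = 0 on ∂Ω, on an open bounded connected domain Ω ⊂ ℝ² with smooth boundary, let N be a connected component of Ω ∖ MAX(u) such that Γ_N = ∂N ∩ ∂Ω is connected and |∇u| is constant on Γ_N, and assume the Normalization u_max = (u_R)_max is in force, where R satisfies τ̄_o(R) = τ̄(N) if τ̄(N) < √2 and τ̄_i(R) = τ̄(N) if τ̄(N) > √2. Then: if N is outer (i.e., ∫_{Γ_N} ⟨x, ν⟩ dH¹ > 0, ν the outward unit normal of Ω), the length of Γ_N satisfies H¹(Γ_N) ≥ 2π; if N is inner (i.e., ∫_{Γ_N} ⟨x, ν⟩ dH¹ < 0), then H¹(Γ_N) ≤ 2π r_i(R). -/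

import Mathlib

open Set MeasureTheory Filter
open scoped RealInnerProductSpace ENNReal Topology

noncomputable section

/-- The Euclidean plane. -/
abbrev E2 : Type := EuclideanSpace ℝ (Fin 2)

/-- The Laplacian of `u : ℝ² → ℝ` at `x`. -/
def lap (u : E2 → ℝ) (x : E2) : ℝ :=
  ∑ i : Fin 2, iteratedFDeriv ℝ 2 u x
    ![EuclideanSpace.single i (1:ℝ), EuclideanSpace.single i (1:ℝ)]

/-- `Ω` has smooth boundary: near each boundary point there is a smooth defining function
with nonvanishing differential. -/
def SmoothBoundary (Ω : Set E2) : Prop :=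
  ∀ x ∈ frontier Ω, ∃ (U : Set E2) (f : E2 → ℝ), IsOpen U ∧ x ∈ U ∧
    ContDiff ℝ (⊤ : ℕ∞) f ∧ (∀ y ∈ U, fderiv ℝ f y ≠ 0) ∧
    (Ω ∩ U = {y | y ∈ U ∧ f y < 0}) ∧ (frontier Ω ∩ U = {y | y ∈ U ∧ f y = 0})

/-- A solution `(Ω, u)` of the Serrin-type Dirichlet problem `Δu = -2` in `Ω`, `u = 0` on `∂Ω`,
on an open bounded connected domain with smooth boundary, `u` smooth up to the boundary. -/
structure IsSerrinSolution (Ω : Set E2) (u : E2 → ℝ) : Prop where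
  isOpen : IsOpen Ω
  bounded : Bornology.IsBounded Ω
  connected : IsConnected Ω
  smoothBoundary : SmoothBoundary Ω
  smooth : ContDiffOn ℝ (⊤ : ℕ∞) u (closure Ω)
  pde : ∀ x ∈ Ω, lap u x = -2
  bdry : ∀ x ∈ frontier Ω, u x = 0

/-- `u_max`, the maximum of `u` on the closure of `Ω`. -/
def umax (Ω : Set E2) (u : E2 → ℝ) : ℝ := sSup (u '' closure Ω)

/-- `MAX(u) = {p ∈ Ω : u p = u_max}`. -/
def MAXset (Ω : Set E2) (u : E2 → ℝ) : Set E2 := {p | p ∈ Ω ∧ u p = umax Ω u}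

/-- `N` is a connected component of `S`. -/
def IsCompOf (N S : Set E2) : Prop := ∃ p ∈ S, N = connectedComponentIn S p

/-- The normalised wall shear stress computed over a set `S` (e.g. a boundary component):
`sup_S |∇u| / √(2 u_max)`. -/
def nwssOn (Ω : Set E2) (u : E2 → ℝ) (S : Set E2) : ℝ :=
  sSup ((fun x => ‖gradient u x‖) '' S) / Real.sqrt (2 * umax Ω u)

/-- The normalised wall shear stress of a region `N ⊆ Ω ∖ MAX(u)`: the NWSS over
`∂Ω ∩ closure N`. -/
def nwssRegion (Ω : Set E2) (u : E2 → ℝ) (N : Set E2) : ℝ :=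
  nwssOn Ω u (frontier Ω ∩ closure N)

/-- `r_i(R)`: the smallest positive zero of `ρ ↦ 1 - ρ² + 2 R² log ρ`. -/
def innerRadius (R : ℝ) : ℝ :=
  sInf {ρ : ℝ | 0 < ρ ∧ 1 - ρ^2 + 2*R^2*Real.log ρ = 0}

/-- The ring-shaped model domain `Ω_R = {r_i(R) < |x| < 1}`. -/
def modelDomain (R : ℝ) : Set E2 := {x : E2 | innerRadius R < ‖x‖ ∧ ‖x‖ < 1}

/-- The ring-shaped model solution `u_R(x) = (1 - |x|²)/2 + R² log |x|`. -/
def modelU (R : ℝ) (x : E2) : ℝ := (1 - ‖x‖^2)/2 + R^2 * Real.log ‖x‖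

/-- `(u_R)_max = (1 - R²)/2 + R² log R`. -/
def modelUmax (R : ℝ) : ℝ := (1 - R^2)/2 + R^2 * Real.log R

/-- The outer NWSS function `τ̄_o`. -/
def tauOut (R : ℝ) : ℝ :=
  if R = 0 then 1 else (1 - R^2)/Real.sqrt (1 - R^2 + 2*R^2*Real.log R)

/-- The inner NWSS function `τ̄_i`. -/
def tauIn (R : ℝ) : ℝ :=
  if R = 1 then Real.sqrt 2
  else (R^2 - (innerRadius R)^2)/(innerRadius R * Real.sqrt (1 - R^2 + 2*R^2*Real.log R))

/-- `(Ω', u')` is obtained from `(Ω, u)` by the translation-dilation `x ↦ x₀ + λ x`,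
`u ↦ λ² u(·/λ)`. -/
def EquivPair (Ω : Set E2) (u : E2 → ℝ) (Ω' : Set E2) (u' : E2 → ℝ) : Prop :=
  ∃ (lam : ℝ) (x₀ : E2), 0 < lam ∧ Ω' = (fun x => x₀ + lam • x) '' Ω ∧
    ∀ x ∈ Ω, u' (x₀ + lam • x) = lam^2 * u x

/-- `(Ω, u)` is, up to a translation and a dilation, Serrin's solution
`(B(0,1), (1 - |x|²)/2)`. -/
def IsSerrinModel (Ω : Set E2) (u : E2 → ℝ) : Prop :=
  ∃ (x₀ : E2) (lam : ℝ), 0 < lam ∧ Ω = Metric.ball x₀ lam ∧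
    ∀ x ∈ Ω, u x = (lam^2 - ‖x - x₀‖^2)/2

/-- `Ω` is ring-shaped, with `A` the unbounded connected component of `ℝ² ∖ closure Ω`
and `B` the other (bounded) one; the outer boundary component is `Γ_o = ∂Ω ∩ closure A`
and the inner one is `Γ_i = ∂Ω ∩ closure B`. -/
def RingShapedWith (Ω A B : Set E2) : Prop :=
  A ≠ B ∧ ¬ Bornology.IsBounded A ∧
  ∀ C : Set E2, (∃ p ∈ (closure Ω)ᶜ, C = connectedComponentIn (closure Ω)ᶜ p) ↔ (C = A ∨ C = B)

/-- `S` is a smooth simple closed curve in the plane (admitting a smooth, unit-speed,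
periodic, injective-on-a-period parametrization). -/
def IsSmoothSimpleClosedCurve (S : Set E2) : Prop :=
  ∃ (γ : ℝ → E2) (L : ℝ), 0 < L ∧ ContDiff ℝ (⊤ : ℕ∞) γ ∧ (∀ t, ‖deriv γ t‖ = 1) ∧
    (∀ t, γ (t + L) = γ t) ∧ InjOn γ (Ico 0 L) ∧ S = range γ

/-- The outward unit normal `-∇u/|∇u|` of `Ω` along `∂Ω` (where `u = 0` and `u > 0` inside). -/
def outNormal (u : E2 → ℝ) (x : E2) : E2 := -(‖gradient u x‖)⁻¹ • gradient u x

theorem wirtinger_dirichlet_aux {y y' : ℝ → ℝ} {l k : ℝ} (hl : 0 < l) (hk : 0 < k)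
    (hkl : k * l < Real.pi) (hy : ∀ t, HasDerivAt y (y' t) t) (hy' : Continuous y')
    (h0 : y 0 = 0) (h1 : y l = 0) :
    k ^ 2 * ∫ t in (0:ℝ)..l, y t ^ 2 ≤ ∫ t in (0:ℝ)..l, y' t ^ 2 := by
  have hyc : Continuous y := continuous_iff_continuousAt.2 fun t => (hy t).continuousAt
  set φ : ℝ := (Real.pi - k * l) / 2 with hφ
  have hφ0 : 0 < φ := by rw [hφ]; linarith
  have hsin : ∀ t ∈ Icc 0 l, 0 < Real.sin (k * t + φ) := by
    intro t ht
    apply Real.sin_pos_of_pos_of_lt_pi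
    · have := mul_nonneg hk.le ht.1; linarith
    · have := mul_le_mul_of_nonneg_left ht.2 hk.le
      linarith
  have key := intervalIntegral.sub_le_integral_of_hasDeriv_right_of_le (a := 0) (b := l)
    (g := fun t => k * y t ^ 2 * (Real.cos (k * t + φ) / Real.sin (k * t + φ)))
    (g' := fun t => y' t ^ 2 - k ^ 2 * y t ^ 2
      - (y' t - k * y t * (Real.cos (k * t + φ) / Real.sin (k * t + φ))) ^ 2)
    (φ := fun t => y' t ^ 2 - k ^ 2 * y t ^ 2) hl.le ?_ ?_ ?_ ?_
  · simp only [h0, h1] at key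
    rw [intervalIntegral.integral_sub
      ((by fun_prop : Continuous fun t => y' t ^ 2).intervalIntegrable _ _)
      ((by fun_prop : Continuous fun t => k ^ 2 * y t ^ 2).intervalIntegrable _ _),
      intervalIntegral.integral_const_mul] at key
    norm_num at key
    exact key
  · refine ContinuousOn.mul (by fun_prop) (ContinuousOn.div (by fun_prop) (by fun_prop) ?_)
    exact fun t ht => (hsin t ht).ne'
  · intro t ht
    have hs := (hsin t (Ioo_subset_Icc_self ht)).ne'
    have hlin : HasDerivAt (fun t => k * t + φ) k t := by
      simpa using ((hasDerivAt_id t).const_mul k).add_const φ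
    have hq := (hlin.cos.div hlin.sin hs)
    have := ((((hy t).pow 2).const_mul k).mul hq).hasDerivWithinAt (s := Ioi t)
    refine this.congr_deriv ?_
    simp only [Pi.pow_apply, Pi.div_apply]
    field_simp
    norm_num
    ring
  · exact (ContinuousOn.sub (hy'.pow 2).continuousOn
      (((hyc.pow 2).const_mul _).continuousOn)).integrableOn_Icc
  · intro t ht
    have := sq_nonneg (y' t - k * y t * (Real.cos (k * t + φ) / Real.sin (k * t + φ)))
    linarith

/-- Wirtinger's inequality with Dirichlet boundary conditions. -/
theorem wirtinger_dirichlet {y y' : ℝ → ℝ} {l : ℝ} (hl : 0 < l)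
    (hy : ∀ t, HasDerivAt y (y' t) t) (hy' : Continuous y')
    (h0 : y 0 = 0) (h1 : y l = 0) :
    (Real.pi / l) ^ 2 * ∫ t in (0:ℝ)..l, y t ^ 2 ≤ ∫ t in (0:ℝ)..l, y' t ^ 2 := by
  have hlim : Tendsto (fun k : ℝ => k ^ 2 * ∫ t in (0:ℝ)..l, y t ^ 2) (𝓝[<] (Real.pi / l))
      (𝓝 ((Real.pi / l) ^ 2 * ∫ t in (0:ℝ)..l, y t ^ 2)) := by
    apply Tendsto.mono_left _ nhdsWithin_le_nhds
    exact (((continuous_id.pow 2).mul continuous_const).tendsto _)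
  refine le_of_tendsto hlim ?_
  have hp : 0 < Real.pi / l := div_pos Real.pi_pos hl
  filter_upwards [Ioo_mem_nhdsLT hp] with k hk
  exact wirtinger_dirichlet_aux hl hk.1 ((lt_div_iff₀ hl).1 hk.2) hy hy' h0 h1

theorem integral_mul_deriv_le_half {x' y y' : ℝ → ℝ} {l : ℝ} (hl : 0 < l)
    (hy : ∀ t, HasDerivAt y (y' t) t) (hx' : Continuous x') (hy' : Continuous y')
    (hu : ∀ t, x' t ^ 2 + y' t ^ 2 = 1) (h0 : y 0 = 0) (h1 : y l = 0) :
    2 * ∫ t in (0:ℝ)..l, y t * x' t ≤ l ^ 2 / Real.pi := by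
  have hyc : Continuous y := continuous_iff_continuousAt.2 fun t => (hy t).continuousAt
  have hp : 0 < Real.pi / l := div_pos Real.pi_pos hl
  set k := Real.pi / l with hk
  have hw := wirtinger_dirichlet hl hy hy' h0 h1
  rw [← hk] at hw
  have hle : ∫ t in (0:ℝ)..l, 2 * (y t * x' t) ≤
      ∫ t in (0:ℝ)..l, (k * y t ^ 2 - k⁻¹ * y' t ^ 2 + k⁻¹) := by
    apply intervalIntegral.integral_mono_on hl.le
    · exact (continuous_const.mul (hyc.mul hx')).intervalIntegrable _ _
    · exact (((continuous_const.mul (hyc.pow 2)).sub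
        (continuous_const.mul (hy'.pow 2))).add continuous_const).intervalIntegrable _ _
    · intro t _
      have h2 : x' t ^ 2 = 1 - y' t ^ 2 := by linarith [hu t]
      have : k * y t ^ 2 - k⁻¹ * y' t ^ 2 + k⁻¹ - 2 * (y t * x' t) =
          k⁻¹ * (k * y t - x' t) ^ 2 := by
        have : (k * y t - x' t) ^ 2 = k ^ 2 * y t ^ 2 - 2 * k * y t * x' t + (1 - y' t ^ 2) := by
          rw [← h2]; ring
        rw [this]; field_simp; ring
      have : 0 ≤ k⁻¹ * (k * y t - x' t) ^ 2 := by positivity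
      linarith
  rw [intervalIntegral.integral_const_mul, intervalIntegral.integral_add,
    intervalIntegral.integral_sub,
    intervalIntegral.integral_const_mul, intervalIntegral.integral_const_mul,
    intervalIntegral.integral_const] at hle
  · have : k * (∫ t in (0:ℝ)..l, y t ^ 2) ≤ k⁻¹ * ∫ t in (0:ℝ)..l, y' t ^ 2 := by
      rw [← mul_le_mul_iff_right₀ hp]
      calc k * (k * ∫ t in (0:ℝ)..l, y t ^ 2) = k ^ 2 * ∫ t in (0:ℝ)..l, y t ^ 2 := by ring
        _ ≤ _ := hw
        _ = _ := by field_simp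
    have e : l ^ 2 / Real.pi = (l - 0) • k⁻¹ := by
      rw [hk]; simp only [inv_div, smul_eq_mul]; field_simp; ring
    rw [e]; linarith
  · exact (continuous_const.mul (hyc.pow 2)).intervalIntegrable _ _
  · exact (continuous_const.mul (hy'.pow 2)).intervalIntegrable _ _
  · exact ((continuous_const.mul (hyc.pow 2)).sub
        (continuous_const.mul (hy'.pow 2))).intervalIntegrable _ _
  · exact continuous_const.intervalIntegrable _ _

theorem integral_mul_deriv_le {x' y y' : ℝ → ℝ} {l : ℝ} (hl : 0 < l)
    (hy : ∀ t, HasDerivAt y (y' t) t) (hx' : Continuous x') (hy' : Continuous y')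
    (hu : ∀ t, x' t ^ 2 + y' t ^ 2 = 1) (h0 : y 0 = 0) (h1 : y l = 0) (h2 : y (2 * l) = 0) :
    2 * ∫ t in (0:ℝ)..(2 * l), y t * x' t ≤ (2 * l) ^ 2 / (2 * Real.pi) := by
  have hyc : Continuous y := continuous_iff_continuousAt.2 fun t => (hy t).continuousAt
  have a := integral_mul_deriv_le_half hl hy hx' hy' hu h0 h1
  have b := integral_mul_deriv_le_half (y := fun t => y (t + l)) (y' := fun t => y' (t + l))
    (x' := fun t => x' (t + l)) hl (fun t => (hy (t + l)).comp_add_const t l) (by fun_prop)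
    (by fun_prop) (fun t => hu _) (by simpa using h1) (by simpa [two_mul] using h2)
  have hi : ∀ a b, IntervalIntegrable (fun t => y t * x' t) volume a b :=
    fun a b => (hyc.mul hx').intervalIntegrable _ _
  rw [intervalIntegral.integral_comp_add_right (fun t => y t * x' t) l] at b
  rw [← intervalIntegral.integral_add_adjacent_intervals (hi 0 l) (hi l (2 * l))]
  rw [zero_add, ← two_mul] at b
  have e : (2 * l) ^ 2 / (2 * Real.pi) = l ^ 2 / Real.pi + l ^ 2 / Real.pi := by
    field_simp; ring
  rw [e]; linarith

/-- Rotation by a right angle in the plane. -/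
def rotJ : E2 →L[ℝ] E2 :=
  LinearMap.toContinuousLinearMap
    { toFun := fun v => !₂[-v 1, v 0]
      map_add' := fun v w => by ext i; fin_cases i <;> simp; ring
      map_smul' := fun r v => by ext i; fin_cases i <;> simp }

@[simp] theorem rotJ_zero (v : E2) : rotJ v 0 = -v 1 := rfl
@[simp] theorem rotJ_one (v : E2) : rotJ v 1 = v 0 := rfl

theorem E2_inner (v w : E2) : ⟪v, w⟫ = v 0 * w 0 + v 1 * w 1 := by
  simp [PiLp.inner_apply, Fin.sum_univ_two]; ring

theorem E2_norm_sq (v : E2) : ‖v‖ ^ 2 = v 0 ^ 2 + v 1 ^ 2 := by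
  rw [← real_inner_self_eq_norm_sq, E2_inner]; ring

theorem hasDerivAt_E2_coord {γ : ℝ → E2} {T : E2} {t : ℝ} (h : HasDerivAt γ T t) (i : Fin 2) :
    HasDerivAt (fun s => γ s i) (T i) t :=
  ((EuclideanSpace.proj (𝕜 := ℝ) i).hasFDerivAt.comp_hasDerivAt t h)

theorem exists_unit_direction (a : E2) : ∃ e : E2, ‖e‖ = 1 ∧ ⟪a, rotJ e⟫ = 0 := by
  by_cases ha : a = 0
  · exact ⟨EuclideanSpace.single 0 1, by simp, by simp [ha]⟩
  · refine ⟨‖a‖⁻¹ • a, by simp [norm_smul, ha], ?_⟩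
    rw [E2_inner]; simp; ring

/-- The isoperimetric inequality for closed unit-speed curves in the plane, with signed area. -/
theorem isoperimetric_signed {γ T : ℝ → E2} {L : ℝ} (hL : 0 < L)
    (hγ : ∀ t, HasDerivAt γ (T t) t) (hT : Continuous T) (hu : ∀ t, ‖T t‖ = 1)
    (hper : γ L = γ 0) :
    ∫ t in (0:ℝ)..L, ⟪γ t, rotJ (T t)⟫ ≤ L ^ 2 / (2 * Real.pi) := by
  have hγc : Continuous γ := continuous_iff_continuousAt.2 fun t => (hγ t).continuousAt
  obtain ⟨e, he, hae⟩ := exists_unit_direction (γ (L / 2) - γ 0)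
  have he2 : e 0 ^ 2 + e 1 ^ 2 = 1 := by rw [← E2_norm_sq, he]; norm_num
  set x : ℝ → ℝ := fun t => ⟪γ t - γ 0, e⟫ with hx
  set x' : ℝ → ℝ := fun t => ⟪T t, e⟫ with hx'
  set y : ℝ → ℝ := fun t => ⟪γ t - γ 0, rotJ e⟫ with hy
  set y' : ℝ → ℝ := fun t => ⟪T t, rotJ e⟫ with hy'
  have dx : ∀ t, HasDerivAt x (x' t) t := fun t => by
    simpa using ((hγ t).sub_const (γ 0)).inner ℝ (hasDerivAt_const t e)
  have dy : ∀ t, HasDerivAt y (y' t) t := fun t => by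
    simpa using ((hγ t).sub_const (γ 0)).inner ℝ (hasDerivAt_const t (rotJ e))
  have cx' : Continuous x' := by fun_prop
  have cy' : Continuous y' := by fun_prop
  have cx : Continuous x := by fun_prop
  have cy : Continuous y := by fun_prop
  have hunit : ∀ t, x' t ^ 2 + y' t ^ 2 = 1 := by
    intro t
    have h1 : T t 0 ^ 2 + T t 1 ^ 2 = 1 := by rw [← E2_norm_sq, hu]; norm_num
    simp only [hx', hy', E2_inner, rotJ_zero, rotJ_one]
    linear_combination (T t 0 ^ 2 + T t 1 ^ 2) * he2 + h1
  have main := integral_mul_deriv_le (l := L / 2) (by positivity) dy cx' cy' hunit (by simp [hy])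
    hae (by rw [mul_div_cancel₀ _ (two_ne_zero)]; simp [hy, hper])
  rw [mul_div_cancel₀ _ (two_ne_zero)] at main
  have hpt : ∀ t, ⟪γ t, rotJ (T t)⟫ = y t * x' t - x t * y' t + ⟪γ 0, rotJ (T t)⟫ := by
    intro t
    simp only [hx, hx', hy, hy', E2_inner, rotJ_zero, rotJ_one, PiLp.sub_apply]
    linear_combination (-(γ t 0 - γ 0 0) * T t 1 + (γ t 1 - γ 0 1) * T t 0) * (-he2)
  have hparts : ∫ t in (0:ℝ)..L, x t * y' t = - ∫ t in (0:ℝ)..L, y t * x' t := by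
    rw [intervalIntegral.integral_mul_deriv_eq_deriv_mul (fun t _ => dx t) (fun t _ => dy t)
      (cx'.intervalIntegrable _ _) (cy'.intervalIntegrable _ _)]
    simp [hx, hy, hper, mul_comm]
  have hconst : ∫ t in (0:ℝ)..L, ⟪γ 0, rotJ (T t)⟫ = 0 := by
    have hd : ∀ t, HasDerivAt (fun t => ⟪γ 0, rotJ (γ t)⟫) ⟪γ 0, rotJ (T t)⟫ t := fun t => by
      simpa using (hasDerivAt_const t (γ 0)).inner ℝ
        (rotJ.hasFDerivAt.comp_hasDerivAt t (hγ t))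
    rw [intervalIntegral.integral_eq_sub_of_hasDerivAt (fun t _ => hd t)
      ((by fun_prop : Continuous _).intervalIntegrable _ _), hper, sub_self]
  simp_rw [hpt]
  rw [intervalIntegral.integral_add,
    intervalIntegral.integral_sub, hparts, hconst]
  · linarith
  all_goals exact (by fun_prop : Continuous _).intervalIntegrable _ _

theorem le_pi_of_sin_nonneg {φ : ℝ → ℝ} {a b : ℝ} (hab : a ≤ b) (hφ : Continuous φ)
    (hs : ∀ t ∈ Icc a b, 0 ≤ Real.sin (φ t)) (ha : φ a ≤ Real.pi) : φ b ≤ Real.pi := by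
  by_contra! hb
  have hpi := Real.pi_pos
  set v : ℝ := (Real.pi + min (φ b) (2 * Real.pi)) / 2 with hv
  have h1 : Real.pi < min (φ b) (2 * Real.pi) := lt_min hb (by linarith)
  have h2 := min_le_left (φ b) (2 * Real.pi)
  have h3 := min_le_right (φ b) (2 * Real.pi)
  obtain ⟨t, ht, htv⟩ := intermediate_value_Icc hab hφ.continuousOn
    (show v ∈ Icc (φ a) (φ b) from ⟨by rw [hv]; linarith, by rw [hv]; linarith⟩)
  have h4 : 0 < Real.sin (v - Real.pi) :=
    Real.sin_pos_of_pos_of_lt_pi (by rw [hv]; linarith) (by rw [hv]; linarith)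
  have := hs t ht
  rw [htv] at this
  rw [Real.sin_sub_pi] at h4
  linarith

/-- The easy half of Hopf's Umlaufsatz: the total curvature of a simple closed curve is at
most `2π`. -/
theorem total_curvature_le {z w : ℝ → ℂ} {β : ℝ → ℝ} {L : ℝ} (hL : 0 < L)
    (hz : ∀ t, HasDerivAt z (w t) t)
    (hw : ∀ t, HasDerivAt w (Complex.I * β t * w t) t) (hβ : Continuous β)
    (hu : ∀ t, ‖w t‖ = 1) (hper : ∀ t, z (t + L) = z t)
    (hinj : ∀ s d, 0 < d → d < L → z (s + d) ≠ z s)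
    (hmin : ∀ t, (z 0).im ≤ (z t).im) :
    ∫ t in (0:ℝ)..L, β t ≤ 2 * Real.pi := by
  have hwc : Continuous w := continuous_iff_continuousAt.2 fun t => (hw t).continuousAt
  set I : ℝ → ℝ → ℂ := fun s d => ∫ τ in (0:ℝ)..1, w (s + τ * d) with hI
  have hIc : Continuous fun p : ℝ × ℝ => I p.1 p.2 := by
    apply intervalIntegral.continuous_parametric_intervalIntegral_of_continuous'
    fun_prop
  have hId : ∀ s d : ℝ, (d : ℂ) * I s d = z (s + d) - z s := by
    intro s d
    rw [hI]
    simp only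
    rw [← intervalIntegral.integral_const_mul]
    have := intervalIntegral.integral_eq_sub_of_hasDerivAt (a := 0) (b := 1)
      (f := fun τ => z (s + τ * d)) (f' := fun τ => d • w (s + τ * d)) ?_ ?_
    · simp only [Complex.real_smul] at this; rw [this]; simp
    · intro τ _
      have h1 : HasDerivAt (fun τ : ℝ => s + τ * d) d τ := by
        simpa using ((hasDerivAt_id τ).mul_const d).const_add s
      exact (hz (s + τ * d)).scomp τ h1
    · exact (by fun_prop : Continuous fun τ : ℝ => d • w (s + τ * d)).intervalIntegrable _ _
  have hI0 : ∀ s, I s 0 = w s := by intro s; simp [hI]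
  have hIL : ∀ s, I s L = 0 := by
    intro s
    have := hId s L
    rw [hper, sub_self] at this
    rcases mul_eq_zero.1 this with h | h
    · exact absurd (by exact_mod_cast h) hL.ne'
    · exact h
  set S : ℝ → ℝ → ℂ := fun s d => I s d - I (s + d) (L - d) with hS
  have hS0 : ∀ s, S s 0 = w s := by intro s; simp [hS, hI0, hIL]
  have hSL : ∀ s, S s L = -w (s + L) := by intro s; simp [hS, hI0, hIL]
  have hSd : ∀ s d, 0 < d → d < L → S s d =
        ((1 / d + 1 / (L - d) : ℝ) : ℂ) * (z (s + d) - z s) := by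
    intro s d h0 h1
    have e1 := hId s d
    have e2 := hId (s + d) (L - d)
    have e3 : s + d + (L - d) = s + L := by ring
    rw [e3, hper] at e2
    have hd : (d : ℂ) ≠ 0 := by exact_mod_cast h0.ne'
    have hd' : ((L - d : ℝ) : ℂ) ≠ 0 := by exact_mod_cast (sub_pos.2 h1).ne'
    have f1 : I s d = (z (s + d) - z s) / d := by rw [← e1]; field_simp
    have f2 : I (s + d) (L - d) = (z s - z (s + d)) / ((L - d : ℝ) : ℂ) := by
      rw [← e2]; field_simp
    simp only [hS, f1, f2]
    push_cast at hd' ⊢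
    field_simp
    ring
  have hwne : ∀ s, w s ≠ 0 := fun s h => by have := hu s; rw [h] at this; simp at this
  have hSne : ∀ s d, 0 ≤ d → d ≤ L → S s d ≠ 0 := by
    intro s d h0 h1
    rcases h0.eq_or_lt with rfl | h0
    · rw [hS0]; exact hwne s
    rcases h1.eq_or_lt with rfl | h1
    · rw [hSL]; exact neg_ne_zero.2 (hwne _)
    rw [hSd s d h0 h1]
    refine mul_ne_zero ?_ (sub_ne_zero.2 (hinj s d h0 h1))
    have : 0 < 1 / d + 1 / (L - d) := by
      have := sub_pos.2 h1; positivity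
    exact_mod_cast this.ne'
  have hSc : Continuous fun p : ℝ × ℝ => S p.1 p.2 := by
    have : Continuous fun p : ℝ × ℝ => I (p.1 + p.2) (L - p.2) :=
      hIc.comp (by fun_prop : Continuous fun p : ℝ × ℝ => (p.1 + p.2, L - p.2))
    exact hIc.sub this
  set cl : ℝ → ℝ := fun d => max 0 (min d L) with hcl
  have hclc : Continuous cl := by fun_prop
  have hcl0 : ∀ d, 0 ≤ cl d := fun d => le_max_left _ _
  have hclL : ∀ d, cl d ≤ L := fun d => max_le hL.le (min_le_right _ _)
  have hcleq : ∀ d, 0 ≤ d → d ≤ L → cl d = d := by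
    intro d h0 h1; simp [hcl, h0, h1]
  have hSne' : ∀ p : ℝ × ℝ, S p.1 (cl p.2) ≠ 0 := fun p => hSne _ _ (hcl0 _) (hclL _)
  have hSc' : Continuous fun p : ℝ × ℝ => S p.1 (cl p.2) :=
    hSc.comp (by fun_prop : Continuous fun p : ℝ × ℝ => (p.1, cl p.2))
  let Q : C(ℝ × ℝ, Circle) :=
    { toFun := fun p => (⟨S p.1 (cl p.2) / (‖S p.1 (cl p.2)‖ : ℂ), by
        show _ ∈ Metric.sphere (0 : ℂ) 1
        rw [mem_sphere_zero_iff_norm, norm_div, Complex.norm_real, norm_norm]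
        exact div_self (norm_ne_zero_iff.2 (hSne' p))⟩ : Circle)
      continuous_toFun := by
        refine Continuous.subtype_mk ?_ _
        exact hSc'.div (Complex.continuous_ofReal.comp hSc'.norm)
          (fun p => by exact_mod_cast norm_ne_zero_iff.2 (hSne' p)) }
  obtain ⟨α, ⟨hα0, hα⟩, -⟩ := Circle.isCoveringMap_exp.existsUnique_continuousMap_lifts Q (0, 0)
    (Complex.arg (Q (0, 0))) (Circle.exp_arg _)
  have hαS : ∀ s d, 0 ≤ d → d ≤ L → S s d = ‖S s d‖ * Complex.exp (α (s, d) * Complex.I) := by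
    intro s d h0 h1
    have h2 : Circle.exp (α (s, d)) = Q (s, d) := congrFun hα (s, d)
    have h3 := congrArg (fun z : Circle => (z : ℂ)) h2
    have h4 : ((Q (s, d) : Circle) : ℂ) = S s (cl d) / (‖S s (cl d)‖ : ℂ) := rfl
    rw [hcleq d h0 h1] at h4
    simp only [Circle.coe_exp, h4] at h3
    rw [h3]
    have : (‖S s d‖ : ℂ) ≠ 0 := by exact_mod_cast norm_ne_zero_iff.2 (hSne s d h0 h1)
    field_simp
  have him : ∀ s d, 0 ≤ d → d ≤ L → (S s d).im = ‖S s d‖ * Real.sin (α (s, d)) := by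
    intro s d h0 h1
    conv_lhs => rw [hαS s d h0 h1]
    rw [Complex.im_ofReal_mul, Complex.exp_ofReal_mul_I_im]
  have hnp : ∀ s d, 0 ≤ d → d ≤ L → 0 < ‖S s d‖ := fun s d h0 h1 => norm_pos_iff.2 (hSne s d h0 h1)
  have hw0 : (w 0).im = 0 := by
    have h1 : HasDerivAt (fun t => (z t).im) (w 0).im 0 :=
      Complex.imCLM.hasFDerivAt.comp_hasDerivAt (0 : ℝ) (hz 0)
    exact IsLocalMin.hasDerivAt_eq_zero (Eventually.of_forall hmin) h1
  have hwper : ∀ t, w (t + L) = w t := by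
    intro t
    have h1 := (hz (t + L)).scomp t ((hasDerivAt_id t).add_const L)
    have h2 : (z ∘ fun y => id y + L) = z := by funext y; simp [hper]
    rw [h2, one_smul] at h1
    exact h1.unique (hz t)
  have hpos1 : ∀ d, 0 ≤ d → d ≤ L → 0 ≤ (S 0 d).im := by
    intro d h0 h1
    rcases h0.eq_or_lt with rfl | h0
    · rw [hS0, hw0]
    rcases h1.eq_or_lt with rfl | h1
    · rw [hSL, hwper, Complex.neg_im, hw0, neg_zero]
    rw [hSd 0 d h0 h1, Complex.im_ofReal_mul]
    have := sub_pos.2 h1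
    refine mul_nonneg (by positivity) ?_
    rw [Complex.sub_im, zero_add]
    linarith [hmin d]
  have hpos2 : ∀ d, 0 ≤ d → d ≤ L → (S d (L - d)).im ≤ 0 := by
    intro d h0 h1
    rcases h0.eq_or_lt with rfl | h0
    · rw [sub_zero, hSL, hwper, Complex.neg_im, hw0, neg_zero]
    rcases h1.eq_or_lt with rfl | h1
    · rw [sub_self, hS0]
      have := hwper 0
      rw [zero_add] at this
      rw [this, hw0]
    rw [hSd d (L - d) (by linarith) (by linarith), Complex.im_ofReal_mul]
    have := sub_pos.2 h1
    have h3 : 0 < L - (L - d) := by linarith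
    refine mul_nonpos_of_nonneg_of_nonpos (by positivity) ?_
    have h4 := hper 0
    rw [zero_add] at h4
    rw [Complex.sub_im, add_sub_cancel, h4]
    linarith [hmin d]
  have hαc : Continuous α := α.continuous
  have h00 : 0 ≤ α (0, 0) ∧ α (0, 0) ≤ Real.pi := by
    rw [hα0]
    refine ⟨Complex.arg_nonneg_iff.2 ?_, Complex.arg_le_pi _⟩
    have h4 : ((Q (0, 0) : Circle) : ℂ) = S 0 (cl 0) / (‖S 0 (cl 0)‖ : ℂ) := rfl
    rw [h4, hcleq 0 le_rfl hL.le, hS0, Complex.div_ofReal_im, hw0, zero_div]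
  have h0L : α (0, L) ≤ Real.pi := by
    refine le_pi_of_sin_nonneg (φ := fun d => α (0, d)) hL.le (by fun_prop) ?_ h00.2
    intro d hd
    have h5 := hpos1 d hd.1 hd.2
    rw [him 0 d hd.1 hd.2] at h5
    exact nonneg_of_mul_nonneg_right h5 (hnp _ _ hd.1 hd.2)
  have hL0 : α (L, 0) - Real.pi ≤ Real.pi := by
    have := le_pi_of_sin_nonneg (φ := fun d => α (d, L - d) - Real.pi) hL.le (by fun_prop) ?_
      (by simp only [sub_zero]; linarith [Real.pi_pos])
    · simpa using this
    intro d hd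
    have h5 := hpos2 d hd.1 hd.2
    rw [him d (L - d) (by linarith [hd.2]) (by linarith [hd.1])] at h5
    have h6 := hnp d (L - d) (by linarith [hd.2]) (by linarith [hd.1])
    rw [Real.sin_sub_pi]
    nlinarith
  set θ : ℝ → ℝ := fun s => ∫ t in (0:ℝ)..s, β t with hθ
  have hθd : ∀ s, HasDerivAt θ (β s) s := fun s =>
    intervalIntegral.integral_hasDerivAt_right (hβ.intervalIntegrable _ _)
      hβ.stronglyMeasurable.stronglyMeasurableAtFilter hβ.continuousAt
  have hθc : Continuous θ := continuous_iff_continuousAt.2 fun t => (hθd t).continuousAt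
  have hwθ : ∀ s, w s = w 0 * Complex.exp (θ s * Complex.I) := by
    have hd : ∀ s, HasDerivAt (fun s => w s * Complex.exp (-(θ s * Complex.I))) 0 s := by
      intro s
      have h1 : HasDerivAt (fun s => -((θ s : ℂ) * Complex.I)) (-((β s : ℂ) * Complex.I)) s :=
        (((hθd s).ofReal_comp).mul_const Complex.I).neg
      have := (hw s).mul h1.cexp
      refine this.congr_deriv ?_
      ring
    intro s
    have := is_const_of_deriv_eq_zero (fun s => (hd s).differentiableAt) (fun s => (hd s).deriv) s 0
    have h0 : θ 0 = 0 := by simp [hθ]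
    simp only [h0, Complex.ofReal_zero, zero_mul, neg_zero, Complex.exp_zero, mul_one] at this
    rw [← this, mul_assoc, ← Complex.exp_add]
    simp
  have key : θ L + α (0, 0) - α (L, 0) + Real.pi ≤ Real.pi := by
    refine le_pi_of_sin_nonneg (φ := fun s => θ s + α (0, 0) - α (s, 0) + Real.pi) hL.le
      (by fun_prop) ?_ (by simp [hθ])
    intro s _
    have e1 := hαS s 0 le_rfl hL.le
    have e2 := hαS 0 0 le_rfl hL.le
    rw [hS0, hu, Complex.ofReal_one, one_mul] at e1 e2
    have e3 := hwθ s
    rw [e1, e2, ← Complex.exp_add] at e3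
    have e4 : Complex.exp (((θ s + α (0, 0) - α (s, 0) : ℝ) : ℂ) * Complex.I) = 1 := by
      push_cast
      rw [sub_mul, Complex.exp_sub, add_mul, add_comm, ← e3, div_self (Complex.exp_ne_zero _)]
    have e5 := congrArg Complex.im e4
    rw [Complex.exp_ofReal_mul_I_im, Complex.one_im] at e5
    rw [Real.sin_add_pi, e5, neg_zero]
  have : θ L = ∫ t in (0:ℝ)..L, β t := rfl
  linarith [h00.1]

/-- A simple closed curve of length `L` with curvature at least `b` satisfies `b L ≤ 2π`. -/
theorem curvature_bound_mul_length_le {γ T : ℝ → E2} {β : ℝ → ℝ} {L b : ℝ} (hL : 0 < L)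
    (hγ : ∀ t, HasDerivAt γ (T t) t) (hT : ∀ t, HasDerivAt T (β t • rotJ (T t)) t)
    (hβ : Continuous β) (hu : ∀ t, ‖T t‖ = 1) (hper : ∀ t, γ (t + L) = γ t)
    (hinj : ∀ s d, 0 < d → d < L → γ (s + d) ≠ γ s) (hb : ∀ t, b ≤ β t) :
    b * L ≤ 2 * Real.pi := by
  have hγc : Continuous γ := continuous_iff_continuousAt.2 fun t => (hγ t).continuousAt
  obtain ⟨t₀, -, ht₀⟩ := isCompact_Icc.exists_isMinOn (nonempty_Icc.2 hL.le)
    (f := fun t => γ t 1) (by fun_prop)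
  have hmin : ∀ t, γ t₀ 1 ≤ γ t 1 := by
    intro t
    obtain ⟨y, hy, hyt⟩ := Function.Periodic.exists_mem_Ico₀ (f := γ) hper hL t
    rw [hyt]
    exact ht₀ ⟨hy.1, hy.2.le⟩
  set c : E2 → ℂ := fun v => v 0 + v 1 * Complex.I with hc
  have hcJ : ∀ v, c (rotJ v) = Complex.I * c v := by
    intro v
    simp only [hc, rotJ_zero, rotJ_one]
    push_cast
    linear_combination (v 1 : ℂ) * (-Complex.I_mul_I)
  have hcs : ∀ (a : ℝ) v, c (a • v) = a * c v := by
    intro a v; simp [hc]; ring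
  have hcinj : ∀ v w, c v = c w → v = w := by
    intro v w h
    have h0 := congrArg Complex.re h
    have h1 := congrArg Complex.im h
    simp [hc] at h0 h1
    ext i; fin_cases i
    · exact h0
    · exact h1
  have hcd : ∀ {f : ℝ → E2} {f' : E2} {t : ℝ}, HasDerivAt f f' t →
      HasDerivAt (fun t => c (f t)) (c f') t := by
    intro f f' t h
    exact (hasDerivAt_E2_coord h 0).ofReal_comp.add
      ((hasDerivAt_E2_coord h 1).ofReal_comp.mul_const Complex.I)
  have hshift : ∀ {f : ℝ → ℂ} {f' : ℂ} {t : ℝ}, HasDerivAt f f' (t₀ + t) →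
      HasDerivAt (fun t => f (t₀ + t)) f' t := by
    intro f f' t h
    simpa using h.comp_const_add t₀ t
  have hnorm : ∀ v, ‖c v‖ = ‖v‖ := by
    intro v
    rw [← sq_eq_sq₀ (norm_nonneg _) (norm_nonneg _), E2_norm_sq, Complex.sq_norm,
      Complex.normSq_apply]
    simp [hc]; ring
  have key := total_curvature_le (z := fun t => c (γ (t₀ + t))) (w := fun t => c (T (t₀ + t)))
    (β := fun t => β (t₀ + t)) hL (fun t => hshift (hcd (hγ _)))
    (fun t => by
      have := hshift (hcd (hT (t₀ + t)))
      refine this.congr_deriv ?_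
      rw [hcs, hcJ]; ring)
    (by fun_prop) (fun t => by rw [hnorm, hu])
    (fun t => by simp only [← add_assoc, hper])
    (fun s d h0 h1 h => hinj (t₀ + s) d h0 h1 (by
      have := hcinj _ _ h
      rwa [← add_assoc] at this))
    (fun t => by simpa [hc] using hmin (t₀ + t))
  refine le_trans ?_ key
  have := intervalIntegral.integral_mono_on (μ := volume) (a := 0) (b := L) (f := fun _ => b)
    (g := fun t => β (t₀ + t)) hL.le (continuous_const.intervalIntegrable _ _)
    ((by fun_prop : Continuous fun t => β (t₀ + t)).intervalIntegrable _ _) (fun t _ => hb _)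
  simpa only [intervalIntegral.integral_const, sub_zero, smul_eq_mul, mul_comm L] using this

/-- Rays pointing into a sublevel set stay in it for a short time. -/
theorem eventually_ray_neg {f : E2 → ℝ} {x w : E2} (hf : DifferentiableAt ℝ f x)
    (hx : f x ≤ 0) (hw : fderiv ℝ f x w < 0) : ∀ᶠ t : ℝ in 𝓝[>] 0, f (x + t • w) < 0 := by
  have h1 : HasDerivAt (fun t : ℝ => f (x + t • w)) (fderiv ℝ f x w) 0 := by
    have h2 : HasDerivAt (fun t : ℝ => x + t • w) w 0 := by
      simpa using ((hasDerivAt_id (0 : ℝ)).smul_const w).const_add x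
    have h3 : HasFDerivAt f (fderiv ℝ f x) (x + (0 : ℝ) • w) := by simpa using hf.hasFDerivAt
    exact h3.comp_hasDerivAt (0 : ℝ) h2
  have h2 := h1.hasDerivWithinAt (s := Ioi 0)
  rw [hasDerivWithinAt_iff_tendsto_slope' (by simp)] at h2
  filter_upwards [h2.eventually (gt_mem_nhds hw), self_mem_nhdsWithin] with t ht ht0
  rw [slope_def_field, sub_zero, zero_smul, add_zero] at ht
  have := (div_neg_iff.1 ht)
  have ht0' : (0 : ℝ) < t := ht0
  rcases this with h | h <;> linarith [h.1, h.2]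

theorem exists_fderiv_neg {f' : E2 →L[ℝ] ℝ} (h : f' ≠ 0) : ∃ w, f' w < 0 := by
  obtain ⟨w, hw⟩ : ∃ w, f' w ≠ 0 := by
    by_contra! hc
    exact h (ContinuousLinearMap.ext hc)
  rcases lt_or_gt_of_ne hw with h | h
  · exact ⟨w, h⟩
  · exact ⟨-w, by simpa using h⟩

namespace SmoothBoundary

variable {Ω : Set E2}

theorem eventually_ray_mem (hΩ : SmoothBoundary Ω) {x : E2} (hx : x ∈ frontier Ω) :
    ∃ f' : E2 →L[ℝ] ℝ, f' ≠ 0 ∧ ∀ w, f' w < 0 → ∀ᶠ t : ℝ in 𝓝[>] 0, x + t • w ∈ Ω := by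
  obtain ⟨U, f, hU, hxU, hf, hf', hΩU, hFU⟩ := hΩ x hx
  refine ⟨fderiv ℝ f x, hf' x hxU, fun w hw => ?_⟩
  have hfx : f x = 0 := by
    have : x ∈ frontier Ω ∩ U := ⟨hx, hxU⟩
    rw [hFU] at this; exact this.2
  have h1 : Tendsto (fun t : ℝ => x + t • w) (𝓝[>] 0) (𝓝 x) := by
    have : Continuous fun t : ℝ => x + t • w := by fun_prop
    have := this.tendsto 0
    rw [zero_smul, add_zero] at this
    exact this.mono_left nhdsWithin_le_nhds
  filter_upwards [eventually_ray_neg (hf.differentiable (by simp) x) hfx.le hw,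
    h1.eventually (hU.mem_nhds hxU)] with t ht htU
  have : x + t • w ∈ {y | y ∈ U ∧ f y < 0} := ⟨htU, ht⟩
  rw [← hΩU] at this
  exact this.1

theorem uniqueDiffOn_closure (hΩ : SmoothBoundary Ω) (hO : IsOpen Ω) :
    UniqueDiffOn ℝ (closure Ω) := by
  intro x hx
  by_cases hxΩ : x ∈ Ω
  · exact (hO.uniqueDiffWithinAt hxΩ).mono subset_closure
  have hxf : x ∈ frontier Ω := by rw [hO.frontier_eq]; exact ⟨hx, hxΩ⟩
  obtain ⟨f', hf', hray⟩ := hΩ.eventually_ray_mem hxf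
  have hsub : {w | f' w < 0} ⊆ tangentConeAt ℝ (closure Ω) x := by
    intro w hw
    refine mem_tangentConeAt_of_add_smul_mem (l := 𝓝[>] (0 : ℝ)) (c := id) ?_ ?_
    · exact tendsto_nhdsWithin_mono_right (fun t ht => ne_of_gt ht) tendsto_id
    · exact (hray w hw).mono fun t ht => subset_closure ht
  refine ⟨?_, by rwa [closure_closure]⟩
  have htop : Submodule.span ℝ (tangentConeAt ℝ (closure Ω) x) = ⊤ := by
    apply Submodule.eq_top_of_nonempty_interior'
    obtain ⟨w, hw⟩ := exists_fderiv_neg hf'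
    refine ⟨w, mem_interior.2 ⟨{w | f' w < 0}, fun v hv => Submodule.subset_span (hsub hv),
      isOpen_lt f'.continuous continuous_const, hw⟩⟩
  rw [htop]
  exact dense_univ

end SmoothBoundary

/-- The gradient of `u` computed within the closure of `Ω`. -/
def gC (Ω : Set E2) (u : E2 → ℝ) (x : E2) : E2 :=
  !₂[fderivWithin ℝ u (closure Ω) x (EuclideanSpace.single 0 1),
    fderivWithin ℝ u (closure Ω) x (EuclideanSpace.single 1 1)]

/-- The Hessian of `u` computed within the closure of `Ω`. -/
def hC (Ω : Set E2) (u : E2 → ℝ) (x : E2) : E2 →L[ℝ] E2 :=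
  fderivWithin ℝ (gC Ω u) (closure Ω) x

theorem E2_eq (w : E2) :
    w = w 0 • EuclideanSpace.single 0 (1 : ℝ) + w 1 • EuclideanSpace.single 1 (1 : ℝ) := by
  ext i; fin_cases i <;> simp

theorem gC_inner (Ω : Set E2) (u : E2 → ℝ) (x w : E2) :
    ⟪gC Ω u x, w⟫ = fderivWithin ℝ u (closure Ω) x w := by
  conv_rhs => rw [E2_eq w]
  rw [E2_inner, map_add, map_smul, map_smul]
  simp [gC, mul_comm]

namespace IsSerrinSolution

variable {Ω : Set E2} {u : E2 → ℝ}

theorem uniqueDiffOn (h : IsSerrinSolution Ω u) : UniqueDiffOn ℝ (closure Ω) :=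
  h.smoothBoundary.uniqueDiffOn_closure h.isOpen

theorem isCompact_closure (h : IsSerrinSolution Ω u) : IsCompact (closure Ω) :=
  h.bounded.isCompact_closure

theorem contDiffOn_gC (h : IsSerrinSolution Ω u) :
    ContDiffOn ℝ (⊤ : ℕ∞) (gC Ω u) (closure Ω) := by
  have h1 : ContDiffOn ℝ (⊤ : ℕ∞) (fderivWithin ℝ u (closure Ω)) (closure Ω) :=
    h.smooth.fderivWithin h.uniqueDiffOn (by simp)
  rw [contDiffOn_euclidean]
  intro i
  fin_cases i
  · exact h1.clm_apply contDiffOn_const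
  · exact h1.clm_apply contDiffOn_const

theorem continuousOn (h : IsSerrinSolution Ω u) : ContinuousOn u (closure Ω) :=
  h.smooth.continuousOn

theorem continuousOn_gC (h : IsSerrinSolution Ω u) : ContinuousOn (gC Ω u) (closure Ω) :=
  h.contDiffOn_gC.continuousOn

theorem continuousOn_hC (h : IsSerrinSolution Ω u) : ContinuousOn (hC Ω u) (closure Ω) :=
  (h.contDiffOn_gC.fderivWithin (m := 0) h.uniqueDiffOn (by simp)).continuousOn

theorem hasFDerivWithinAt (h : IsSerrinSolution Ω u) {x : E2} (hx : x ∈ closure Ω) :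
    HasFDerivWithinAt u (innerSL ℝ (gC Ω u x)) (closure Ω) x := by
  have h1 := (h.smooth.differentiableOn (by simp) x hx).hasFDerivWithinAt
  refine h1.congr_fderiv ?_
  ext w
  exact (gC_inner Ω u x w).symm

theorem hasFDerivWithinAt_gC (h : IsSerrinSolution Ω u) {x : E2} (hx : x ∈ closure Ω) :
    HasFDerivWithinAt (gC Ω u) (hC Ω u x) (closure Ω) x :=
  (h.contDiffOn_gC.differentiableOn (by simp) x hx).hasFDerivWithinAt

theorem mem_nhds (h : IsSerrinSolution Ω u) {x : E2} (hx : x ∈ Ω) : closure Ω ∈ 𝓝 x :=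
  mem_of_superset (h.isOpen.mem_nhds hx) subset_closure

theorem hasFDerivAt (h : IsSerrinSolution Ω u) {x : E2} (hx : x ∈ Ω) :
    HasFDerivAt u (innerSL ℝ (gC Ω u x)) x :=
  (h.hasFDerivWithinAt (subset_closure hx)).hasFDerivAt (h.mem_nhds hx)

theorem hasFDerivAt_gC (h : IsSerrinSolution Ω u) {x : E2} (hx : x ∈ Ω) :
    HasFDerivAt (gC Ω u) (hC Ω u x) x :=
  (h.hasFDerivWithinAt_gC (subset_closure hx)).hasFDerivAt (h.mem_nhds hx)

theorem fderiv_fderiv_eq (h : IsSerrinSolution Ω u) {x : E2} (hx : x ∈ Ω) (v w : E2) :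
    fderiv ℝ (fderiv ℝ u) x v w = ⟪hC Ω u x v, w⟫ := by
  have h1 : fderiv ℝ u =ᶠ[𝓝 x] fun y => innerSL ℝ (gC Ω u y) := by
    filter_upwards [h.isOpen.mem_nhds hx] with y hy
    exact (h.hasFDerivAt hy).fderiv
  rw [h1.fderiv_eq]
  have h2 : HasFDerivAt (fun y => innerSL ℝ (gC Ω u y))
      ((innerSL ℝ : E2 →L[ℝ] E2 →L[ℝ] ℝ).comp (hC Ω u x)) x :=
    (innerSL ℝ : E2 →L[ℝ] E2 →L[ℝ] ℝ).hasFDerivAt.comp x (h.hasFDerivAt_gC hx)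
  rw [h2.fderiv]
  rfl

theorem hC_symm (h : IsSerrinSolution Ω u) {x : E2} (hx : x ∈ Ω) (v w : E2) :
    ⟪hC Ω u x v, w⟫ = ⟪hC Ω u x w, v⟫ := by
  have h1 : ContDiffAt ℝ (⊤ : ℕ∞) u x := h.smooth.contDiffAt (h.mem_nhds hx)
  have h2 : IsSymmSndFDerivAt ℝ u x := h1.isSymmSndFDerivAt (by
    rw [minSmoothness_of_isRCLikeNormedField]; exact WithTop.coe_le_coe.2 (le_top (a := (2 : ℕ∞))))
  rw [← h.fderiv_fderiv_eq hx, ← h.fderiv_fderiv_eq hx]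
  exact h2 v w

theorem trace_hC_of_mem (h : IsSerrinSolution Ω u) {x : E2} (hx : x ∈ Ω) :
    hC Ω u x (EuclideanSpace.single 0 1) 0 + hC Ω u x (EuclideanSpace.single 1 1) 1 = -2 := by
  have h1 := h.pde x hx
  rw [lap, Fin.sum_univ_two, iteratedFDeriv_two_apply, iteratedFDeriv_two_apply] at h1
  simp only [Matrix.cons_val_zero, Matrix.cons_val_one, h.fderiv_fderiv_eq hx, E2_inner] at h1
  simpa using h1

theorem trace_hC (h : IsSerrinSolution Ω u) {x : E2} (hx : x ∈ closure Ω) :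
    hC Ω u x (EuclideanSpace.single 0 1) 0 + hC Ω u x (EuclideanSpace.single 1 1) 1 = -2 := by
  have hcont : ContinuousOn (fun x => hC Ω u x (EuclideanSpace.single 0 1) 0 +
      hC Ω u x (EuclideanSpace.single 1 1) 1) (closure Ω) := by
    have := h.continuousOn_hC
    fun_prop
  exact (EqOn.of_subset_closure (fun y hy => h.trace_hC_of_mem hy) hcont continuousOn_const
    subset_closure le_rfl) hx

theorem trace_hC_unit (h : IsSerrinSolution Ω u) {x : E2} (hx : x ∈ closure Ω) {n : E2}
    (hn : ‖n‖ = 1) : ⟪hC Ω u x n, n⟫ + ⟪hC Ω u x (rotJ n), rotJ n⟫ = -2 := by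
  have h1 := h.trace_hC hx
  have h2 : n 0 ^ 2 + n 1 ^ 2 = 1 := by rw [← E2_norm_sq, hn, one_pow]
  rw [E2_eq n, E2_eq (rotJ _)]
  simp only [E2_inner, map_add, map_smul]
  simp
  linear_combination h1 * (n 0 ^ 2 + n 1 ^ 2) + (-2 : ℝ) * h2

/-- `u` has no local minimum inside `Ω`. -/
theorem not_isLocalMin (h : IsSerrinSolution Ω u) {x : E2} (hx : x ∈ Ω) : ¬ IsLocalMin u x := by
  intro hmin
  have hg : gC Ω u x = 0 := by
    have := hmin.hasFDerivAt_eq_zero (h.hasFDerivAt hx)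
    have h2 := congrArg (fun f : E2 →L[ℝ] ℝ => f (gC Ω u x)) this
    simpa using h2
  have hdir : ∀ e : E2, 0 ≤ ⟪hC Ω u x e, e⟫ := by
    intro e
    by_contra! hneg
    have hl : ∀ᶠ t : ℝ in 𝓝 0, x + t • e ∈ Ω := by
      have : Continuous fun t : ℝ => x + t • e := by fun_prop
      have := this.tendsto 0
      rw [zero_smul, add_zero] at this
      exact this.eventually (h.isOpen.mem_nhds hx)
    have hline : ∀ t : ℝ, HasDerivAt (fun t : ℝ => x + t • e) e t := fun t => by
      simpa using ((hasDerivAt_id t).smul_const e).const_add x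
    have h1 : ∀ᶠ t : ℝ in 𝓝 0, HasDerivAt (fun t => u (x + t • e)) ⟪gC Ω u (x + t • e), e⟫ t := by
      filter_upwards [hl] with t ht
      exact (h.hasFDerivAt ht).comp_hasDerivAt t (hline t)
    have h2 : HasDerivAt (fun t : ℝ => ⟪gC Ω u (x + t • e), e⟫) ⟪hC Ω u x e, e⟫ 0 := by
      have h3 : HasFDerivAt (gC Ω u) (hC Ω u x) (x + (0 : ℝ) • e) := by
        simpa using h.hasFDerivAt_gC hx
      have h4 := h3.comp_hasDerivAt (0 : ℝ) (hline 0)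
      simpa using h4.inner ℝ (hasDerivAt_const (0 : ℝ) e)
    have hmax : IsLocalMax (fun t : ℝ => u (x + t • e)) 0 := by
      have hd : deriv (fun t : ℝ => u (x + t • e)) =ᶠ[𝓝 0] fun t => ⟪gC Ω u (x + t • e), e⟫ := by
        filter_upwards [h1] with t ht using ht.deriv
      apply isLocalMax_of_deriv_deriv_neg
      · rw [hd.deriv_eq, h2.deriv]; exact hneg
      · rw [hd.eq_of_nhds]; simp [hg]
      · exact h1.self_of_nhds.continuousAt
    have hmin' : IsLocalMin (fun t : ℝ => u (x + t • e)) 0 := by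
      have : ContinuousAt (fun t : ℝ => x + t • e) 0 := by fun_prop
      have hm : IsLocalMin u (x + (0 : ℝ) • e) := by simpa using hmin
      exact this.eventually hm
    have hconst : (fun t : ℝ => u (x + t • e)) =ᶠ[𝓝 0] fun _ => u (x + (0 : ℝ) • e) := by
      filter_upwards [hmax, hmin'] with t h1 h2 using le_antisymm h1 h2
    have h5 : ∀ᶠ t : ℝ in 𝓝 0, ⟪gC Ω u (x + t • e), e⟫ = 0 := by
      filter_upwards [hconst.eventuallyEq_nhds, h1] with t ht1 ht2
      have := ht1.deriv_eq
      rw [ht2.deriv, deriv_const] at this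
      exact this
    have h6 : HasDerivAt (fun t : ℝ => ⟪gC Ω u (x + t • e), e⟫) 0 0 :=
      (hasDerivAt_const (0 : ℝ) (0 : ℝ)).congr_of_eventuallyEq h5
    exact hneg.ne (h2.unique h6)
  have h1 := h.trace_hC_unit (subset_closure hx) (n := EuclideanSpace.single 0 1) (by simp)
  linarith [hdir (EuclideanSpace.single 0 1), hdir (rotJ (EuclideanSpace.single 0 1))]

theorem frontier_eq (h : IsSerrinSolution Ω u) : frontier Ω = closure Ω \ Ω :=
  h.isOpen.frontier_eq

theorem pos (h : IsSerrinSolution Ω u) {x : E2} (hx : x ∈ Ω) : 0 < u x := by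
  obtain ⟨y, hy, hmin⟩ := h.isCompact_closure.exists_isMinOn ⟨x, subset_closure hx⟩ h.continuousOn
  have hyΩ : y ∉ Ω := by
    intro hyΩ
    refine h.not_isLocalMin hyΩ ?_
    filter_upwards [h.mem_nhds hyΩ] with z hz using hmin hz
  have hy0 : u y = 0 := h.bdry y (by rw [h.frontier_eq]; exact ⟨hy, hyΩ⟩)
  have h0 : ∀ z ∈ closure Ω, 0 ≤ u z := fun z hz => hy0 ▸ hmin hz
  refine lt_of_le_of_ne (h0 x (subset_closure hx)) fun h1 => h.not_isLocalMin hx ?_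
  filter_upwards [h.mem_nhds hx] with z hz
  rw [← h1]; exact h0 z hz

theorem nonneg (h : IsSerrinSolution Ω u) {x : E2} (hx : x ∈ closure Ω) : 0 ≤ u x := by
  by_cases hxΩ : x ∈ Ω
  · exact (h.pos hxΩ).le
  · exact (h.bdry x (by rw [h.frontier_eq]; exact ⟨hx, hxΩ⟩)).ge

theorem le_umax (h : IsSerrinSolution Ω u) {x : E2} (hx : x ∈ closure Ω) : u x ≤ umax Ω u :=
  le_csSup (h.isCompact_closure.image_of_continuousOn h.continuousOn).bddAbove
    (mem_image_of_mem u hx)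

theorem umax_pos (h : IsSerrinSolution Ω u) : 0 < umax Ω u := by
  obtain ⟨x, hx⟩ := h.connected.nonempty
  exact (h.pos hx).trans_le (h.le_umax (subset_closure hx))

theorem gC_eq_zero_of_mem_MAXset (h : IsSerrinSolution Ω u) {x : E2} (hx : x ∈ MAXset Ω u) :
    gC Ω u x = 0 := by
  have hmax : IsLocalMax u x := by
    filter_upwards [h.mem_nhds hx.1] with y hy
    rw [hx.2]; exact h.le_umax hy
  have := hmax.hasFDerivAt_eq_zero (h.hasFDerivAt hx.1)
  have h2 := congrArg (fun f : E2 →L[ℝ] ℝ => f (gC Ω u x)) this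
  simpa using h2

theorem gradient_eq (h : IsSerrinSolution Ω u) {x : E2} (hx : x ∈ closure Ω)
    (hne : gradient u x ≠ 0) : gradient u x = gC Ω u x := by
  have hd : DifferentiableAt ℝ u x := by
    by_contra hd
    exact hne (gradient_eq_zero_of_not_differentiableAt hd)
  have h1 := hd.hasFDerivAt.hasFDerivWithinAt (s := closure Ω)
  have h2 := (h.uniqueDiffOn x hx).eq h1 (h.hasFDerivWithinAt hx)
  refine ext_inner_right ℝ fun v => ?_
  rw [inner_gradient_left, h2]
  rfl

end IsSerrinSolution

/-- A smooth domain is locally connected at its boundary points. -/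
theorem SmoothBoundary.exists_locally_preconnected {Ω : Set E2} (hΩ : SmoothBoundary Ω) {x : E2}
    (hx : x ∈ frontier Ω) {ρ : ℝ} (hρ : 0 < ρ) :
    ∃ q, ∃ δ > 0, ∀ y ∈ Ω ∩ Metric.ball x δ, ∃ C, IsPreconnected C ∧ C ⊆ Ω ∩ Metric.ball x ρ ∧
      y ∈ C ∧ q ∈ C := by
  obtain ⟨U, f, hU, hxU, hf, hf', hΩU, hFU⟩ := hΩ x hx
  have hfx : f x = 0 := by
    have : x ∈ frontier Ω ∩ U := ⟨hx, hxU⟩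
    rw [hFU] at this; exact this.2
  have hmem : ∀ y ∈ U, f y < 0 → y ∈ Ω := by
    intro y hy hfy
    have : y ∈ {y | y ∈ U ∧ f y < 0} := ⟨hy, hfy⟩
    rw [← hΩU] at this; exact this.1
  have hmem' : ∀ y ∈ U, y ∈ Ω → f y < 0 := by
    intro y hy hyΩ
    have : y ∈ Ω ∩ U := ⟨hyΩ, hy⟩
    rw [hΩU] at this; exact this.2
  obtain ⟨e, he⟩ := exists_fderiv_neg (hf' x hxU)
  have hfd : ∀ y, HasFDerivAt f (fderiv ℝ f y) y := fun y =>
    (hf.differentiable (by simp) y).hasFDerivAt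
  have hcont : Continuous fun y => fderiv ℝ f y e :=
    (hf.continuous_fderiv (by simp)).clm_apply continuous_const
  obtain ⟨r, hr, hrsub⟩ : ∃ r > 0, ∀ y ∈ Metric.ball x r, y ∈ U ∧ fderiv ℝ f y e < 0 := by
    have := (hU.eventually_mem hxU).and
      (hcont.continuousAt.eventually (gt_mem_nhds he))
    exact Metric.eventually_nhds_iff_ball.1 this
  set r' := min r ρ with hr'
  have hr'0 : 0 < r' := lt_min hr hρ
  have hene : e ≠ 0 := by rintro rfl; simp at he
  have hen : 0 < ‖e‖ := norm_pos_iff.2 hene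
  have hcurve : ∀ᶠ s : ℝ in 𝓝[>] 0, f (x + s • e) < 0 :=
    eventually_ray_neg (hfd x).differentiableAt hfx.le he
  have hsmall : ∀ᶠ s : ℝ in 𝓝[>] 0, s * ‖e‖ < r' / 2 := by
    have : Tendsto (fun s : ℝ => s * ‖e‖) (𝓝 0) (𝓝 0) := by
      have : Continuous fun s : ℝ => s * ‖e‖ := by fun_prop
      simpa using this.tendsto 0
    exact (this.mono_left nhdsWithin_le_nhds).eventually (gt_mem_nhds (by positivity))
  obtain ⟨s, hs1, hs2, hs0⟩ := (hcurve.and (hsmall.and self_mem_nhdsWithin)).exists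
  have hs0 : 0 < s := hs0
  obtain ⟨δ₁, hδ₁, hδ₁sub⟩ : ∃ δ₁ > 0, ∀ y ∈ Metric.ball (x + s • e) δ₁, f y < 0 := by
    have := hf.continuous.continuousAt.eventually (gt_mem_nhds hs1)
    exact Metric.eventually_nhds_iff_ball.1 this
  set δ := min δ₁ (r' / 2) with hδ
  have hδ0 : 0 < δ := lt_min hδ₁ (by positivity)
  have hline : ∀ y ∈ Metric.ball x δ, ∀ τ ∈ Icc 0 s, y + τ • e ∈ Metric.ball x r' := by
    intro y hy τ hτ
    rw [mem_ball_iff_norm] at hy ⊢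
    calc ‖y + τ • e - x‖ = ‖(y - x) + τ • e‖ := by congr 1; abel
      _ ≤ ‖y - x‖ + ‖τ • e‖ := norm_add_le _ _
      _ = ‖y - x‖ + τ * ‖e‖ := by rw [norm_smul, Real.norm_of_nonneg hτ.1]
      _ < r' / 2 + r' / 2 := by
        have h1 : τ * ‖e‖ ≤ s * ‖e‖ := mul_le_mul_of_nonneg_right hτ.2 hen.le
        have h2 := min_le_right δ₁ (r' / 2)
        linarith
      _ = r' := by ring
  have hr'r : Metric.ball x r' ⊆ Metric.ball x r := Metric.ball_subset_ball (min_le_left _ _)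
  have hr'ρ : Metric.ball x r' ⊆ Metric.ball x ρ := Metric.ball_subset_ball (min_le_right _ _)
  refine ⟨x + s • e, δ, hδ0, fun y hy => ?_⟩
  refine ⟨(fun τ : ℝ => y + τ • e) '' Icc 0 s ∪ (fun z => z + s • e) '' Metric.ball x δ,
    ?_, ?_, ?_, ?_⟩
  · refine IsPreconnected.union (y + s • e) ⟨s, ⟨hs0.le, le_rfl⟩, rfl⟩ ⟨y, hy.2, rfl⟩ ?_ ?_
    · exact isPreconnected_Icc.image _ (by fun_prop)
    · exact (convex_ball x δ).isPreconnected.image _ (by fun_prop)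
  · rintro z (⟨τ, hτ, rfl⟩ | ⟨z, hz, rfl⟩)
    · have h1 := hline y hy.2 τ hτ
      refine ⟨hmem _ (hrsub _ (hr'r h1)).1 ?_, hr'ρ h1⟩
      have h0 : f y < 0 := by
        have := hline y hy.2 0 ⟨le_rfl, hs0.le⟩
        rw [zero_smul, add_zero] at this
        exact hmem' y (hrsub y (hr'r this)).1 hy.1
      have hanti : AntitoneOn (fun τ : ℝ => f (y + τ • e)) (Icc 0 s) := by
        have hd : ∀ τ : ℝ, HasDerivAt (fun τ : ℝ => f (y + τ • e))
            (fderiv ℝ f (y + τ • e) e) τ := fun τ => by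
          have h2 : HasDerivAt (fun t : ℝ => y + t • e) e τ := by
            simpa using ((hasDerivAt_id τ).smul_const e).const_add y
          exact (hfd _).comp_hasDerivAt τ h2
        refine antitoneOn_of_deriv_nonpos (convex_Icc 0 s) ?_ ?_ ?_
        · exact fun τ _ => (hd τ).continuousAt.continuousWithinAt
        · exact fun τ _ => (hd τ).differentiableAt.differentiableWithinAt
        · intro τ hτ
          rw [(hd τ).deriv]
          exact (hrsub _ (hr'r (hline y hy.2 τ (interior_subset hτ)))).2.le
      have := hanti ⟨le_rfl, hs0.le⟩ hτ hτ.1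
      simp only [zero_smul, add_zero] at this
      exact this.trans_lt h0
    · have h1 := hline z hz s ⟨hs0.le, le_rfl⟩
      refine ⟨hmem _ (hrsub _ (hr'r h1)).1 (hδ₁sub _ ?_), hr'ρ h1⟩
      rw [mem_ball_iff_norm] at hz ⊢
      have := min_le_left δ₁ (r' / 2)
      rw [add_sub_add_right_eq_sub]
      linarith
  · exact Or.inl ⟨0, ⟨le_rfl, hs0.le⟩, by simp⟩
  · exact Or.inr ⟨x, Metric.mem_ball_self hδ0, rfl⟩

namespace IsSerrinSolution

variable {Ω N : Set E2} {u : E2 → ℝ}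

theorem isOpen_diff_MAXset (h : IsSerrinSolution Ω u) : IsOpen (Ω \ MAXset Ω u) := by
  have : Ω \ MAXset Ω u = Ω ∩ u ⁻¹' {umax Ω u}ᶜ := by
    ext x; simp [MAXset]
  rw [this]
  exact (h.continuousOn.mono subset_closure).isOpen_inter_preimage h.isOpen
    isOpen_compl_singleton

theorem isOpen_comp (h : IsSerrinSolution Ω u) (hN : IsCompOf N (Ω \ MAXset Ω u)) : IsOpen N := by
  obtain ⟨p, -, rfl⟩ := hN
  exact h.isOpen_diff_MAXset.connectedComponentIn

theorem comp_subset (hN : IsCompOf N (Ω \ MAXset Ω u)) : N ⊆ Ω \ MAXset Ω u := by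
  obtain ⟨p, -, rfl⟩ := hN
  exact connectedComponentIn_subset _ _

theorem mem_comp_of_isPreconnected (hN : IsCompOf N (Ω \ MAXset Ω u)) {C : Set E2}
    (hC : IsPreconnected C) (hCs : C ⊆ Ω \ MAXset Ω u) {x y : E2} (hx : x ∈ C) (hxN : x ∈ N)
    (hy : y ∈ C) : y ∈ N := by
  obtain ⟨p, -, rfl⟩ := hN
  rw [connectedComponentIn_eq hxN]
  exact hC.subset_connectedComponentIn hx hCs hy

theorem mem_comp_of_mem_closure (h : IsSerrinSolution Ω u) (hN : IsCompOf N (Ω \ MAXset Ω u))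
    {x : E2} (hx : x ∈ closure N) (hxΩ : x ∈ Ω) (hxm : u x ≠ umax Ω u) : x ∈ N := by
  have hx' : x ∈ Ω \ MAXset Ω u := ⟨hxΩ, fun hm => hxm hm.2⟩
  obtain ⟨r, hr, hrsub⟩ := Metric.isOpen_iff.1 h.isOpen_diff_MAXset x hx'
  obtain ⟨y, hy, hxy⟩ := Metric.mem_closure_iff.1 hx r hr
  exact mem_comp_of_isPreconnected hN (convex_ball x r).isPreconnected hrsub
    (by rwa [Metric.mem_ball, dist_comm]) hy (Metric.mem_ball_self hr)

theorem closure_comp_subset (hN : IsCompOf N (Ω \ MAXset Ω u)) : closure N ⊆ closure Ω :=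
  closure_mono ((comp_subset hN).trans sdiff_subset)

theorem frontier_inter_eq (h : IsSerrinSolution Ω u) (hN : IsCompOf N (Ω \ MAXset Ω u)) :
    frontier N ∩ frontier Ω = frontier Ω ∩ closure N := by
  rw [(h.isOpen_comp hN).frontier_eq, h.frontier_eq]
  ext x
  constructor
  · rintro ⟨⟨h1, h2⟩, h3⟩; exact ⟨h3, h1⟩
  · rintro ⟨⟨h1, h2⟩, h3⟩; exact ⟨⟨h3, fun hx => h2 (comp_subset hN hx).1⟩, h1, h2⟩

theorem isCompact_frontier_inter (h : IsSerrinSolution Ω u) :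
    IsCompact (frontier N ∩ frontier Ω) := by
  refine h.isCompact_closure.of_isClosed_subset (isClosed_frontier.inter isClosed_frontier) ?_
  exact inter_subset_right.trans frontier_subset_closure

theorem closure_comp_cases (h : IsSerrinSolution Ω u) (hN : IsCompOf N (Ω \ MAXset Ω u))
    {x : E2} (hx : x ∈ closure N) :
    x ∈ N ∨ x ∈ frontier N ∩ frontier Ω ∨ x ∈ MAXset Ω u := by
  by_cases hxΩ : x ∈ Ω
  · by_cases hm : u x = umax Ω u
    · exact Or.inr (Or.inr ⟨hxΩ, hm⟩)
    · exact Or.inl (h.mem_comp_of_mem_closure hN hx hxΩ hm)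
  · right; left
    rw [h.frontier_inter_eq hN, h.frontier_eq]
    exact ⟨⟨closure_comp_subset hN hx, hxΩ⟩, hx⟩

/-- Near `Γ_N`, the domain coincides with `N` and its boundary with `Γ_N`. -/
theorem exists_collar (h : IsSerrinSolution Ω u) (hN : IsCompOf N (Ω \ MAXset Ω u)) :
    ∃ δ > 0, ∀ x ∈ frontier N ∩ frontier Ω, ∀ y, dist y x < δ →
      (y ∈ Ω → y ∈ N) ∧ (y ∈ frontier Ω → y ∈ frontier N ∩ frontier Ω) := by
  have hloc : ∀ x ∈ frontier N ∩ frontier Ω, ∃ δ > 0, Ω ∩ Metric.ball x δ ⊆ N := by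
    intro x hx
    have hx' := hx
    rw [h.frontier_inter_eq hN] at hx'
    have hxc : x ∈ closure Ω := frontier_subset_closure hx.2
    have hu0 : u x = 0 := h.bdry x hx.2
    obtain ⟨ρ, hρ, hρsub⟩ : ∃ ρ > 0, ∀ y ∈ Metric.ball x ρ ∩ closure Ω, u y < umax Ω u := by
      have : ∀ᶠ y in 𝓝[closure Ω] x, u y < umax Ω u :=
        (h.continuousOn x hxc).eventually (gt_mem_nhds (by rw [hu0]; exact h.umax_pos))
      obtain ⟨ρ, hρ, hsub⟩ := Metric.mem_nhdsWithin_iff.1 this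
      exact ⟨ρ, hρ, fun y hy => hsub hy⟩
    obtain ⟨q, δ, hδ, hq⟩ := h.smoothBoundary.exists_locally_preconnected hx.2 hρ
    have hsub : Ω ∩ Metric.ball x ρ ⊆ Ω \ MAXset Ω u := fun y hy =>
      ⟨hy.1, fun hm => (hρsub y ⟨hy.2, subset_closure hy.1⟩).ne hm.2⟩
    obtain ⟨y₀, hy₀, hy₀x⟩ := Metric.mem_closure_iff.1 hx'.2 δ hδ
    obtain ⟨C, hC, hCs, hyC, hqC⟩ := hq y₀ ⟨(comp_subset hN hy₀).1, by
      rwa [Metric.mem_ball, dist_comm]⟩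
    have hqN : q ∈ N := mem_comp_of_isPreconnected hN hC (hCs.trans hsub) hyC hy₀ hqC
    refine ⟨δ, hδ, fun y hy => ?_⟩
    obtain ⟨C', hC', hCs', hyC', hqC'⟩ := hq y hy
    exact mem_comp_of_isPreconnected hN hC' (hCs'.trans hsub) hqC' hqN hyC'
  choose! d hd hdsub using hloc
  have hcover : frontier N ∩ frontier Ω ⊆ ⋃ x ∈ frontier N ∩ frontier Ω, Metric.ball x (d x) :=
    fun x hx => mem_iUnion₂.2 ⟨x, hx, Metric.mem_ball_self (hd x hx)⟩
  obtain ⟨δ, hδ, hsub⟩ := (h.isCompact_frontier_inter (N := N)).exists_thickening_subset_open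
    (isOpen_biUnion fun _ _ => Metric.isOpen_ball) hcover
  refine ⟨δ, hδ, fun x hx y hyx => ?_⟩
  have hy : y ∈ Metric.thickening δ (frontier N ∩ frontier Ω) :=
    Metric.mem_thickening_iff.2 ⟨x, hx, hyx⟩
  obtain ⟨x', hx', hyx'⟩ := mem_iUnion₂.1 (hsub hy)
  refine ⟨fun hyΩ => hdsub x' hx' ⟨hyΩ, hyx'⟩, fun hyF => ?_⟩
  rw [h.frontier_inter_eq hN]
  refine ⟨hyF, Metric.mem_closure_iff.2 fun ε hε => ?_⟩
  have hpos : 0 < d x' - dist y x' := sub_pos.2 hyx'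
  obtain ⟨z, hz, hyz⟩ := Metric.mem_closure_iff.1 (frontier_subset_closure hyF)
    (min ε (d x' - dist y x')) (lt_min hε hpos)
  refine ⟨z, hdsub x' hx' ⟨hz, ?_⟩, hyz.trans_le (min_le_left _ _)⟩
  rw [Metric.mem_ball]
  have h1 := hyz.trans_le (min_le_right _ _)
  have h2 := dist_triangle z y x'
  rw [dist_comm z y] at h2
  linarith

end IsSerrinSolution

/-- A linear functional whose negative half-plane lies in a half-plane `⟪g, w⟫ ≥ 0` is a negative
multiple of `⟪g, ·⟫`. -/
theorem exists_neg_multiple {f' : E2 →L[ℝ] ℝ} (hf' : f' ≠ 0) {g : E2} (hg : g ≠ 0)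
    (H : ∀ w, f' w < 0 → 0 ≤ ⟪g, w⟫) : ∃ κ > 0, ∀ w, f' w = -κ * ⟪g, w⟫ := by
  set a : E2 := !₂[f' (EuclideanSpace.single 0 1), f' (EuclideanSpace.single 1 1)] with ha
  have hfa : ∀ w, f' w = ⟪a, w⟫ := by
    intro w
    conv_lhs => rw [E2_eq w]
    rw [E2_inner, map_add, map_smul, map_smul]
    simp [ha, mul_comm]
  have hane : a ≠ 0 := by
    rintro h0
    exact hf' (ContinuousLinearMap.ext fun w => by rw [hfa, h0]; simp)
  have hap : 0 < ⟪a, a⟫ := real_inner_self_pos.2 hane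
  have hle : ∀ w, ⟪a, w⟫ ≤ 0 → 0 ≤ ⟪g, w⟫ := by
    intro w hw
    have hlim : Tendsto (fun ε : ℝ => ⟪g, w - ε • a⟫) (𝓝[>] 0) (𝓝 ⟪g, w⟫) := by
      have : Continuous fun ε : ℝ => ⟪g, w - ε • a⟫ := by fun_prop
      have := this.tendsto 0
      rw [zero_smul, sub_zero] at this
      exact this.mono_left nhdsWithin_le_nhds
    refine ge_of_tendsto hlim ?_
    filter_upwards [self_mem_nhdsWithin] with ε hε
    apply H
    rw [hfa, inner_sub_right, inner_smul_right]
    have := mul_pos (show (0 : ℝ) < ε from hε) hap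
    linarith
  have h1 := hle (rotJ a) (by rw [E2_inner]; simp; linarith)
  have h2 := hle (-rotJ a) (by rw [E2_inner]; simp; linarith)
  have h3 := hle (-a) (by rw [inner_neg_right]; linarith)
  rw [inner_neg_right] at h2 h3
  have h4 : ⟪g, rotJ a⟫ = 0 := le_antisymm (by linarith) h1
  have hgn : 0 < ⟪g, g⟫ := real_inner_self_pos.2 hg
  rw [E2_inner] at hap h3 h4 hgn
  simp only [rotJ_zero, rotJ_one] at h4
  have h5 : g 0 * a 0 + g 1 * a 1 < 0 := by
    refine lt_of_le_of_ne (by linarith) fun h0 => ?_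
    have : (a 0 * a 0 + a 1 * a 1) * (g 0 * g 0 + g 1 * g 1) = 0 := by
      linear_combination (g 0 * a 0 + g 1 * a 1) * h0 + (g 0 * -a 1 + g 1 * a 0) * h4
    exact (mul_pos hap hgn).ne' this
  refine ⟨-((a 0 * a 0 + a 1 * a 1) / (g 0 * a 0 + g 1 * a 1)),
    neg_pos.2 (div_neg_of_pos_of_neg hap h5), fun w => ?_⟩
  rw [hfa, E2_inner, E2_inner]
  rw [neg_neg, div_mul_eq_mul_div, eq_div_iff h5.ne]
  linear_combination (w 0 * a 1 - w 1 * a 0) * h4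

namespace IsSerrinSolution

variable {Ω N : Set E2} {u : E2 → ℝ}

theorem inner_gC_nonneg_of_ray (h : IsSerrinSolution Ω u) {x w : E2} (hx : x ∈ frontier Ω)
    (hw : ∀ᶠ t : ℝ in 𝓝[>] 0, x + t • w ∈ Ω) : 0 ≤ ⟪gC Ω u x, w⟫ := by
  have hxc : x ∈ closure Ω := frontier_subset_closure hx
  set S : Set ℝ := {t | x + t • w ∈ closure Ω}
  have hS : S ∈ 𝓝[>] (0 : ℝ) := hw.mono fun t ht => subset_closure ht
  have h1 : HasDerivWithinAt (fun t : ℝ => u (x + t • w)) ⟪gC Ω u x, w⟫ S 0 := by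
    have h2 : HasDerivWithinAt (fun t : ℝ => x + t • w) w S 0 := by
      simpa using (((hasDerivAt_id (0 : ℝ)).smul_const w).const_add x).hasDerivWithinAt (s := S)
    have h3 : HasFDerivWithinAt u (innerSL ℝ (gC Ω u x)) (closure Ω) (x + (0 : ℝ) • w) := by
      simpa using h.hasFDerivWithinAt hxc
    exact h3.comp_hasDerivWithinAt (0 : ℝ) h2 fun t ht => ht
  have h2 := h1.mono_of_mem_nhdsWithin hS
  rw [hasDerivWithinAt_iff_tendsto_slope' (by simp)] at h2
  refine ge_of_tendsto h2 ?_
  filter_upwards [hw, self_mem_nhdsWithin] with t ht ht0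
  rw [slope_def_field, zero_smul, add_zero, sub_zero, h.bdry x hx, sub_zero]
  exact div_nonneg (h.pos ht).le (le_of_lt ht0)

/-- A global defining function for `Ω` near `Γ_N`. -/
theorem exists_defining (h : IsSerrinSolution Ω u)
    (hne : ∀ x ∈ frontier N ∩ frontier Ω, gC Ω u x ≠ 0) :
    ∃ F : E2 → ℝ, ContDiff ℝ (⊤ : ℕ∞) F ∧ HasCompactSupport F ∧ (∀ y ∈ Ω, F y ≤ 0) ∧
      (∀ y ∉ Ω, 0 ≤ F y) ∧
      (∃ W, IsOpen W ∧ frontier N ∩ frontier Ω ⊆ W ∧ ∀ y ∈ W, F y = 0 → y ∈ frontier Ω) ∧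
      ∀ x ∈ frontier N ∩ frontier Ω, ∃ κ > 0, ∀ w, fderiv ℝ F x w = -κ * ⟪gC Ω u x, w⟫ := by
  suffices H : ∃ F : E2 → ℝ, ContDiff ℝ (⊤ : ℕ∞) F ∧ HasCompactSupport F ∧ (∀ y ∈ Ω, F y ≤ 0) ∧
      (∀ y ∉ Ω, 0 ≤ F y) ∧
      (∃ W, IsOpen W ∧ frontier N ∩ frontier Ω ⊆ W ∧ ∀ y ∈ W, F y = 0 → y ∈ frontier Ω) ∧
      ∀ x ∈ frontier N ∩ frontier Ω, ∃ κ ≥ 0, (∀ w, fderiv ℝ F x w = -κ * ⟪gC Ω u x, w⟫) ∧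
        (x ∈ frontier N ∩ frontier Ω → 0 < κ) by
    obtain ⟨F, h1, h2, h3, h4, h5, h6⟩ := H
    refine ⟨F, h1, h2, h3, h4, h5, fun x hx => ?_⟩
    obtain ⟨κ, -, hκ, hκ0⟩ := h6 x hx
    exact ⟨κ, hκ0 hx, hκ⟩
  refine (h.isCompact_frontier_inter (N := N)).induction_on (p := fun S =>
    ∃ F : E2 → ℝ, ContDiff ℝ (⊤ : ℕ∞) F ∧ HasCompactSupport F ∧ (∀ y ∈ Ω, F y ≤ 0) ∧
      (∀ y ∉ Ω, 0 ≤ F y) ∧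
      (∃ W, IsOpen W ∧ S ⊆ W ∧ ∀ y ∈ W, F y = 0 → y ∈ frontier Ω) ∧
      ∀ x ∈ frontier N ∩ frontier Ω, ∃ κ ≥ 0, (∀ w, fderiv ℝ F x w = -κ * ⟪gC Ω u x, w⟫) ∧
        (x ∈ S → 0 < κ)) ?_ ?_ ?_ ?_
  · refine ⟨fun _ => 0, contDiff_const, HasCompactSupport.zero, by simp, by simp,
      ⟨∅, isOpen_empty, le_rfl, by simp⟩, fun x _ => ⟨0, le_rfl, by simp, by simp⟩⟩
  · rintro S T hST ⟨F, h1, h2, h3, h4, ⟨W, hW, hTW, hWF⟩, h6⟩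
    refine ⟨F, h1, h2, h3, h4, ⟨W, hW, hST.trans hTW, hWF⟩, fun x hx => ?_⟩
    obtain ⟨κ, h7, h8, h9⟩ := h6 x hx
    exact ⟨κ, h7, h8, fun hxS => h9 (hST hxS)⟩
  · rintro S T ⟨F, h1, h2, h3, h4, ⟨W, hW, hSW, hWF⟩, h6⟩
      ⟨F', h1', h2', h3', h4', ⟨W', hW', hSW', hWF'⟩, h6'⟩
    refine ⟨fun x => F x + F' x, h1.add h1', h2.add h2', fun y hy =>
      add_nonpos (h3 y hy) (h3' y hy),
      fun y hy => add_nonneg (h4 y hy) (h4' y hy), ⟨W ∪ W', hW.union hW',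
      union_subset_union hSW hSW', fun y hy hy0 => ?_⟩, fun x hx => ?_⟩
    · have hboth : F y = 0 ∧ F' y = 0 := by
        by_cases hyΩ : y ∈ Ω
        · have a1 := h3 y hyΩ; have a2 := h3' y hyΩ
          constructor <;> linarith
        · have a1 := h4 y hyΩ; have a2 := h4' y hyΩ
          constructor <;> linarith
      rcases hy with hy | hy
      · exact hWF y hy hboth.1
      · exact hWF' y hy hboth.2
    · obtain ⟨κ, h7, h8, h9⟩ := h6 x hx
      obtain ⟨κ', h7', h8', h9'⟩ := h6' x hx
      refine ⟨κ + κ', add_nonneg h7 h7', fun w => ?_, ?_⟩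
      · have : fderiv ℝ (fun x => F x + F' x) x = fderiv ℝ F x + fderiv ℝ F' x :=
          fderiv_add (h1.differentiable (by simp) x) (h1'.differentiable (by simp) x)
        rw [this, add_apply, h8, h8']; ring
      · rintro (hxS | hxS)
        · have := h9 hxS; linarith [show (0:ℝ) ≤ κ' from h7']
        · have := h9' hxS; linarith [show (0:ℝ) ≤ κ from h7]
  · intro x hx
    obtain ⟨U, f, hU, hxU, hf, hf', hΩU, hFU⟩ := h.smoothBoundary x hx.2
    have hfd : Differentiable ℝ f := hf.differentiable (by simp)
    have hmem : ∀ y ∈ U, (y ∈ Ω ↔ f y < 0) := by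
      intro y hy
      have := Set.ext_iff.1 hΩU y
      simpa [hy] using this
    have hmemF : ∀ y ∈ U, (y ∈ frontier Ω ↔ f y = 0) := by
      intro y hy
      have := Set.ext_iff.1 hFU y
      simpa [hy] using this
    obtain ⟨r, hr, hrU⟩ := Metric.nhds_basis_closedBall.mem_iff.1 (hU.mem_nhds hxU)
    let b : ContDiffBump x := ⟨r / 2, r, by positivity, by linarith⟩
    have hbout : ∀ y ∉ U, y ∉ tsupport b := by
      intro y hy hyb
      rw [b.tsupport_eq] at hyb
      exact hy (hrU hyb)
    have hb0 : ∀ y ∉ U, b y = 0 := fun y hy => by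
      by_contra hne
      exact hbout y hy (subset_tsupport _ hne)
    have hbd : Differentiable ℝ b := (b.contDiff (n := 1)).differentiable (by simp)
    refine ⟨Metric.ball x r ∩ (frontier N ∩ frontier Ω),
      inter_mem (mem_nhdsWithin_of_mem_nhds (Metric.ball_mem_nhds x hr)) self_mem_nhdsWithin,
      fun y => b y * f y, b.contDiff.mul hf, b.hasCompactSupport.mul_right, ?_, ?_,
      ⟨Metric.ball x r, Metric.isOpen_ball, inter_subset_left, ?_⟩, ?_⟩
    · intro y hy
      by_cases hyU : y ∈ U
      · exact mul_nonpos_of_nonneg_of_nonpos b.nonneg ((hmem y hyU).1 hy).le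
      · simp [hb0 y hyU]
    · intro y hy
      by_cases hyU : y ∈ U
      · exact mul_nonneg b.nonneg (not_lt.1 fun hlt => hy ((hmem y hyU).2 hlt))
      · simp [hb0 y hyU]
    · intro y hy hy0
      have hby : 0 < b y := b.pos_of_mem_ball hy
      exact (hmemF y (hrU (Metric.ball_subset_closedBall hy))).2
        ((mul_eq_zero.1 hy0).resolve_left hby.ne')
    · intro z hz
      by_cases hzU : z ∈ U
      · have hfz : f z = 0 := (hmemF z hzU).1 hz.2
        obtain ⟨κ, hκ, hκf⟩ := exists_neg_multiple (hf' z hzU) (hne z hz) (fun w hw => by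
          refine h.inner_gC_nonneg_of_ray hz.2 ?_
          have h1 : Tendsto (fun t : ℝ => z + t • w) (𝓝[>] 0) (𝓝 z) := by
            have : Continuous fun t : ℝ => z + t • w := by fun_prop
            have := this.tendsto 0
            rw [zero_smul, add_zero] at this
            exact this.mono_left nhdsWithin_le_nhds
          filter_upwards [eventually_ray_neg (hfd z) hfz.le hw,
            h1.eventually (hU.mem_nhds hzU)] with t ht htU
          exact (hmem _ htU).2 ht)
        have hd : fderiv ℝ (fun y => b y * f y) z = b z • fderiv ℝ f z := by
          have := ((hbd z).hasFDerivAt.mul (hfd z).hasFDerivAt).fderiv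
          rw [hfz, zero_smul, add_zero] at this
          exact this
        refine ⟨b z * κ, mul_nonneg b.nonneg (le_of_lt hκ), fun w => ?_, fun hzS => ?_⟩
        · rw [hd, smul_apply, hκf, smul_eq_mul]; ring
        · exact mul_pos (b.pos_of_mem_ball hzS.1) hκ
      · refine ⟨0, le_rfl, fun w => ?_, fun hzS =>
          absurd (hrU (Metric.ball_subset_closedBall hzS.1)) hzU⟩
        have h0 : (fun y => b y * f y) =ᶠ[𝓝 z] fun _ => 0 := by
          have := notMem_tsupport_iff_eventuallyEq.1 (hbout z hzU)
          filter_upwards [this] with y hy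
          rw [hy]; simp
        rw [h0.fderiv_eq]
        simp

end IsSerrinSolution

@[simp] theorem norm_rotJ (v : E2) : ‖rotJ v‖ = ‖v‖ := by
  rw [← sq_eq_sq₀ (norm_nonneg _) (norm_nonneg _), E2_norm_sq, E2_norm_sq]
  simp; ring

theorem inner_rotJ_self (v : E2) : ⟪v, rotJ v⟫ = 0 := by
  rw [E2_inner]; simp; ring

theorem lipschitz_truncated_normalize {m₀ : ℝ} (hm : 0 < m₀) :
    LipschitzWith (Real.toNNReal (2 / m₀)) fun v : E2 => (max ‖v‖ m₀)⁻¹ • v := by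
  refine LipschitzWith.of_dist_le_mul fun v w => ?_
  rw [Real.coe_toNNReal _ (by positivity), dist_eq_norm, dist_eq_norm]
  set a := max ‖v‖ m₀ with ha
  set b := max ‖w‖ m₀ with hb
  have ha0 : m₀ ≤ a := le_max_right _ _
  have hb0 : m₀ ≤ b := le_max_right _ _
  have hap : 0 < a := hm.trans_le ha0
  have hbp : 0 < b := hm.trans_le hb0
  have hwb : ‖w‖ ≤ b := le_max_left _ _
  have hab : |b - a| ≤ ‖v - w‖ := by
    have := abs_max_sub_max_le_abs ‖w‖ ‖v‖ m₀
    refine this.trans ?_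
    rw [norm_sub_rev v w]
    exact abs_norm_sub_norm_le w v
  have h1 : a⁻¹ • v - b⁻¹ • w = a⁻¹ • (v - w) + ((b - a) / (a * b)) • w := by
    have : (b - a) / (a * b) = a⁻¹ - b⁻¹ := by field_simp
    rw [this, smul_sub, sub_smul]; abel
  rw [h1]
  have hinv : a⁻¹ ≤ m₀⁻¹ := inv_anti₀ hm ha0
  calc ‖a⁻¹ • (v - w) + ((b - a) / (a * b)) • w‖
      ≤ ‖a⁻¹ • (v - w)‖ + ‖((b - a) / (a * b)) • w‖ := norm_add_le _ _
    _ = a⁻¹ * ‖v - w‖ + (|b - a| * a⁻¹) * (‖w‖ / b) := by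
        rw [norm_smul, norm_smul, Real.norm_eq_abs, Real.norm_eq_abs, abs_div, abs_mul,
          abs_of_pos hap, abs_of_pos hbp, abs_of_pos (inv_pos.2 hap)]
        field_simp
    _ ≤ m₀⁻¹ * ‖v - w‖ + (‖v - w‖ * m₀⁻¹) * 1 := by
        gcongr
        exact (div_le_one hbp).2 hwb
    _ = 2 / m₀ * ‖v - w‖ := by ring

namespace IsSerrinSolution

variable {Ω N : Set E2} {u : E2 → ℝ}

theorem exists_collar_field (h : IsSerrinSolution Ω u) (hN : IsCompOf N (Ω \ MAXset Ω u))
    (hΓ : (frontier N ∩ frontier Ω).Nonempty) {c : ℝ} (hc0 : 0 < c)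
    (hc : ∀ x ∈ frontier N ∩ frontier Ω, ‖gC Ω u x‖ = c) :
    ∃ V : E2 → E2, (∃ K, LipschitzWith K V) ∧ (∀ y, ‖V y‖ ≤ 1) ∧
      (∀ x ∈ frontier N ∩ frontier Ω, V x = c⁻¹ • gC Ω u x) ∧
      (∀ γ : ℝ → E2, (∀ t, HasDerivAt γ (rotJ (V (γ t))) t) → γ 0 ∈ frontier N ∩ frontier Ω →
        ∀ t, γ t ∈ frontier N ∩ frontier Ω) ∧
      (∃ C > 0, ∀ x ∈ frontier N ∩ frontier Ω, ∀ y ∈ frontier N ∩ frontier Ω,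
        |⟪y - x, V x⟫| ≤ C * ‖y - x‖ ^ 2) ∧
      (∃ s₀ : ℝ, 0 < s₀ ∧ ∀ x ∈ frontier N ∩ frontier Ω, ∀ s : ℝ, 0 < s → s < s₀ →
        x + s • V x ∈ N ∧ x - s • V x ∉ closure Ω) := by
  obtain ⟨F, hF, hFs, hFΩ, hFΩ', ⟨W, hW, hΓW, hWF⟩, hFd⟩ := h.exists_defining (N := N)
    (fun x hx h0 => by have := hc x hx; rw [h0, norm_zero] at this; exact hc0.ne this)
  obtain ⟨δ, hδ, hcol⟩ := h.exists_collar hN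
  set Γ := frontier N ∩ frontier Ω with hΓdef
  have hΓc : IsCompact Γ := h.isCompact_frontier_inter
  have hFdiff : ∀ y, HasFDerivAt F (fderiv ℝ F y) y := fun y =>
    (hF.differentiable (by simp) y).hasFDerivAt
  have hFcl : ∀ y ∈ closure Ω, F y ≤ 0 := fun y hy =>
    closure_minimal hFΩ (isClosed_le hF.continuous continuous_const) hy
  have hF0 : ∀ x ∈ Γ, F x = 0 := fun x hx => le_antisymm (hFcl x (frontier_subset_closure hx.2))
    (hFΩ' x (by have := hx.2; rw [h.frontier_eq] at this; exact this.2))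
  set G : E2 → E2 := fun y => !₂[fderiv ℝ F y (EuclideanSpace.single 0 1),
    fderiv ℝ F y (EuclideanSpace.single 1 1)] with hG
  have hGi : ∀ y w, fderiv ℝ F y w = ⟪G y, w⟫ := by
    intro y w
    conv_lhs => rw [E2_eq w]
    rw [E2_inner, map_add, map_smul, map_smul]
    simp [hG, mul_comm]
  have hfc : ContDiff ℝ 1 (fderiv ℝ F) := hF.fderiv_right (m := 1) (by
    exact WithTop.coe_le_coe.2 (le_top (a := (2 : ℕ∞))))
  have hGc : ContDiff ℝ 1 G := by
    rw [contDiff_euclidean]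
    intro i
    fin_cases i
    · exact hfc.clm_apply contDiff_const
    · exact hfc.clm_apply contDiff_const
  have hGs : HasCompactSupport G := by
    refine (hFs.fderiv (𝕜 := ℝ)).comp_left (g := fun f' : E2 →L[ℝ] ℝ =>
      (!₂[f' (EuclideanSpace.single 0 1), f' (EuclideanSpace.single 1 1)] : E2)) ?_
    ext i; fin_cases i <;> simp
  obtain ⟨K, hK⟩ := hGc.lipschitzWith_of_hasCompactSupport hGs (by simp)
  have hGκ : ∀ x ∈ Γ, ∃ κ : ℝ, 0 < κ ∧ G x = -κ • gC Ω u x := by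
    intro x hx
    obtain ⟨κ, hκ, hκF⟩ := hFd x hx
    refine ⟨κ, hκ, ext_inner_right ℝ fun w => ?_⟩
    rw [← hGi, hκF, inner_smul_left]; simp
  have hGne : ∀ x ∈ Γ, 0 < ‖G x‖ := by
    intro x hx
    obtain ⟨κ, hκ, hκG⟩ := hGκ x hx
    rw [hκG, norm_smul, hc x hx, norm_neg, Real.norm_of_nonneg (le_of_lt hκ)]
    exact mul_pos hκ hc0
  obtain ⟨x₀, hx₀, hmin⟩ := hΓc.exists_isMinOn hΓ (hGc.continuous.norm.continuousOn)
  set m₀ := ‖G x₀‖ with hm₀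
  have hm₀p : 0 < m₀ := hGne x₀ hx₀
  have hm₀le : ∀ x ∈ Γ, m₀ ≤ ‖G x‖ := fun x hx => hmin hx
  set V : E2 → E2 := fun y => -((max ‖G y‖ m₀)⁻¹ • G y) with hV
  have hVn : ∀ x ∈ Γ, V x = c⁻¹ • gC Ω u x := by
    intro x hx
    obtain ⟨κ, hκ, hκG⟩ := hGκ x hx
    simp only [hV]
    rw [max_eq_left (hm₀le x hx), hκG, norm_smul, hc x hx, norm_neg,
      Real.norm_of_nonneg (le_of_lt hκ), smul_smul, ← neg_smul]
    congr 1
    have := ne_of_gt hκ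
    field_simp
  have hVG : ∀ x ∈ Γ, G x = -‖G x‖ • V x := by
    intro x hx
    simp only [hV]
    rw [max_eq_left (hm₀le x hx), smul_neg, neg_smul, neg_neg, smul_smul,
      mul_inv_cancel₀ (hGne x hx).ne', one_smul]
  have hVunit : ∀ x ∈ Γ, ‖V x‖ = 1 := by
    intro x hx
    rw [hVn x hx, norm_smul, hc x hx, norm_inv, Real.norm_of_nonneg hc0.le,
      inv_mul_cancel₀ hc0.ne']
  have hTaylor : ∀ x y, |F y - F x - ⟪G x, y - x⟫| ≤ K * ‖y - x‖ ^ 2 := by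
    intro x y
    have hb : ∀ z ∈ Metric.closedBall x ‖y - x‖, ‖fderiv ℝ F z - fderiv ℝ F x‖ ≤ K * ‖y - x‖ := by
      intro z hz
      refine ContinuousLinearMap.opNorm_le_bound _ (by positivity) fun w => ?_
      rw [sub_apply, hGi, hGi, ← inner_sub_left]
      refine (norm_inner_le_norm _ _).trans ?_
      gcongr
      have := hK.dist_le_mul z x
      rw [dist_eq_norm, dist_eq_norm] at this
      refine this.trans ?_
      gcongr
      rwa [← dist_eq_norm]
    have := (convex_closedBall x ‖y - x‖).norm_image_sub_le_of_norm_hasFDerivWithin_le'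
      (fun z _ => (hFdiff z).hasFDerivWithinAt) hb
      (Metric.mem_closedBall_self (norm_nonneg _)) (by rw [mem_closedBall_iff_norm] : y ∈ _)
    rw [hGi, Real.norm_eq_abs] at this
    rw [pow_two, ← mul_assoc]
    exact this
  refine ⟨V, ?_, ?_, hVn, ?_, ?_, ?_⟩
  · exact ⟨_, ((lipschitz_truncated_normalize hm₀p).comp hK).neg⟩
  · intro y
    simp only [hV]
    rw [norm_neg, norm_smul, norm_inv, Real.norm_of_nonneg
      (le_max_of_le_left (norm_nonneg _)), inv_mul_le_iff₀ (lt_max_of_lt_right hm₀p), mul_one]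
    exact le_max_left _ _
  · intro γ hγ hγ0
    have hγc : Continuous γ := continuous_iff_continuousAt.2 fun t => (hγ t).continuousAt
    have hFγ : ∀ t, F (γ t) = 0 := by
      have hd : ∀ t, HasDerivAt (fun t => F (γ t)) 0 t := by
        intro t
        have := (hFdiff (γ t)).comp_hasDerivAt t (hγ t)
        refine this.congr_deriv ?_
        rw [hGi]
        simp only [hV, map_neg, map_smul, inner_neg_right, inner_smul_right, inner_rotJ_self,
          mul_zero, neg_zero]
      intro t
      have := is_const_of_deriv_eq_zero (fun s => (hd s).differentiableAt)
        (fun s => (hd s).deriv) t 0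
      rw [this, hF0 _ hγ0]
    have hclopen : IsClopen (γ ⁻¹' Γ) := by
      refine ⟨hΓc.isClosed.preimage hγc, isOpen_iff_mem_nhds.2 fun t ht => ?_⟩
      filter_upwards [hγc.continuousAt.eventually (hW.mem_nhds (hΓW ht)),
        hγc.continuousAt.eventually (Metric.ball_mem_nhds (γ t) hδ)] with s hs1 hs2
      exact (hcol (γ t) ht (γ s) hs2).2 (hWF _ hs1 (hFγ s))
    intro t
    have := hclopen.eq_univ ⟨0, hγ0⟩
    exact (this ▸ mem_univ t : t ∈ γ ⁻¹' Γ)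
  · refine ⟨(K + 1) / m₀, by positivity, fun x hx y hy => ?_⟩
    have h1 := hTaylor x y
    rw [hF0 x hx, hF0 y hy, hVG x hx, inner_smul_left, sub_zero, zero_sub, abs_neg, abs_mul] at h1
    rw [real_inner_comm, div_mul_eq_mul_div, le_div_iff₀ hm₀p]
    simp only [conj_trivial, abs_neg, abs_norm] at h1
    have h2 := mul_le_mul_of_nonneg_right (hm₀le x hx) (abs_nonneg ⟪V x, y - x⟫)
    nlinarith [sq_nonneg ‖y - x‖]
  · refine ⟨min δ (m₀ / (K + 1)), by positivity, fun x hx s hs0 hs => ?_⟩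
    have hs1 : s < δ := hs.trans_le (min_le_left _ _)
    have hs2 : s < m₀ / (K + 1) := hs.trans_le (min_le_right _ _)
    rw [lt_div_iff₀ (by positivity)] at hs2
    have hvv : ⟪V x, V x⟫ = 1 := by rw [real_inner_self_eq_norm_sq, hVunit x hx, one_pow]
    have hm := hm₀le x hx
    constructor
    · have h1 := (abs_le.1 (hTaylor x (x + s • V x))).2
      rw [add_sub_cancel_left, hF0 x hx, inner_smul_right] at h1
      nth_rewrite 1 [hVG x hx] at h1
      rw [inner_smul_left, hvv, norm_smul, hVunit x hx, Real.norm_of_nonneg hs0.le] at h1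
      simp only [conj_trivial] at h1
      have hFneg : F (x + s • V x) < 0 := by nlinarith
      have hΩ : x + s • V x ∈ Ω := by
        by_contra hn
        exact (hFΩ' _ hn).not_gt hFneg
      refine (hcol x hx _ ?_).1 hΩ
      rw [dist_eq_norm, add_sub_cancel_left, norm_smul, hVunit x hx, Real.norm_of_nonneg hs0.le]
      linarith
    · have h1 := (abs_le.1 (hTaylor x (x - s • V x))).1
      rw [sub_sub_cancel_left, hF0 x hx, inner_neg_right, inner_smul_right] at h1
      nth_rewrite 1 [hVG x hx] at h1
      rw [inner_smul_left, hvv, norm_neg, norm_smul, hVunit x hx,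
        Real.norm_of_nonneg hs0.le] at h1
      simp only [conj_trivial] at h1
      have hFpos : 0 < F (x - s • V x) := by nlinarith
      exact fun hn => (hFcl _ hn).not_gt hFpos

end IsSerrinSolution

theorem exists_global_flow_line {E : Type*} [NormedAddCommGroup E] [NormedSpace ℝ E]
    [CompleteSpace E] {Y : E → E} {K : NNReal} (hY : LipschitzWith K Y) (hb : ∀ y, ‖Y y‖ ≤ 1)
    (x₀ : E) : ∃ γ : ℝ → E, γ 0 = x₀ ∧ ∀ t, HasDerivAt γ (Y (γ t)) t := by
  have hex : ∀ n : ℕ, ∃ α : ℝ → E, α 0 = x₀ ∧ ∀ t ∈ Ioo (-(n : ℝ)) n, HasDerivAt α (Y (α t)) t := by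
    intro n
    have h0 : (0 : ℝ) ∈ Icc (-(n : ℝ)) n := by constructor <;> simp
    have hpl : IsPicardLindelof (fun _ => Y) (⟨0, h0⟩ : Icc (-(n : ℝ)) n) x₀ n 0 1 K :=
      .of_time_independent (fun x _ => by simpa using hb x) hY.lipschitzOnWith (by simp)
    obtain ⟨α, hα0, hα⟩ := hpl.exists_eq_forall_mem_Icc_hasDerivWithinAt₀
    exact ⟨α, hα0, fun t ht => (hα t (Ioo_subset_Icc_self ht)).hasDerivAt (Icc_mem_nhds ht.1 ht.2)⟩
  choose α hα0 hα using hex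
  have hagree : ∀ m n : ℕ, m ≤ n → ∀ t ∈ Ioo (-(m : ℝ)) m, α m t = α n t := by
    intro m n hmn t ht
    have hmn' : (m : ℝ) ≤ n := by exact_mod_cast hmn
    have hm0 : (0 : ℝ) < m := by linarith [ht.1, ht.2]
    refine ODE_solution_unique_of_mem_Ioo (v := fun _ => Y) (s := fun _ => univ) (K := K)
      (t₀ := 0) (a := -(m : ℝ)) (b := m)
      (fun _ _ => hY.lipschitzOnWith) ⟨by linarith, hm0⟩ (fun s hs => ⟨hα m s hs, trivial⟩)
      (fun s hs => ⟨hα n s ⟨by linarith [hs.1], by linarith [hs.2]⟩, trivial⟩) ?_ ht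
    rw [hα0, hα0]
  set γ : ℝ → E := fun t => α (⌈|t|⌉₊ + 1) t with hγ
  have hγα : ∀ (n : ℕ) t, t ∈ Ioo (-(n : ℝ)) n → γ t = α n t := by
    intro n t ht
    have ht' : t ∈ Ioo (-((⌈|t|⌉₊ + 1 : ℕ) : ℝ)) ((⌈|t|⌉₊ + 1 : ℕ) : ℝ) := by
      have := Nat.le_ceil |t|
      rw [mem_Ioo, ← abs_lt]
      push_cast
      linarith
    rcases le_total n (⌈|t|⌉₊ + 1) with hle | hle
    · exact (hagree _ _ hle t ht).symm
    · exact hagree _ _ hle t ht'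
  refine ⟨γ, ?_, fun t => ?_⟩
  · rw [hγα 1 0 (by simp), hα0]
  · set n := ⌈|t|⌉₊ + 1 with hn
    have ht' : t ∈ Ioo (-(n : ℝ)) n := by
      have := Nat.le_ceil |t|
      rw [mem_Ioo, ← abs_lt, hn]
      push_cast
      linarith
    have hev : γ =ᶠ[𝓝 t] α n := by
      filter_upwards [isOpen_Ioo.mem_nhds ht'] with s hs using hγα n s hs
    rw [hγα n t ht']
    exact (hα n t ht').congr_of_eventuallyEq hev

theorem inner_rotJ_rotJ (v w : E2) : ⟪rotJ v, rotJ w⟫ = ⟪v, w⟫ := by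
  rw [E2_inner, E2_inner]; simp; ring

theorem eq_inner_smul_of_inner_rotJ_eq_zero {n w : E2} (hn : ‖n‖ = 1) (h : ⟪w, rotJ n⟫ = 0) :
    w = ⟪w, n⟫ • n := by
  have h1 := E2_norm_sq n
  rw [hn] at h1
  rw [E2_inner] at h
  simp only [rotJ_zero, rotJ_one] at h
  ext i
  rw [PiLp.smul_apply, E2_inner, smul_eq_mul]
  fin_cases i
  · simp only [Fin.zero_eta, Fin.isValue]
    linear_combination w 0 * h1 - n 1 * h
  · simp only [Fin.mk_one, Fin.isValue]
    linear_combination w 1 * h1 + n 0 * h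

/-- A compact connected set that carries a unit normal field and is invariant under the flow of
the corresponding tangent field is a simple closed curve. -/
theorem exists_closed_parametrization {Γ : Set E2} {V : E2 → E2} {K : NNReal} {C : ℝ}
    (hΓc : IsCompact Γ) (hconn : IsConnected Γ) (hV : LipschitzWith K V) (hVb : ∀ y, ‖V y‖ ≤ 1)
    (hV1 : ∀ x ∈ Γ, ‖V x‖ = 1)
    (hinv : ∀ γ : ℝ → E2, (∀ t, HasDerivAt γ (rotJ (V (γ t))) t) → γ 0 ∈ Γ → ∀ t, γ t ∈ Γ)
    (hC : 0 < C) (hquad : ∀ x ∈ Γ, ∀ y ∈ Γ, |⟪y - x, V x⟫| ≤ C * ‖y - x‖ ^ 2) :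
    ∃ (γ : ℝ → E2) (L : ℝ), 0 < L ∧ (∀ t, HasDerivAt γ (rotJ (V (γ t))) t) ∧
      (∀ t, γ (t + L) = γ t) ∧ (∀ s d, 0 < d → d < L → γ (s + d) ≠ γ s) ∧
      γ '' Ico 0 L = Γ := by
  obtain ⟨x₀, hx₀⟩ := hconn.nonempty
  have hYlip : LipschitzWith K fun y => rotJ (V y) := by
    refine LipschitzWith.of_dist_le_mul fun x y => ?_
    rw [dist_eq_norm, ← map_sub, norm_rotJ, ← dist_eq_norm]
    exact hV.dist_le_mul x y
  obtain ⟨γ, hγ0, hγ⟩ := exists_global_flow_line hYlip (fun y => by simpa using hVb y) x₀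
  have hγΓ : ∀ t, γ t ∈ Γ := hinv γ hγ (hγ0 ▸ hx₀)
  have hγc : Continuous γ := continuous_iff_continuousAt.2 fun t => (hγ t).continuousAt
  have huniq : ∀ s t, γ s = γ t → ∀ r, γ (r + s) = γ (r + t) := by
    intro s t hst r
    have := ODE_solution_unique_univ (v := fun _ => fun y => rotJ (V y)) (s := fun _ => univ)
      (K := K) (t₀ := 0) (f := fun r => γ (r + s)) (g := fun r => γ (r + t))
      (fun _ => hYlip.lipschitzOnWith) (fun r => ⟨(hγ (r + s)).comp_add_const r s, trivial⟩)
      (fun r => ⟨(hγ (r + t)).comp_add_const r t, trivial⟩) (by simpa using hst)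
    exact congrFun this r
  have hγlip : ∀ t s, ‖γ (t + s) - γ t‖ ≤ |s| := by
    intro t s
    have := Convex.norm_image_sub_le_of_norm_hasDerivWithin_le (f := γ) (C := 1)
      (fun x _ => (hγ x).hasDerivWithinAt) (fun x _ => by simpa using hVb (γ x)) convex_univ
      (mem_univ t) (mem_univ (t + s))
    simpa using this
  set a : ℝ := min (1 / (2 * (K + 1))) (1 / (8 * C)) with ha
  have ha0 : 0 < a := by positivity
  have haK : (K : ℝ) * a ≤ 1 / 2 := by
    have : a ≤ 1 / (2 * (K + 1)) := min_le_left _ _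
    rw [le_div_iff₀ (by positivity)] at this
    nlinarith
  have haC : C * a ≤ 1 / 8 := by
    have : a ≤ 1 / (8 * C) := min_le_right _ _
    rw [le_div_iff₀ (by positivity)] at this
    linarith
  have hVγ : ∀ t s, |s| ≤ a → 1 / 2 ≤ ⟪V (γ (t + s)), V (γ t)⟫ := by
    intro t s hs
    have h1 : ‖V (γ (t + s)) - V (γ t)‖ ≤ 1 / 2 := by
      have := hV.dist_le_mul (γ (t + s)) (γ t)
      rw [dist_eq_norm, dist_eq_norm] at this
      calc _ ≤ (K : ℝ) * ‖γ (t + s) - γ t‖ := this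
        _ ≤ K * a := by gcongr; exact (hγlip t s).trans hs
        _ ≤ 1 / 2 := haK
    have h2 := abs_le.1 (abs_real_inner_le_norm (V (γ (t + s)) - V (γ t)) (V (γ t)))
    rw [inner_sub_left, real_inner_self_eq_norm_sq, hV1 _ (hγΓ t)] at h2
    linarith [h2.1]
  have harc : ∀ t, ∀ y ∈ Γ, dist y (γ t) < a / 2 → ∃ s, |s| ≤ a ∧ γ (t + s) = y := by
    intro t y hy hyt
    set n := V (γ t) with hn
    have hn1 : ‖n‖ = 1 := hV1 _ (hγΓ t)
    have hT1 : ‖rotJ n‖ = 1 := by rw [norm_rotJ, hn1]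
    set z : ℝ → ℝ := fun s => ⟪γ (t + s) - γ t, rotJ n⟫ with hz
    have hzd : ∀ s, HasDerivAt z ⟪V (γ (t + s)), n⟫ s := by
      intro s
      have h1 : HasDerivAt (fun s => γ (t + s) - γ t) (rotJ (V (γ (t + s)))) s :=
        ((hγ (t + s)).comp_const_add t s).sub_const _
      have := h1.inner ℝ (hasDerivAt_const s (rotJ n))
      refine this.congr_deriv ?_
      rw [inner_zero_right, zero_add, inner_rotJ_rotJ]
    have hzc : Continuous z := continuous_iff_continuousAt.2 fun t => (hzd t).continuousAt
    have hmono : ∀ s₁ s₂, -a ≤ s₁ → s₁ ≤ s₂ → s₂ ≤ a → 1 / 2 * (s₂ - s₁) ≤ z s₂ - z s₁ := by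
      intro s₁ s₂ h1 h12 h2
      refine (convex_Icc (-a) a).mul_sub_le_image_sub_of_le_deriv (f := z) hzc.continuousOn
        (fun s _ => (hzd s).differentiableAt.differentiableWithinAt) (fun s hs => ?_)
        s₁ ⟨h1, h12.trans h2⟩ s₂ ⟨h1.trans h12, h2⟩ h12
      rw [(hzd s).deriv]
      exact hVγ t s (abs_le.2 (show s ∈ Icc (-a) a from interior_subset hs))
    have hz0 : z 0 = 0 := by simp [hz]
    have hza : a / 2 ≤ z a := by
      have := hmono 0 a (by linarith) ha0.le le_rfl
      rw [hz0] at this; linarith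
    have hzna : z (-a) ≤ -(a / 2) := by
      have := hmono (-a) 0 le_rfl (by linarith) ha0.le
      rw [hz0] at this; linarith
    have hyz : |⟪y - γ t, rotJ n⟫| < a / 2 := by
      refine (abs_real_inner_le_norm _ _).trans_lt ?_
      rwa [hT1, mul_one, ← dist_eq_norm]
    obtain ⟨s, hs, hzs⟩ := intermediate_value_Icc (show -a ≤ a by linarith) hzc.continuousOn
      (show ⟪y - γ t, rotJ n⟫ ∈ Icc (z (-a)) (z a) from
        ⟨hzna.trans (abs_lt.1 hyz).1.le, (abs_lt.1 hyz).2.le.trans hza⟩)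
    have hsa : |s| ≤ a := abs_le.2 hs
    refine ⟨s, hsa, ?_⟩
    set w := y - γ (t + s) with hw
    have hwT : ⟪w, rotJ n⟫ = 0 := by
      have : w = (y - γ t) - (γ (t + s) - γ t) := by rw [hw]; abel
      rw [this, inner_sub_left, sub_eq_zero]
      exact hzs.symm
    have hwn := eq_inner_smul_of_inner_rotJ_eq_zero hn1 hwT
    set μ := ⟪w, n⟫ with hμ
    have hq := hquad _ (hγΓ (t + s)) y hy
    rw [← hw, hwn, inner_smul_left, norm_smul, hn1, mul_one, Real.norm_eq_abs, abs_mul] at hq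
    simp only [conj_trivial] at hq
    have h3 := hVγ t s hsa
    rw [real_inner_comm, ← hn] at h3
    have h4 : |μ| ≤ 2 * a := by
      have h5 : ‖w‖ = |μ| := by rw [hwn, norm_smul, hn1, mul_one, Real.norm_eq_abs]
      rw [← h5]
      have : w = (y - γ t) - (γ (t + s) - γ t) := by rw [hw]; abel
      rw [this]
      refine (norm_sub_le _ _).trans ?_
      rw [← dist_eq_norm]
      linarith [hγlip t s]
    have h6 : |μ| * (1 / 2) ≤ C * |μ| ^ 2 := by
      refine le_trans ?_ hq
      gcongr
      exact h3.trans (le_abs_self _)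
    have h7 : |μ| = 0 := by
      by_contra hne
      have hpos : 0 < |μ| := lt_of_le_of_ne (abs_nonneg _) (Ne.symm hne)
      have : C * |μ| ≤ 1 / 4 := by nlinarith
      nlinarith
    rw [abs_eq_zero.1 h7, zero_smul] at hwn
    exact (sub_eq_zero.1 hwn).symm
  let P : AddSubgroup ℝ :=
    { carrier := {p | γ p = γ 0}
      zero_mem' := rfl
      add_mem' := by
        intro p q hp hq
        have := huniq q 0 hq p
        simp only [add_zero] at this
        exact this.trans hp
      neg_mem' := by
        intro p hp
        have := huniq p 0 hp (-p)
        simp only [add_zero, neg_add_cancel] at this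
        exact this.symm }
  have hPmem : ∀ p, p ∈ P ↔ γ p = γ 0 := fun p => Iff.rfl
  have hsub : ∀ s d, γ (s + d) = γ s → d ∈ P := by
    intro s d hsd
    have := huniq _ _ hsd (-s)
    rw [neg_add_cancel_left, neg_add_cancel] at this
    exact this
  obtain ⟨p, hp0, hpP⟩ : ∃ p > 0, p ∈ P := by
    obtain ⟨x, -, φ, hφ, hlim⟩ := hΓc.tendsto_subseq (x := fun k : ℕ => γ (k * (a + 1)))
      (fun k => hγΓ _)
    obtain ⟨M, hM⟩ := Metric.cauchySeq_iff.1 hlim.cauchySeq (a / 2) (by positivity)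
    have h1 := hM (M + 1) (by simp) M le_rfl
    simp only [Function.comp] at h1
    obtain ⟨s, hs, hs'⟩ := harc _ _ (hγΓ _) h1
    refine ⟨(φ (M + 1) : ℝ) * (a + 1) - (φ M * (a + 1) + s), ?_, ?_⟩
    · have h2 : (φ M : ℝ) + 1 ≤ φ (M + 1) := by exact_mod_cast hφ (Nat.lt_succ_self M)
      have := (abs_le.1 hs).2
      nlinarith
    · refine hsub (φ M * (a + 1) + s) _ ?_
      rw [add_sub_cancel, hs']
  have hnd : ¬ Dense (P : Set ℝ) := by
    intro hd
    have hcl : IsClosed (P : Set ℝ) := by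
      have : (P : Set ℝ) = {p | γ p = γ 0} := rfl
      rw [this]
      exact isClosed_eq hγc continuous_const
    have hall : ∀ p, γ p = γ 0 := by
      intro p
      have : p ∈ (P : Set ℝ) := by rw [← hcl.closure_eq, hd.closure_eq]; trivial
      exact this
    have h1 : HasDerivAt γ 0 0 := by
      have : γ = fun _ => γ 0 := funext hall
      rw [this]; exact hasDerivAt_const _ _
    have h2 := (hγ 0).unique h1
    have h3 := hV1 _ (hγΓ 0)
    rw [← norm_rotJ, h2, norm_zero] at h3
    exact zero_ne_one h3
  obtain ⟨l, hl⟩ := (AddSubgroup.dense_or_cyclic P).resolve_left hnd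
  have hlP : ∀ q, q ∈ P ↔ ∃ k : ℤ, k • l = q := by
    intro q; rw [hl, AddSubgroup.mem_closure_singleton]
  have hl0 : l ≠ 0 := by
    rintro rfl
    obtain ⟨k, hk⟩ := (hlP p).1 hpP
    simp only [smul_zero] at hk
    exact hp0.ne hk
  have hLP : |l| ∈ P := by
    rcases abs_choice l with h1 | h1 <;> rw [h1]
    · exact (hlP l).2 ⟨1, one_smul _ _⟩
    · exact P.neg_mem ((hlP l).2 ⟨1, one_smul _ _⟩)
  have hLpos : 0 < |l| := abs_pos.2 hl0
  have hper : ∀ t, γ (t + |l|) = γ t := by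
    intro t
    have := huniq _ _ ((hPmem _).1 hLP) t
    rwa [add_zero] at this
  refine ⟨γ, |l|, hLpos, hγ, hper, ?_, ?_⟩
  · intro s d hd0 hdL hsd
    obtain ⟨k, hk⟩ := (hlP d).1 (hsub s d hsd)
    have h1 : |d| = |(k : ℝ)| * |l| := by rw [← hk, zsmul_eq_mul, abs_mul]
    rw [abs_of_pos hd0] at h1
    have hk0 : k ≠ 0 := by rintro rfl; simp at hk; linarith
    have : (1 : ℝ) ≤ |(k : ℝ)| := by exact_mod_cast Int.one_le_abs hk0
    nlinarith
  · have himg : γ '' Ico 0 |l| = range γ := by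
      refine subset_antisymm (image_subset_range _ _) ?_
      rintro _ ⟨t, rfl⟩
      obtain ⟨y, hy, hyt⟩ := Function.Periodic.exists_mem_Ico₀ (f := γ) hper hLpos t
      exact ⟨y, hy, hyt.symm⟩
    rw [himg]
    have hrc : IsClosed (range γ) := by
      have : range γ = γ '' Icc 0 |l| := by
        refine subset_antisymm ?_ (image_subset_range _ _)
        rw [← himg]
        exact image_mono Ico_subset_Icc_self
      rw [this]
      exact (isCompact_Icc.image hγc).isClosed
    refine subset_antisymm (range_subset_iff.2 hγΓ) ?_
    by_contra hnot
    obtain ⟨y, hyΓ, hy⟩ := not_subset.1 hnot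
    obtain ⟨w, hwΓ, hwU, hwr⟩ := hconn.isPreconnected (⋃ t, Metric.ball (γ t) (a / 2)) (range γ)ᶜ
      (isOpen_iUnion fun t => Metric.isOpen_ball) hrc.isOpen_compl
      (fun w _ => by
        by_cases hw : w ∈ range γ
        · obtain ⟨t, rfl⟩ := hw
          exact Or.inl (mem_iUnion.2 ⟨t, Metric.mem_ball_self (by positivity)⟩)
        · exact Or.inr hw)
      ⟨γ 0, hγΓ 0, mem_iUnion.2 ⟨0, Metric.mem_ball_self (by positivity)⟩⟩ ⟨y, hyΓ, hy⟩
    obtain ⟨t, ht⟩ := mem_iUnion.1 hwU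
    obtain ⟨s, -, hs⟩ := harc t w hwΓ ht
    exact hwr ⟨_, hs⟩

theorem lipschitzWith_one_of_unit_speed {γ T : ℝ → E2} (hγ : ∀ t, HasDerivAt γ (T t) t)
    (hu : ∀ t, ‖T t‖ = 1) : LipschitzWith 1 γ := by
  refine lipschitzWith_of_nnnorm_deriv_le (fun t => (hγ t).differentiableAt) fun t => ?_
  rw [(hγ t).deriv, ← NNReal.coe_le_coe, coe_nnnorm, hu t]; simp

/-- Along a simple arc parametrized by arc length, `H¹` is the image of Lebesgue measure. -/
theorem restrict_hausdorffMeasure_eq_map {γ T : ℝ → E2} {L : ℝ} {K : NNReal} (hL : 0 < L)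
    (hγ : ∀ t, HasDerivAt γ (T t) t) (hT : LipschitzWith K T) (hu : ∀ t, ‖T t‖ = 1)
    (hinj : InjOn γ (Ico 0 L)) :
    (μH[1] : Measure E2).restrict (γ '' Ico 0 L) =
      Measure.map γ ((volume : Measure ℝ).restrict (Ico 0 L)) := by
  have hγc : Continuous γ := continuous_iff_continuousAt.2 fun t => (hγ t).continuousAt
  have hlip := lipschitzWith_one_of_unit_speed hγ hu
  have hmeas : ∀ s ⊆ Ico 0 L, MeasurableSet s → MeasurableSet (γ '' s) := fun s hs hm =>
    hm.image_of_continuousOn_injOn hγc.continuousOn (hinj.mono hs)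
  have hle : ∀ s : Set ℝ, (μH[1] : Measure E2) (γ '' s) ≤ volume s := by
    intro s
    have := hlip.hausdorffMeasure_image_le (d := 1) zero_le_one s
    rw [hausdorffMeasure_real] at this
    simpa using this
  have hchord : ∀ a b, a ≤ b →
      ENNReal.ofReal ((1 - K * (b - a)) * (b - a)) ≤ (μH[1] : Measure E2) (γ '' Ico a b) := by
    intro a b hab
    set φ : ℝ → ℝ := fun t => ⟪γ t, T a⟫ with hφ
    have hφd : ∀ t, HasDerivAt φ ⟪T t, T a⟫ t := by
      intro t
      have := (hγ t).inner ℝ (hasDerivAt_const t (T a))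
      refine this.congr_deriv ?_
      rw [inner_zero_right, zero_add]
    have hφc : Continuous φ := continuous_iff_continuousAt.2 fun t => (hφd t).continuousAt
    have h1 : (1 - K * (b - a)) * (b - a) ≤ φ b - φ a := by
      refine (convex_Icc a b).mul_sub_le_image_sub_of_le_deriv hφc.continuousOn
        (fun s _ => (hφd s).differentiableAt.differentiableWithinAt) (fun s hs => ?_)
        a (left_mem_Icc.2 hab) b (right_mem_Icc.2 hab) hab
      rw [(hφd s).deriv]
      have hs' : s ∈ Icc a b := interior_subset hs
      have h2 : ‖T s - T a‖ ≤ K * (b - a) := by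
        have := hT.dist_le_mul s a
        rw [dist_eq_norm, Real.dist_eq, abs_of_nonneg (by linarith [hs'.1])] at this
        exact this.trans (by gcongr; exact hs'.2)
      have h3 := (abs_le.1 (abs_real_inner_le_norm (T s - T a) (T a))).1
      rw [inner_sub_left, real_inner_self_eq_norm_sq, hu a] at h3
      linarith
    have h2 : LipschitzWith 1 fun y : E2 => (⟪y, T a⟫ : ℝ) := by
      refine LipschitzWith.of_dist_le_mul fun x y => ?_
      rw [Real.dist_eq, ← inner_sub_left, dist_eq_norm]
      refine (abs_real_inner_le_norm _ _).trans ?_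
      simp [hu a]
    have h3 := h2.hausdorffMeasure_image_le (d := 1) zero_le_one (γ '' Ico a b)
    rw [hausdorffMeasure_real, image_image] at h3
    have h4 : Ico (φ a) (φ b) ⊆ (fun t => ⟪γ t, T a⟫) '' Ico a b :=
      intermediate_value_Ico hab hφc.continuousOn
    calc ENNReal.ofReal ((1 - K * (b - a)) * (b - a)) ≤ ENNReal.ofReal (φ b - φ a) :=
          ENNReal.ofReal_le_ofReal h1
      _ = volume (Ico (φ a) (φ b)) := Real.volume_Ico.symm
      _ ≤ volume ((fun t => ⟪γ t, T a⟫) '' Ico a b) := measure_mono h4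
      _ ≤ _ := by simpa using h3
  have hsum : ∀ d, 0 ≤ d → ∀ k : ℕ, k * d ≤ L →
      ENNReal.ofReal (k * ((1 - K * d) * d)) ≤ (μH[1] : Measure E2) (γ '' Ico 0 (k * d)) := by
    intro d hd k
    by_cases hneg : 1 - K * d < 0
    · intro _
      rw [ENNReal.ofReal_of_nonpos]
      · exact zero_le
      · exact mul_nonpos_of_nonneg_of_nonpos (by positivity)
          (mul_nonpos_of_nonpos_of_nonneg hneg.le hd)
    push Not at hneg
    induction k with
    | zero => intro _; simp
    | succ k ih =>
      intro hk
      push_cast at hk ⊢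
      have hkd : (k : ℝ) * d ≤ (k + 1) * d := by nlinarith
      have hkd0 : 0 ≤ (k : ℝ) * d := by positivity
      rw [← Ico_union_Ico_eq_Ico hkd0 hkd, image_union, measure_union, add_mul,
        ENNReal.ofReal_add (by positivity) (by positivity)]
      · refine add_le_add (ih (hkd.trans hk)) ?_
        have := hchord (k * d) ((k + 1) * d) hkd
        rwa [show ((k : ℝ) + 1) * d - k * d = d by ring, ← one_mul ((1 - K * d) * d)] at this
      · exact Disjoint.image (Set.disjoint_left.2 fun x hx hx' => absurd hx.2 (not_lt.2 hx'.1)) hinj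
          (Ico_subset_Ico_right (hkd.trans hk)) (Ico_subset_Ico hkd0 hk)
      · exact hmeas _ (Ico_subset_Ico hkd0 hk) measurableSet_Ico
  have htot : ENNReal.ofReal L ≤ (μH[1] : Measure E2) (γ '' Ico 0 L) := by
    have hlim : Tendsto (fun n : ℕ => (1 - K * (L / ((n : ℝ) + 1))) * L) atTop (𝓝 L) := by
      have h1 : Tendsto (fun n : ℕ => L / ((n : ℝ) + 1)) atTop (𝓝 0) := by
        have := tendsto_one_div_add_atTop_nhds_zero_nat (𝕜 := ℝ)
        have := this.const_mul L
        simpa [div_eq_mul_inv] using this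
      have := ((h1.const_mul (K : ℝ)).const_sub 1).mul_const L
      simpa using this
    refine le_of_tendsto (ENNReal.tendsto_ofReal hlim) (Eventually.of_forall fun n => ?_)
    have hn : ((n + 1 : ℕ) : ℝ) * (L / (n + 1)) = L := by push_cast; field_simp
    have := hsum (L / (n + 1)) (by positivity) (n + 1) hn.le
    rw [hn] at this
    refine le_trans (ENNReal.ofReal_le_ofReal (le_of_eq ?_)) this
    push_cast; field_simp
  have : IsFiniteMeasure ((μH[1] : Measure E2).restrict (γ '' Ico 0 L)) :=
    ⟨by
      rw [Measure.restrict_apply_univ]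
      exact (hle _).trans_lt (by simp)⟩
  refine Measure.eq_of_le_of_measure_univ_eq ?_ ?_
  · refine Measure.le_iff.2 fun B hB => ?_
    rw [Measure.restrict_apply hB, Measure.map_apply hγc.measurable hB,
      Measure.restrict_apply (hγc.measurable hB), inter_comm, inter_comm (γ ⁻¹' B),
      ← image_inter_preimage]
    exact hle _
  · refine le_antisymm ?_ ?_
    · rw [Measure.restrict_apply_univ, Measure.map_apply hγc.measurable .univ, preimage_univ,
        Measure.restrict_apply_univ]
      exact hle _
    · rw [Measure.restrict_apply_univ, Measure.map_apply hγc.measurable .univ, preimage_univ,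
        Measure.restrict_apply_univ, Real.volume_Ico, sub_zero]
      exact htot

theorem rotJ_rotJ (v : E2) : rotJ (rotJ v) = -v := by
  ext i; fin_cases i <;> simp

/-- An arc length parametrization `γ` of the part `∂N ∩ ∂Ω` of the boundary, with inward unit
normal `n`, tangent `rotJ n`, curvature `β`, and the geometric control of a collar. -/
structure IsBoundaryCurve (Ω N : Set E2) (u : E2 → ℝ) (c L C s₀ : ℝ) (γ n : ℝ → E2)
    (β : ℝ → ℝ) : Prop where
  c_pos : 0 < c
  L_pos : 0 < L
  C_pos : 0 < C
  s₀_pos : 0 < s₀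
  hasDerivAt : ∀ t, HasDerivAt γ (rotJ (n t)) t
  normal_eq : ∀ t, n t = c⁻¹ • gC Ω u (γ t)
  norm_normal : ∀ t, ‖n t‖ = 1
  hasDerivAt_normal : ∀ t, HasDerivAt n (β t • rotJ (n t)) t
  curvature_eq : ∀ t, β t = c⁻¹ * ⟪hC Ω u (γ t) (rotJ (n t)), rotJ (n t)⟫
  continuous_curvature : Continuous β
  periodic : ∀ t, γ (t + L) = γ t
  injective : ∀ s d, 0 < d → d < L → γ (s + d) ≠ γ s
  image : γ '' Ico 0 L = frontier N ∩ frontier Ω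
  quadratic : ∀ s t, |⟪γ s - γ t, n t⟫| ≤ C * ‖γ s - γ t‖ ^ 2
  collar_mem : ∀ t s, 0 < s → s < s₀ → γ t + s • n t ∈ N
  collar_not_mem : ∀ t s, 0 < s → s < s₀ → γ t - s • n t ∉ closure Ω

theorem IsSerrinSolution.exists_isBoundaryCurve {Ω N : Set E2} {u : E2 → ℝ}
    (h : IsSerrinSolution Ω u) (hN : IsCompOf N (Ω \ MAXset Ω u))
    (hconn : IsConnected (frontier N ∩ frontier Ω)) {c : ℝ} (hc0 : 0 < c)
    (hc : ∀ x ∈ frontier N ∩ frontier Ω, ‖gC Ω u x‖ = c) :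
    ∃ L C s₀ γ n β, IsBoundaryCurve Ω N u c L C s₀ γ n β := by
  obtain ⟨V, ⟨K, hK⟩, hVb, hVn, hinv, ⟨C, hCp, hquad⟩, s₀, hs₀, hs⟩ :=
    h.exists_collar_field hN hconn.nonempty hc0 hc
  have hV1 : ∀ x ∈ frontier N ∩ frontier Ω, ‖V x‖ = 1 := by
    intro x hx
    rw [hVn x hx, norm_smul, hc x hx, norm_inv, Real.norm_of_nonneg hc0.le,
      inv_mul_cancel₀ hc0.ne']
  obtain ⟨γ, L, hL, hγ, hper, hinj, himg⟩ := exists_closed_parametrization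
    h.isCompact_frontier_inter hconn hK hVb hV1 hinv hCp hquad
  have hγc : Continuous γ := continuous_iff_continuousAt.2 fun t => (hγ t).continuousAt
  have hmem : ∀ t, γ t ∈ frontier N ∩ frontier Ω := by
    intro t
    obtain ⟨y, hy, hyt⟩ := Function.Periodic.exists_mem_Ico₀ (f := γ) hper hL t
    rw [hyt, ← himg]
    exact mem_image_of_mem _ hy
  have hcl : ∀ t, γ t ∈ closure Ω := fun t => frontier_subset_closure (hmem t).2
  set n : ℝ → E2 := fun t => V (γ t) with hn
  have hnn : ∀ t, n t = c⁻¹ • gC Ω u (γ t) := fun t => hVn _ (hmem t)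
  have hn1 : ∀ t, ‖n t‖ = 1 := fun t => hV1 _ (hmem t)
  have hnd : ∀ t, HasDerivAt n (c⁻¹ • hC Ω u (γ t) (rotJ (n t))) t := by
    intro t
    have h1 := (h.hasFDerivWithinAt_gC (hcl t)).comp_hasDerivWithinAt (s := univ) t
      (hγ t).hasDerivWithinAt (fun s _ => hcl s)
    rw [hasDerivWithinAt_univ] at h1
    have h2 := h1.const_smul c⁻¹
    exact h2.congr_of_eventuallyEq (Eventually.of_forall hnn)
  have hnc : Continuous n := continuous_iff_continuousAt.2 fun t => (hnd t).continuousAt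
  set β : ℝ → ℝ := fun t => c⁻¹ * ⟪hC Ω u (γ t) (rotJ (n t)), rotJ (n t)⟫ with hβ
  have hnβ : ∀ t, c⁻¹ • hC Ω u (γ t) (rotJ (n t)) = β t • rotJ (n t) := by
    intro t
    set w := c⁻¹ • hC Ω u (γ t) (rotJ (n t)) with hw
    have h0 : ⟪n t, w⟫ = 0 := by
      have h1 := (hnd t).inner ℝ (hnd t)
      have h2 : (fun t => ⟪n t, n t⟫) = fun _ => (1 : ℝ) := by
        funext s; rw [real_inner_self_eq_norm_sq, hn1, one_pow]
      rw [h2] at h1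
      have h3 := h1.unique (hasDerivAt_const t 1)
      rw [← hw, real_inner_comm (n t) w] at h3
      linarith
    have hT1 : ‖rotJ (n t)‖ = 1 := by rw [norm_rotJ, hn1]
    have h1 := eq_inner_smul_of_inner_rotJ_eq_zero (w := w) hT1
      (by rw [rotJ_rotJ, inner_neg_right, real_inner_comm, h0, neg_zero])
    rw [h1, hβ, hw, inner_smul_left]
    simp
  refine ⟨L, C, s₀, γ, n, β, hc0, hL, hCp, hs₀, hγ, hnn, hn1, fun t => hnβ t ▸ hnd t, fun t => rfl,
    ?_, hper, hinj, himg, fun s t => hquad _ (hmem t) _ (hmem s),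
    fun t s h0 h1 => (hs _ (hmem t) s h0 h1).1, fun t s h0 h1 => (hs _ (hmem t) s h0 h1).2⟩
  have h1 : Continuous fun t => hC Ω u (γ t) :=
    h.continuousOn_hC.comp_continuous hγc hcl
  have h2 : Continuous fun t => rotJ (n t) := rotJ.continuous.comp hnc
  exact continuous_const.mul ((h1.clm_apply h2).inner h2)

namespace IsBoundaryCurve

variable {Ω N : Set E2} {u : E2 → ℝ} {c L C s₀ : ℝ} {γ n : ℝ → E2} {β : ℝ → ℝ}

theorem continuous (hb : IsBoundaryCurve Ω N u c L C s₀ γ n β) : Continuous γ :=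
  continuous_iff_continuousAt.2 fun t => (hb.hasDerivAt t).continuousAt

theorem continuous_normal (hb : IsBoundaryCurve Ω N u c L C s₀ γ n β) : Continuous n :=
  continuous_iff_continuousAt.2 fun t => (hb.hasDerivAt_normal t).continuousAt

theorem mem (hb : IsBoundaryCurve Ω N u c L C s₀ γ n β) (t : ℝ) :
    γ t ∈ frontier N ∩ frontier Ω := by
  obtain ⟨y, hy, hyt⟩ := Function.Periodic.exists_mem_Ico₀ (f := γ) hb.periodic hb.L_pos t
  rw [hyt, ← hb.image]
  exact mem_image_of_mem _ hy

theorem mem_closure (hb : IsBoundaryCurve Ω N u c L C s₀ γ n β) (t : ℝ) : γ t ∈ closure Ω :=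
  frontier_subset_closure (hb.mem t).2

theorem norm_tangent (hb : IsBoundaryCurve Ω N u c L C s₀ γ n β) (t : ℝ) : ‖rotJ (n t)‖ = 1 := by
  rw [norm_rotJ, hb.norm_normal]

theorem injOn (hb : IsBoundaryCurve Ω N u c L C s₀ γ n β) : InjOn γ (Ico 0 L) := by
  have key : ∀ s ∈ Ico 0 L, ∀ t ∈ Ico 0 L, s < t → γ s ≠ γ t := by
    intro s hs t ht hst heq
    refine hb.injective s (t - s) (by linarith) (by linarith [hs.1, ht.2]) ?_
    rw [add_sub_cancel, heq]
  intro s hs t ht heq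
  rcases lt_trichotomy s t with hlt | hlt | hlt
  · exact absurd heq (key s hs t ht hlt)
  · exact hlt
  · exact absurd heq.symm (key t ht s hs hlt)

theorem gC_eq (hb : IsBoundaryCurve Ω N u c L C s₀ γ n β) (t : ℝ) : gC Ω u (γ t) = c • n t := by
  rw [hb.normal_eq, smul_smul, mul_inv_cancel₀ hb.c_pos.ne', one_smul]

theorem hasDerivAt_tangent (hb : IsBoundaryCurve Ω N u c L C s₀ γ n β) (t : ℝ) :
    HasDerivAt (fun t => rotJ (n t)) (β t • rotJ (rotJ (n t))) t := by
  have := rotJ.hasFDerivAt.comp_hasDerivAt t (hb.hasDerivAt_normal t)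
  rw [map_smul] at this
  exact this

theorem exists_curvature_bound (hb : IsBoundaryCurve Ω N u c L C s₀ γ n β) :
    ∃ M : ℝ, 0 < M ∧ ∀ t ∈ Icc 0 L, |β t| ≤ M := by
  obtain ⟨M, hM⟩ := (isCompact_Icc (a := (0 : ℝ)) (b := L)).exists_bound_of_continuousOn
    hb.continuous_curvature.continuousOn
  exact ⟨max M 1, by positivity, fun t ht => (hM t ht).trans (le_max_left _ _)⟩

theorem periodic_normal (hb : IsBoundaryCurve Ω N u c L C s₀ γ n β) (t : ℝ) :
    n (t + L) = n t := by
  rw [hb.normal_eq, hb.normal_eq, hb.periodic]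

theorem periodic_curvature (hb : IsBoundaryCurve Ω N u c L C s₀ γ n β) (t : ℝ) :
    β (t + L) = β t := by
  rw [hb.curvature_eq, hb.curvature_eq, hb.periodic, hb.periodic_normal]

theorem abs_curvature_le (hb : IsBoundaryCurve Ω N u c L C s₀ γ n β) :
    ∃ M : ℝ, 0 < M ∧ ∀ t, |β t| ≤ M := by
  obtain ⟨M, hM0, hM⟩ := hb.exists_curvature_bound
  refine ⟨M, hM0, fun t => ?_⟩
  obtain ⟨y, hy, hyt⟩ := Function.Periodic.exists_mem_Ico₀ (f := β) hb.periodic_curvature hb.L_pos t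
  rw [hyt]
  exact hM y ⟨hy.1, hy.2.le⟩

theorem restrict_hausdorffMeasure (hb : IsBoundaryCurve Ω N u c L C s₀ γ n β) :
    (μH[1] : Measure E2).restrict (frontier N ∩ frontier Ω) =
      Measure.map γ ((volume : Measure ℝ).restrict (Ico 0 L)) := by
  obtain ⟨M, hM0, hM⟩ := hb.abs_curvature_le
  rw [← hb.image]
  refine restrict_hausdorffMeasure_eq_map (K := M.toNNReal) hb.L_pos hb.hasDerivAt ?_
    hb.norm_tangent hb.injOn
  refine lipschitzWith_of_nnnorm_deriv_le
    (fun t => (hb.hasDerivAt_tangent t).differentiableAt) fun t => ?_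
  rw [(hb.hasDerivAt_tangent t).deriv, ← NNReal.coe_le_coe, coe_nnnorm, norm_smul, norm_rotJ,
    norm_rotJ, hb.norm_normal, mul_one, Real.coe_toNNReal _ hM0.le]
  exact hM t

theorem hausdorffMeasure_eq (hb : IsBoundaryCurve Ω N u c L C s₀ γ n β) :
    (μH[1] : Measure E2) (frontier N ∩ frontier Ω) = ENNReal.ofReal L := by
  have := congrArg (fun μ => μ univ) hb.restrict_hausdorffMeasure
  simp only [Measure.restrict_apply_univ] at this
  rw [this, Measure.map_apply hb.continuous.measurable .univ, preimage_univ,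
    Measure.restrict_apply_univ, Real.volume_Ico, sub_zero]

theorem setIntegral_eq (hb : IsBoundaryCurve Ω N u c L C s₀ γ n β) {f : E2 → ℝ} {g : ℝ → ℝ}
    (hfg : ∀ t, f (γ t) = g t) :
    ∫ x in frontier N ∩ frontier Ω, f x ∂μH[1] = ∫ t in (0 : ℝ)..L, g t := by
  have hinj := hb.injOn
  rw [hb.restrict_hausdorffMeasure, intervalIntegral.integral_of_le hb.L_pos.le,
    ← integral_Ico_eq_integral_Ioc]
  have hme : MeasurableEmbedding ((Ico (0 : ℝ) L).domRestrict γ) :=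
    hb.continuous.continuousOn.measurableEmbedding measurableSet_Ico hinj
  have h1 : Measure.map γ ((volume : Measure ℝ).restrict (Ico 0 L)) =
      Measure.map ((Ico (0 : ℝ) L).domRestrict γ) (Measure.comap Subtype.val volume) := by
    rw [← map_comap_subtype_coe measurableSet_Ico, Measure.map_map hb.continuous.measurable
      measurable_subtype_coe]
    rfl
  rw [h1, hme.integral_map, ← integral_subtype_comap measurableSet_Ico]
  simp only [domRestrict_apply, hfg]

end IsBoundaryCurve

namespace IsBoundaryCurve

variable {Ω N : Set E2} {u : E2 → ℝ} {c L C s₀ : ℝ} {γ n : ℝ → E2} {β : ℝ → ℝ}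

theorem u_eq_zero (h : IsSerrinSolution Ω u) (hb : IsBoundaryCurve Ω N u c L C s₀ γ n β) (t : ℝ) :
    u (γ t) = 0 := h.bdry _ (hb.mem t).2

theorem exists_growth (h : IsSerrinSolution Ω u) (hN : IsCompOf N (Ω \ MAXset Ω u))
    (hb : IsBoundaryCurve Ω N u c L C s₀ γ n β) :
    ∃ s₁, 0 < s₁ ∧ s₁ ≤ s₀ ∧ ∀ t s, 0 < s → s < s₁ → c / 2 * s ≤ u (γ t + s • n t) := by
  have hc := hb.c_pos
  have huc := h.isCompact_closure.uniformContinuousOn_of_continuous h.continuousOn_gC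
  obtain ⟨δ, hδ, hδu⟩ := Metric.uniformContinuousOn_iff.1 huc (c / 2) (by positivity)
  refine ⟨min s₀ δ, lt_min hb.s₀_pos hδ, min_le_left _ _, fun t s hs0 hs => ?_⟩
  have hss₀ : s < s₀ := hs.trans_le (min_le_left _ _)
  have hsδ : s < δ := hs.trans_le (min_le_right _ _)
  have hcl : ∀ σ ∈ Icc 0 s, γ t + σ • n t ∈ closure Ω := by
    intro σ hσ
    rcases hσ.1.eq_or_lt with rfl | h0
    · simpa using hb.mem_closure t
    · exact subset_closure
        (IsSerrinSolution.comp_subset hN (hb.collar_mem t σ h0 (hσ.2.trans_lt hss₀))).1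
  have hin : ∀ σ ∈ Ioo 0 s, γ t + σ • n t ∈ Ω := fun σ hσ =>
    (IsSerrinSolution.comp_subset hN (hb.collar_mem t σ hσ.1 (hσ.2.trans hss₀))).1
  have hd : ∀ σ ∈ Ioo 0 s, HasDerivAt (fun σ : ℝ => u (γ t + σ • n t))
      ⟪gC Ω u (γ t + σ • n t), n t⟫ σ := by
    intro σ hσ
    have h1 : HasDerivAt (fun σ : ℝ => γ t + σ • n t) (n t) σ := by
      have := ((hasDerivAt_id σ).smul_const (n t)).const_add (γ t)
      simpa using this
    exact (h.hasFDerivAt (hin σ hσ)).comp_hasDerivAt σ h1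
  have hcont : ContinuousOn (fun σ : ℝ => u (γ t + σ • n t)) (Icc 0 s) :=
    h.continuousOn.comp (by fun_prop) hcl
  have := (convex_Icc 0 s).mul_sub_le_image_sub_of_le_deriv (C := c / 2) hcont
    (fun σ hσ => by
      rw [interior_Icc] at hσ
      exact (hd σ hσ).differentiableAt.differentiableWithinAt)
    (fun σ hσ => by
      rw [interior_Icc] at hσ
      rw [(hd σ hσ).deriv]
      have hdist : dist (γ t + σ • n t) (γ t) < δ := by
        rw [dist_eq_norm, add_sub_cancel_left, norm_smul, hb.norm_normal, mul_one,
          Real.norm_of_nonneg hσ.1.le]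
        exact hσ.2.trans hsδ
      have h2 := hδu _ (hcl σ (Ioo_subset_Icc_self hσ)) _ (hb.mem_closure t) hdist
      rw [dist_eq_norm] at h2
      have h3 := (abs_le.1 (abs_real_inner_le_norm
        (gC Ω u (γ t + σ • n t) - gC Ω u (γ t)) (n t))).1
      rw [inner_sub_left, hb.norm_normal, hb.gC_eq t, inner_smul_left,
        real_inner_self_eq_norm_sq, hb.norm_normal] at h3
      rw [hb.gC_eq t] at h2
      simp only [conj_trivial] at h3
      linarith) 0 (left_mem_Icc.2 hs0.le) s (right_mem_Icc.2 hs0.le) hs0.le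
  simpa [hb.u_eq_zero h t] using this

theorem exists_level (h : IsSerrinSolution Ω u) (hN : IsCompOf N (Ω \ MAXset Ω u))
    {δ : ℝ} (hδ : 0 < δ) :
    ∃ ε₀ > 0, ∀ y ∈ N, u y ≤ ε₀ → y ∈ Metric.thickening δ (frontier N ∩ frontier Ω) := by
  set A := closure N \ Metric.thickening δ (frontier N ∩ frontier Ω) with hA
  have hAc : IsCompact A :=
    (h.isCompact_closure.of_isClosed_subset isClosed_closure
      (IsSerrinSolution.closure_comp_subset hN)).diff
      Metric.isOpen_thickening
  rcases A.eq_empty_or_nonempty with he | hne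
  · refine ⟨1, one_pos, fun y hy _ => ?_⟩
    by_contra hn
    have : y ∈ A := ⟨subset_closure hy, hn⟩
    rw [he] at this
    exact this
  · obtain ⟨z, hz, hmin⟩ := hAc.exists_isMinOn hne
      (h.continuousOn.mono (sdiff_subset.trans (IsSerrinSolution.closure_comp_subset hN)))
    have huz : 0 < u z := by
      rcases h.closure_comp_cases hN hz.1 with h1 | h1 | h1
      · exact h.pos (IsSerrinSolution.comp_subset hN h1).1
      · exact absurd (Metric.self_subset_thickening hδ _ h1) hz.2
      · rw [h1.2]; exact h.umax_pos
    refine ⟨u z / 2, by positivity, fun y hy hyu => ?_⟩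
    by_contra hn
    have := hmin (show y ∈ A from ⟨subset_closure hy, hn⟩)
    simp only [mem_ofPred_eq] at this
    linarith

theorem exists_eq_add_smul (h : IsSerrinSolution Ω u) (hN : IsCompOf N (Ω \ MAXset Ω u))
    (hb : IsBoundaryCurve Ω N u c L C s₀ γ n β) :
    ∃ ε₀ > 0, ∀ ε ≤ ε₀, ∀ y ∈ N, u y < ε →
      ∃ t ∈ Ico 0 L, ∃ s, 0 < s ∧ s < 2 / c * ε ∧ y = γ t + s • n t := by
  obtain ⟨s₁, hs₁, hs₁₀, hgr⟩ := hb.exists_growth h hN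
  obtain ⟨ε₀, hε₀, hlev⟩ := exists_level h hN hs₁
  refine ⟨ε₀, hε₀, fun ε hε y hy hyε => ?_⟩
  have hmem := hlev y hy (hyε.le.trans hε)
  obtain ⟨z, hz, hyz⟩ := Metric.mem_thickening_iff.1 hmem
  obtain ⟨x, hx, hxd⟩ := (h.isCompact_frontier_inter (N := N)).exists_infDist_eq_dist ⟨z, hz⟩ y
  have hxy : dist y x < s₁ := by
    rw [← hxd]; exact (Metric.infDist_le_dist_of_mem hz).trans_lt hyz
  rw [← hb.image] at hx
  obtain ⟨t, ht, rfl⟩ := hx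
  have hmin : ∀ s, dist y (γ t) ≤ dist y (γ s) := fun s => by
    rw [← hxd]; exact Metric.infDist_le_dist_of_mem (hb.mem s)
  have horth : ⟪y - γ t, rotJ (n t)⟫ = 0 := by
    have h1 : HasDerivAt (fun s => ⟪y - γ s, y - γ s⟫)
        (⟪y - γ t, -rotJ (n t)⟫ + ⟪-rotJ (n t), y - γ t⟫) t :=
      ((hb.hasDerivAt t).const_sub y).inner ℝ ((hb.hasDerivAt t).const_sub y)
    have h2 : IsLocalMin (fun s => ⟪y - γ s, y - γ s⟫) t := by
      refine Eventually.of_forall fun s => ?_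
      simp only [real_inner_self_eq_norm_sq]
      have := hmin s
      rw [dist_eq_norm, dist_eq_norm] at this
      gcongr
    have h3 := h2.hasDerivAt_eq_zero h1
    rw [real_inner_comm (y - γ t), inner_neg_right] at h3
    linarith
  have hy' := eq_inner_smul_of_inner_rotJ_eq_zero (hb.norm_normal t) horth
  set μ := ⟪y - γ t, n t⟫ with hμ
  have hμabs : |μ| < s₁ := by
    have : ‖y - γ t‖ = |μ| := by rw [hy', norm_smul, hb.norm_normal, mul_one, Real.norm_eq_abs]
    rw [← this, ← dist_eq_norm]; exact hxy
  have hyeq : y = γ t + μ • n t := by rw [← hy', add_sub_cancel]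
  have hyΩ := (IsSerrinSolution.comp_subset hN hy).1
  have hμ0 : 0 < μ := by
    rcases lt_trichotomy μ 0 with hneg | hzero | hpos
    · exfalso
      rw [abs_of_neg hneg] at hμabs
      refine hb.collar_not_mem t (-μ) (by linarith) (by linarith) (subset_closure ?_)
      rwa [neg_smul, sub_neg_eq_add, ← hyeq]
    · exfalso
      have h1 := h.pos hyΩ
      rw [hyeq, hzero, zero_smul, add_zero, hb.u_eq_zero h] at h1
      exact lt_irrefl _ h1
    · exact hpos
  refine ⟨t, ht, μ, hμ0, ?_, hyeq⟩
  have h1 := hgr t μ hμ0 (by rwa [abs_of_pos hμ0] at hμabs)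
  rw [← hyeq] at h1
  have hc := hb.c_pos
  rw [div_mul_eq_mul_div, lt_div_iff₀ hc]
  linarith

theorem collar_injective (hb : IsBoundaryCurve Ω N u c L C s₀ γ n β) {t t' s s' : ℝ}
    (ht : t ∈ Ico 0 L) (ht' : t' ∈ Ico 0 L) (hs0 : 0 ≤ s) (hs : 2 * C * s < 1) (hs0' : 0 ≤ s')
    (hs' : 2 * C * s' < 1) (heq : γ t + s • n t = γ t' + s' • n t') : t = t' ∧ s = s' := by
  have key : ∀ t t' s s' : ℝ, 0 ≤ s → γ t + s • n t = γ t' + s' • n t' →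
      s ^ 2 + (1 - 2 * C * s) * ‖γ t - γ t'‖ ^ 2 ≤ s' ^ 2 := by
    intro t t' s s' hs0 heq
    have h1 : s' • n t' = (γ t - γ t') + s • n t := by
      rw [sub_add_eq_add_sub, heq, add_sub_cancel_left]
    have h2 := congrArg (fun w => ‖w‖ ^ 2) h1
    simp only [norm_smul, hb.norm_normal, mul_one, Real.norm_eq_abs, sq_abs] at h2
    rw [norm_add_sq_real, inner_smul_right, norm_smul, hb.norm_normal, mul_one, Real.norm_eq_abs,
      sq_abs] at h2
    have h3 := (abs_le.1 (hb.quadratic t' t)).2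
    rw [norm_sub_rev, ← neg_sub, inner_neg_left] at h3
    nlinarith
  have h1 := key t t' s s' hs0 heq
  have h2 := key t' t s' s hs0' heq.symm
  rw [norm_sub_rev] at h2
  have h3 : ‖γ t - γ t'‖ ^ 2 = 0 := by
    have := sq_nonneg ‖γ t - γ t'‖
    nlinarith
  have h4 : γ t = γ t' := sub_eq_zero.1 (norm_eq_zero.1 (pow_eq_zero_iff two_ne_zero |>.1 h3))
  have h5 := hb.injOn ht ht' h4
  subst h5
  rw [h3] at h1 h2
  refine ⟨rfl, ?_⟩
  nlinarith

theorem tendsto_div (h : IsSerrinSolution Ω u) (hN : IsCompOf N (Ω \ MAXset Ω u))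
    (hb : IsBoundaryCurve Ω N u c L C s₀ γ n β) (t : ℝ) {σ : ℝ} (hσ : 0 < σ) :
    Tendsto (fun ε : ℝ => u (γ t + (ε * σ) • n t) / ε) (𝓝[>] 0) (𝓝 (c * σ)) := by
  have h1 := h.hasFDerivWithinAt (hb.mem_closure t)
  have hmaps : ∀ᶠ ε : ℝ in 𝓝[>] 0, γ t + (ε * σ) • n t ∈ closure Ω := by
    have h2 : ∀ᶠ ε : ℝ in 𝓝[>] 0, ε * σ < s₀ := by
      have : Tendsto (fun ε : ℝ => ε * σ) (𝓝[>] 0) (𝓝 (0 * σ)) :=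
        (tendsto_id.mono_left nhdsWithin_le_nhds).mul_const σ
      rw [zero_mul] at this
      exact this.eventually (gt_mem_nhds hb.s₀_pos)
    filter_upwards [h2, self_mem_nhdsWithin] with ε hε hε0
    exact subset_closure (IsSerrinSolution.comp_subset hN (hb.collar_mem t _ (mul_pos hε0 hσ) hε)).1
  have h3 := h1.lim (l := 𝓝[>] (0 : ℝ)) (c := fun ε => ε⁻¹) (d := fun ε => (ε * σ) • n t)
    (v := σ • n t) ?_ ?_ ?_
  · rw [hb.gC_eq t] at h3
    simp only [innerSL_apply_apply, inner_smul_left, inner_smul_right, real_inner_self_eq_norm_sq,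
      hb.norm_normal, hb.u_eq_zero h] at h3
    simpa [div_eq_inv_mul, mul_comm σ c] using h3
  · have : Tendsto (fun ε : ℝ => (ε * σ) • n t) (𝓝[>] 0) (𝓝 ((0 * σ) • n t)) :=
      ((tendsto_id.mono_left nhdsWithin_le_nhds).mul_const σ).smul_const (n t)
    simpa using this
  · exact hmaps
  · refine tendsto_const_nhds.congr' ?_
    filter_upwards [self_mem_nhdsWithin] with ε hε
    rw [smul_smul, ← mul_assoc, inv_mul_cancel₀ (ne_of_gt hε), one_mul]

end IsBoundaryCurve

/-- The trace of an endomorphism of the plane. -/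
def planeTrace (A : E2 →L[ℝ] E2) : ℝ :=
  A (EuclideanSpace.single 0 1) 0 + A (EuclideanSpace.single 1 1) 1

theorem planeTrace_add (A B : E2 →L[ℝ] E2) :
    planeTrace (A + B) = planeTrace A + planeTrace B := by
  simp only [planeTrace, add_apply, PiLp.add_apply]; ring

theorem planeTrace_smul (a : ℝ) (A : E2 →L[ℝ] E2) :
    planeTrace (a • A) = a * planeTrace A := by
  simp only [planeTrace, smul_apply, PiLp.smul_apply, smul_eq_mul]; ring

theorem planeTrace_smulRight (v w : E2) :
    planeTrace ((innerSL ℝ v).smulRight w) = ⟪v, w⟫ := by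
  simp [planeTrace, E2_inner, EuclideanSpace.inner_single_right]

theorem continuous_planeTrace : Continuous planeTrace := by
  unfold planeTrace; fun_prop

theorem abs_planeTrace_le (A : E2 →L[ℝ] E2) : |planeTrace A| ≤ 2 * ‖A‖ := by
  have h (i : Fin 2) : |A (EuclideanSpace.single i 1) i| ≤ ‖A‖ := by
    calc |A (EuclideanSpace.single i 1) i| ≤ ‖A (EuclideanSpace.single i 1)‖ :=
          PiLp.norm_apply_le (A (EuclideanSpace.single i 1)) i
      _ ≤ ‖A‖ * ‖(EuclideanSpace.single i 1 : E2)‖ := A.le_opNorm _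
      _ = ‖A‖ := by simp
  calc |planeTrace A| ≤ _ + _ := abs_add_le _ _
    _ ≤ 2 * ‖A‖ := by linarith [h 0, h 1]

theorem integral_planeTrace_eq_zero {Z : E2 → E2} {Z' : E2 → E2 →L[ℝ] E2}
    (hZ : ∀ x, HasFDerivAt Z (Z' x) x) (hi : Integrable Z) (hi' : Integrable Z') :
    ∫ x, planeTrace (Z' x) = 0 := by
  have hintegrable : ∀ i : Fin 2, Integrable fun x => Z' x (EuclideanSpace.single i 1) i := fun i =>
    (EuclideanSpace.proj i : E2 →L[ℝ] ℝ).integrable_comp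
      ((ContinuousLinearMap.apply ℝ E2 (EuclideanSpace.single i (1 : ℝ) : E2)).integrable_comp hi')
  have key : ∀ i : Fin 2, ∫ x, Z' x (EuclideanSpace.single i 1) i = 0 := by
    intro i
    have h1 : ∀ x, HasFDerivAt (fun y => Z y i)
        ((EuclideanSpace.proj i : E2 →L[ℝ] ℝ).comp (Z' x)) x := fun x =>
      (EuclideanSpace.proj i : E2 →L[ℝ] ℝ).hasFDerivAt.comp x (hZ x)
    have h2 := integral_bilinear_hasFDerivAt_right_eq_neg_left_of_integrable (μ := volume)
      (f := fun _ : E2 => (1 : ℝ)) (f' := fun _ => 0) (g := fun y => Z y i)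
      (v := EuclideanSpace.single i 1) (B := ContinuousLinearMap.mul ℝ ℝ) (by simp)
      (by
        simp only [ContinuousLinearMap.mul_apply', one_mul]
        exact hintegrable i)
      (by
        simp only [ContinuousLinearMap.mul_apply', one_mul]
        exact (EuclideanSpace.proj i : E2 →L[ℝ] ℝ).integrable_comp hi)
      (fun x _ => hasFDerivAt_const _ _) (fun x _ => h1 x)
    simpa using h2
  simp only [planeTrace]
  rw [integral_add (hintegrable 0) (hintegrable 1), key 0, key 1, add_zero]

theorem exists_cutoff : ∃ χ χ' : ℝ → ℝ, (∀ s, HasDerivAt χ (χ' s) s) ∧ Continuous χ' ∧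
    (∀ s ≤ 1 / 2, χ s = 0) ∧ (∀ s, 1 ≤ s → χ s = 1) ∧ (∀ s, |χ s| ≤ 1) ∧
    (∀ s, 1 ≤ s → χ' s = 0) ∧ ∃ B, ∀ s, |χ' s| ≤ B := by
  have hsm : ContDiff ℝ 1 fun s : ℝ => Real.smoothTransition (2 * s - 1) :=
    Real.smoothTransition.contDiff.comp (by fun_prop)
  set χ := fun s : ℝ => Real.smoothTransition (2 * s - 1) with hχ
  have hd : ∀ s, HasDerivAt χ (deriv χ s) s := fun s =>
    (hsm.differentiable one_ne_zero s).hasDerivAt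
  have hdc : Continuous (deriv χ) := hsm.continuous_deriv le_rfl
  have h0 : ∀ s ≤ (1 / 2 : ℝ), χ s = 0 := fun s hs =>
    Real.smoothTransition.zero_of_nonpos (by linarith)
  have h1 : ∀ s : ℝ, 1 ≤ s → χ s = 1 := fun s hs =>
    Real.smoothTransition.one_of_one_le (by linarith)
  have hab : ∀ s, |χ s| ≤ 1 := fun s =>
    abs_le.2 ⟨by linarith [Real.smoothTransition.nonneg (2 * s - 1)], Real.smoothTransition.le_one _⟩
  have hz1 : ∀ s : ℝ, 1 ≤ s → deriv χ s = 0 := fun s hs => by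
    have hmax : IsLocalMax χ s := Eventually.of_forall fun y => by
      rw [h1 s hs]; exact Real.smoothTransition.le_one _
    exact hmax.deriv_eq_zero
  have hz0 : ∀ s : ℝ, s ≤ 1 / 2 → deriv χ s = 0 := fun s hs => by
    have hmin : IsLocalMin χ s := Eventually.of_forall fun y => by
      rw [h0 s hs]; exact Real.smoothTransition.nonneg _
    exact hmin.deriv_eq_zero
  obtain ⟨B, hB⟩ := (isCompact_Icc (a := (1 / 2 : ℝ)) (b := 1)).exists_bound_of_continuousOn
    hdc.continuousOn
  refine ⟨χ, deriv χ, hd, hdc, h0, h1, hab, hz1, B, fun s => ?_⟩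
  have hB0 : 0 ≤ B := (norm_nonneg _).trans (hB 1 ⟨by norm_num, le_rfl⟩)
  by_cases hs : s ∈ Icc (1 / 2 : ℝ) 1
  · exact hB s hs
  · rw [mem_Icc, not_and_or, not_le, not_le] at hs
    rcases hs with hs | hs
    · rwa [hz0 s hs.le, abs_zero]
    · rwa [hz1 s hs.le, abs_zero]

theorem setIntegral_E2_mul (s t : Set ℝ) (f g : ℝ → ℝ) :
    ∫ p in {p : E2 | p 0 ∈ s ∧ p 1 ∈ t}, f (p 0) * g (p 1) =
      (∫ x in s, f x) * ∫ y in t, g y := by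
  have hmp : MeasurePreserving (fun p : E2 => (p 0, p 1)) (volume : Measure E2)
      (volume : Measure (ℝ × ℝ)) :=
    (volume_preserving_finTwoArrow ℝ).comp (PiLp.volume_preserving_ofLp (Fin 2))
  have hemb : MeasurableEmbedding (fun p : E2 => (p 0, p 1)) :=
    (MeasurableEquiv.finTwoArrow (α := ℝ)).measurableEmbedding.comp
      (MeasurableEquiv.toLp 2 (Fin 2 → ℝ)).symm.measurableEmbedding
  have := hmp.setIntegral_preimage_emb hemb (fun q : ℝ × ℝ => f q.1 * g q.2) (s ×ˢ t)
  rw [Measure.volume_eq_prod, setIntegral_prod_mul] at this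
  exact this

/-- The differential of a collar map `p ↦ γ (p 0) + ε (p 1) n (p 0)`. -/
def collarDeriv (a ε : ℝ) (n : E2) : E2 →L[ℝ] E2 :=
  (EuclideanSpace.proj 0 : E2 →L[ℝ] ℝ).smulRight (a • rotJ n) +
    (EuclideanSpace.proj 1 : E2 →L[ℝ] ℝ).smulRight (ε • n)

theorem det_collarDeriv (a ε : ℝ) {n : E2} (hn : ‖n‖ = 1) : (collarDeriv a ε n).det = -(a * ε) := by
  have h1 : n 0 ^ 2 + n 1 ^ 2 = 1 := by rw [← E2_norm_sq, hn, one_pow]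
  rw [ContinuousLinearMap.det,
    ← LinearMap.det_toMatrix (EuclideanSpace.basisFun (Fin 2) ℝ).toBasis, Matrix.det_fin_two]
  simp [LinearMap.toMatrix_apply, collarDeriv]
  linear_combination (-a * ε) * h1

namespace IsBoundaryCurve

variable {Ω N : Set E2} {u : E2 → ℝ} {c L C s₀ : ℝ} {γ n : ℝ → E2} {β : ℝ → ℝ}

theorem hasFDerivAt_collar (hb : IsBoundaryCurve Ω N u c L C s₀ γ n β) (ε : ℝ) (p : E2) :
    HasFDerivAt (fun p : E2 => γ (p 0) + (ε * p 1) • n (p 0))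
      (collarDeriv (1 + ε * p 1 * β (p 0)) ε (n (p 0))) p := by
  have h0 : HasFDerivAt (fun p : E2 => p 0) (EuclideanSpace.proj 0 : E2 →L[ℝ] ℝ) p :=
    (EuclideanSpace.proj 0 : E2 →L[ℝ] ℝ).hasFDerivAt
  have h1 : HasFDerivAt (fun p : E2 => p 1) (EuclideanSpace.proj 1 : E2 →L[ℝ] ℝ) p :=
    (EuclideanSpace.proj 1 : E2 →L[ℝ] ℝ).hasFDerivAt
  have h2 := (hb.hasDerivAt (p 0)).hasFDerivAt.comp p h0
  have h3 := (hb.hasDerivAt_normal (p 0)).hasFDerivAt.comp p h0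
  have h4 := h2.add ((h1.const_mul ε).smul h3)
  refine h4.congr_fderiv ?_
  ext w i
  simp [collarDeriv]
  ring

end IsBoundaryCurve

theorem integrableOn_of_continuousOn_of_norm_le {E : Type*} [NormedAddCommGroup E]
    [SecondCountableTopology E] {f : E2 → E} {s : Set E2} (hs : MeasurableSet s)
    (hbdd : Bornology.IsBounded s) (hf : ContinuousOn f s) {M : ℝ} (hM : ∀ x ∈ s, ‖f x‖ ≤ M) :
    IntegrableOn f s :=
  IntegrableOn.of_bound hbdd.measure_lt_top (hf.aestronglyMeasurable hs) M
    ((ae_restrict_iff' hs).2 (Eventually.of_forall hM))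

theorem integrable_indicator_of_integrableOn {E : Type*} [NormedAddCommGroup E] {f : E2 → E}
    {s : Set E2} (hs : MeasurableSet s) (hf : IntegrableOn f s) : Integrable (s.indicator f) :=
  hf.integrable_indicator hs

/-- The differential of the field `χ (u / ε) • K`. -/
def cutoffDeriv (Ω : Set E2) (u : E2 → ℝ) (K : E2 → E2) (K' : E2 → E2 →L[ℝ] E2) (χ χ' : ℝ → ℝ)
    (ε : ℝ) (x : E2) : E2 →L[ℝ] E2 :=
  χ (u x / ε) • K' x + (innerSL ℝ ((χ' (u x / ε) / ε) • gC Ω u x)).smulRight (K x)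

theorem planeTrace_cutoffDeriv (Ω : Set E2) (u : E2 → ℝ) (K : E2 → E2) (K' : E2 → E2 →L[ℝ] E2)
    (χ χ' : ℝ → ℝ) (ε : ℝ) (x : E2) :
    planeTrace (cutoffDeriv Ω u K K' χ χ' ε x) = χ (u x / ε) * planeTrace (K' x) +
      χ' (u x / ε) / ε * ⟪gC Ω u x, K x⟫ := by
  rw [cutoffDeriv, planeTrace_add, planeTrace_smul, planeTrace_smulRight, inner_smul_left,
    conj_trivial]

namespace IsSerrinSolution

variable {Ω N : Set E2} {u : E2 → ℝ}

open Classical in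
theorem hasFDerivAt_cutoff (h : IsSerrinSolution Ω u) (hN : IsCompOf N (Ω \ MAXset Ω u))
    {K : E2 → E2} {K' : E2 → E2 →L[ℝ] E2}
    (hK : ∀ x ∈ N, HasFDerivAt K (K' x) x)
    (hmax : ∀ x ∈ closure N ∩ MAXset Ω u, K =O[𝓝[N] x] fun y => ‖y - x‖ ^ 2)
    {χ χ' : ℝ → ℝ} (hχ : ∀ s, HasDerivAt χ (χ' s) s)
    (hχ0 : ∀ s ≤ 1 / 2, χ s = 0) (hχ1 : ∀ s, |χ s| ≤ 1)
    {ε : ℝ} (hε : 0 < ε) (x : E2) :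
    HasFDerivAt (N.indicator fun x => χ (u x / ε) • K x)
      (N.indicator (cutoffDeriv Ω u K K' χ χ' ε) x) x := by
  have hNo := h.isOpen_comp hN
  have hNΩ : N ⊆ Ω := fun x hx => (IsSerrinSolution.comp_subset hN hx).1
  have hzero : ∀ x, x ∉ N → (∀ᶠ y in 𝓝 x, y ∈ N → u y / ε ≤ 1 / 2) →
      HasFDerivAt (N.indicator fun x => χ (u x / ε) • K x)
        (N.indicator (cutoffDeriv Ω u K K' χ χ' ε) x) x := by
    intro x hx hev
    rw [indicator_of_notMem hx]
    refine (hasFDerivAt_const (0 : E2) x).congr_of_eventuallyEq ?_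
    filter_upwards [hev] with y hy
    by_cases hyN : y ∈ N
    · rw [indicator_of_mem hyN, hχ0 _ (hy hyN), zero_smul]
    · rw [indicator_of_notMem hyN]
  by_cases hxN : x ∈ N
  · have h1 : HasFDerivAt (fun x => χ (u x / ε)) _ x :=
      (hχ (u x / ε)).comp_hasFDerivAt x ((h.hasFDerivAt (hNΩ hxN)).mul_const ε⁻¹)
    have h2 := h1.smul (hK x hxN)
    rw [indicator_of_mem hxN]
    refine (h2.congr_of_eventuallyEq ?_).congr_fderiv ?_
    · filter_upwards [hNo.mem_nhds hxN] with y hy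
      rw [indicator_of_mem hy]
      rfl
    · ext w i
      simp only [cutoffDeriv, add_apply, smul_apply, ContinuousLinearMap.smulRight_apply,
        innerSL_apply_apply, inner_smul_left, smul_eq_mul, PiLp.add_apply, PiLp.smul_apply,
        conj_trivial]
      ring
  · by_cases hxc : x ∈ closure N
    · rcases h.closure_comp_cases hN hxc with h1 | h1 | h1
      · exact absurd h1 hxN
      · refine hzero x hxN ?_
        have h2 : ∀ᶠ y in 𝓝[closure Ω] x, u y < ε / 2 :=
          (h.continuousOn x (frontier_subset_closure h1.2)).tendsto.eventually_lt_const
            (by rw [h.bdry x h1.2]; positivity)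
        rw [eventually_nhdsWithin_iff] at h2
        filter_upwards [h2] with y hy hyN
        have := hy (subset_closure (hNΩ hyN))
        rw [div_le_div_iff₀ hε two_pos]
        linarith
      · rw [hasFDerivAt_iff_isLittleO, indicator_of_notMem hxN, indicator_of_notMem hxN]
        simp only [sub_zero, _root_.zero_apply]
        have h3 : (N.indicator fun x => χ (u x / ε) • K x) =O[𝓝 x]
            fun y => ‖y - x‖ ^ 2 := by
          obtain ⟨M, hM⟩ := (hmax x ⟨hxc, h1⟩).bound
          rw [eventually_nhdsWithin_iff] at hM
          refine Asymptotics.IsBigO.of_bound |M| (hM.mono fun y hy => ?_)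
          by_cases hyN : y ∈ N
          · rw [indicator_of_mem hyN, norm_smul]
            calc ‖χ (u y / ε)‖ * ‖K y‖ ≤ 1 * ‖K y‖ :=
                  mul_le_mul_of_nonneg_right (hχ1 _) (norm_nonneg _)
              _ = ‖K y‖ := one_mul _
              _ ≤ M * _ := hy hyN
              _ ≤ _ := mul_le_mul_of_nonneg_right (le_abs_self M) (norm_nonneg _)
          · rw [indicator_of_notMem hyN, norm_zero]
            positivity
        refine h3.trans_isLittleO ?_
        have h4 : (fun y : E2 => y - x) =o[𝓝 x] fun _ => (1 : ℝ) := by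
          rw [Asymptotics.isLittleO_one_iff]
          have : Tendsto (fun y : E2 => y - x) (𝓝 x) (𝓝 (x - x)) :=
            (continuous_id.sub continuous_const).tendsto x
          rwa [sub_self] at this
        have h5 := h4.norm_left.mul_isBigO (Asymptotics.isBigO_refl (fun y => ‖y - x‖) (𝓝 x))
        simp only [one_mul, ← sq] at h5
        exact h5.of_norm_right
    · refine hzero x hxN ?_
      filter_upwards [isClosed_closure.isOpen_compl.mem_nhds hxc] with y hy hyN
      exact absurd (subset_closure hyN) hy

theorem integral_cutoff (h : IsSerrinSolution Ω u) (hN : IsCompOf N (Ω \ MAXset Ω u))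
    {K : E2 → E2} {K' : E2 → E2 →L[ℝ] E2} {M : ℝ}
    (hK : ∀ x ∈ N, HasFDerivAt K (K' x) x) (hK'c : ContinuousOn K' N)
    (hKM : ∀ x ∈ N, ‖K x‖ ≤ M) (hK'M : ∀ x ∈ N, ‖K' x‖ ≤ M)
    (hmax : ∀ x ∈ closure N ∩ MAXset Ω u, K =O[𝓝[N] x] fun y => ‖y - x‖ ^ 2)
    {χ χ' : ℝ → ℝ} (hχ : ∀ s, HasDerivAt χ (χ' s) s) (hχ'c : Continuous χ')
    (hχ0 : ∀ s ≤ 1 / 2, χ s = 0) (hχ1 : ∀ s, |χ s| ≤ 1) {B : ℝ} (hB : ∀ s, |χ' s| ≤ B)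
    {ε : ℝ} (hε : 0 < ε) :
    (∫ x in N, χ (u x / ε) * planeTrace (K' x)) +
      ∫ x in N, χ' (u x / ε) / ε * ⟪gC Ω u x, K x⟫ = 0 := by
  have hNo := h.isOpen_comp hN
  have hNm := hNo.measurableSet
  have hNΩ : N ⊆ Ω := fun x hx => (IsSerrinSolution.comp_subset hN hx).1
  have hNb : Bornology.IsBounded N := h.bounded.subset hNΩ
  have hχc : Continuous χ := continuous_iff_continuousAt.2 fun s => (hχ s).continuousAt
  have huN : ContinuousOn u N := h.continuousOn.mono (hNΩ.trans subset_closure)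
  have hgN : ContinuousOn (gC Ω u) N := h.continuousOn_gC.mono (hNΩ.trans subset_closure)
  have hKN : ContinuousOn K N := fun x hx => (hK x hx).continuousAt.continuousWithinAt
  obtain ⟨G, hG⟩ := h.isCompact_closure.exists_bound_of_continuousOn h.continuousOn_gC
  have hB0 : 0 ≤ B := (abs_nonneg _).trans (hB 0)
  have hχuN : ContinuousOn (fun x => χ (u x / ε)) N := hχc.comp_continuousOn (huN.div_const ε)
  have hχ'uN : ContinuousOn (fun x => χ' (u x / ε) / ε) N :=
    (hχ'c.comp_continuousOn (huN.div_const ε)).div_const ε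
  set D := cutoffDeriv Ω u K K' χ χ' ε with hD
  have hbd : ∀ x ∈ N, |χ' (u x / ε) / ε| ≤ B / ε := fun x _ => by
    rw [abs_div, abs_of_pos hε]
    exact div_le_div_of_nonneg_right (hB _) hε.le
  have hDb : ∀ x ∈ N, ‖D x‖ ≤ M + B / ε * G * M := by
    intro x hx
    refine (norm_add_le _ _).trans (add_le_add ?_ ?_)
    · rw [norm_smul]
      exact (mul_le_mul (hχ1 _) (hK'M x hx) (norm_nonneg _) zero_le_one).trans_eq (one_mul M)
    · rw [ContinuousLinearMap.norm_smulRight_apply, innerSL_apply_norm, norm_smul]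
      have h2 := hG x (subset_closure (hNΩ hx))
      exact mul_le_mul (mul_le_mul (hbd x hx) h2 (norm_nonneg _) (by positivity)) (hKM x hx)
        (norm_nonneg _) (mul_nonneg (by positivity) ((norm_nonneg _).trans h2))
  have hDc : ContinuousOn D N := by
    have h1 : ContinuousOn (fun x => innerSL ℝ ((χ' (u x / ε) / ε) • gC Ω u x)) N :=
      (innerSL ℝ).continuous.comp_continuousOn (hχ'uN.smul hgN)
    exact (hχuN.smul hK'c).add
      (((ContinuousLinearMap.smulRightL ℝ E2 E2).continuous.comp_continuousOn h1).clm_apply hKN)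
  have hDi : IntegrableOn D N := integrableOn_of_continuousOn_of_norm_le hNm hNb hDc hDb
  have hZi : IntegrableOn (fun x => χ (u x / ε) • K x) N :=
    integrableOn_of_continuousOn_of_norm_le hNm hNb (hχuN.smul hKN) (M := M) fun x hx => by
      rw [norm_smul]
      exact (mul_le_mul (hχ1 _) (hKM x hx) (norm_nonneg _) zero_le_one).trans_eq (one_mul M)
  have hDi' : Integrable (N.indicator D) :=
    integrable_indicator_of_integrableOn (E := E2 →L[ℝ] E2) hNm hDi
  have hfin := integral_planeTrace_eq_zero (h.hasFDerivAt_cutoff hN hK hmax hχ hχ0 hχ1 hε)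
    (hZi.integrable_indicator hNm) hDi'
  have h1 : (fun x => planeTrace (N.indicator D x)) = N.indicator fun x => planeTrace (D x) := by
    ext x
    by_cases hx : x ∈ N
    · simp [hx]
    · simp [hx, planeTrace]
  rw [← hD, h1, integral_indicator hNm] at hfin
  simp only [hD, planeTrace_cutoffDeriv] at hfin
  rwa [integral_add] at hfin
  · refine integrableOn_of_continuousOn_of_norm_le hNm hNb
      (hχuN.mul (continuous_planeTrace.comp_continuousOn hK'c)) (M := 2 * M) fun x hx => ?_
    rw [norm_mul]
    have h2 := (abs_planeTrace_le (K' x)).trans (mul_le_mul_of_nonneg_left (hK'M x hx) two_pos.le)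
    exact (mul_le_mul (hχ1 _) h2 (abs_nonneg _) zero_le_one).trans_eq (one_mul _)
  · refine integrableOn_of_continuousOn_of_norm_le hNm hNb
      (hχ'uN.mul (hgN.inner hKN)) (M := B / ε * (G * M)) fun x hx => ?_
    rw [norm_mul]
    have h2 := hG x (subset_closure (hNΩ hx))
    have h5 : ‖⟪gC Ω u x, K x⟫‖ ≤ G * M := (norm_inner_le_norm _ _).trans
      (mul_le_mul h2 (hKM x hx) (norm_nonneg _) ((norm_nonneg _).trans h2))
    exact mul_le_mul (hbd x hx) h5 (norm_nonneg _) (by positivity)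

end IsSerrinSolution

namespace IsBoundaryCurve

variable {Ω N : Set E2} {u : E2 → ℝ} {c L C s₀ : ℝ} {γ n : ℝ → E2} {β : ℝ → ℝ}

theorem exists_collar_bound (h : IsSerrinSolution Ω u) (hN : IsCompOf N (Ω \ MAXset Ω u))
    (hb : IsBoundaryCurve Ω N u c L C s₀ γ n β) :
    ∃ ε₁ : ℝ, 0 < ε₁ ∧ ∀ ε : ℝ, 0 < ε → ε < ε₁ →
      (∀ t σ : ℝ, 0 < σ → σ < 2 / c → γ t + (ε * σ) • n t ∈ N ∧ |1 + ε * σ * β t| ≤ 2) ∧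
      InjOn (fun p : E2 => γ (p 0) + (ε * p 1) • n (p 0))
        {p : E2 | p 0 ∈ Ico 0 L ∧ p 1 ∈ Ioo 0 (2 / c)} ∧
      ∀ y ∈ N, u y < ε → y ∈ (fun p : E2 => γ (p 0) + (ε * p 1) • n (p 0)) ''
        {p : E2 | p 0 ∈ Ico 0 L ∧ p 1 ∈ Ioo 0 (2 / c)} := by
  obtain ⟨ε₀, hε₀, hcov⟩ := hb.exists_eq_add_smul h hN
  obtain ⟨m, hm, hβ⟩ := hb.abs_curvature_le
  have hc := hb.c_pos
  have hCp := hb.C_pos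
  refine ⟨min (min ε₀ (s₀ / (2 / c))) (min (1 / (2 * C * (2 / c))) (1 / (2 / c * m))),
    lt_min (lt_min hε₀ (div_pos hb.s₀_pos (by positivity)))
      (lt_min (by positivity) (by positivity)),
    fun ε hε hlt => ?_⟩
  obtain ⟨⟨h1, h2⟩, h3, h4⟩ : (ε < ε₀ ∧ ε < s₀ / (2 / c)) ∧
      ε < 1 / (2 * C * (2 / c)) ∧ ε < 1 / (2 / c * m) := by
    simpa only [lt_min_iff] using hlt
  rw [lt_div_iff₀ (by positivity)] at h2 h3 h4
  have hsmall : ∀ σ : ℝ, σ < 2 / c → ε * σ < ε * (2 / c) := fun σ hσ =>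
    mul_lt_mul_of_pos_left hσ hε
  refine ⟨fun t σ hσ0 hσ => ⟨hb.collar_mem t _ (by positivity) ((hsmall σ hσ).trans h2), ?_⟩, ?_, ?_⟩
  · have h5 : |ε * σ * β t| ≤ 1 := by
      rw [abs_mul, abs_of_pos (by positivity : 0 < ε * σ)]
      calc ε * σ * |β t| ≤ ε * (2 / c) * m :=
            mul_le_mul (hsmall σ hσ).le (hβ t) (abs_nonneg _) (by positivity)
        _ ≤ 1 := by linarith
    have h6 := abs_add_le 1 (ε * σ * β t)
    rw [abs_one] at h6
    linarith
  · intro p hp q hq hpq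
    have hsm : ∀ σ : ℝ, σ < 2 / c → 2 * C * (ε * σ) < 1 := fun σ hσ => by
      have := mul_lt_mul_of_pos_left (hsmall σ hσ) (by positivity : 0 < 2 * C)
      linarith
    obtain ⟨h5, h6⟩ := hb.collar_injective hp.1 hq.1 (mul_pos hε hp.2.1).le (hsm _ hp.2.2)
      (mul_pos hε hq.2.1).le (hsm _ hq.2.2) hpq
    ext i
    fin_cases i
    · exact h5
    · exact mul_left_cancel₀ hε.ne' h6
  · intro y hy hyε
    obtain ⟨t, ht, s, hs0, hs, rfl⟩ := hcov ε h1.le y hy hyε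
    refine ⟨!₂[t, s / ε], ⟨by simpa using ht, ?_, ?_⟩, ?_⟩
    · simp only [Matrix.cons_val_one, Matrix.cons_val_fin_one]; positivity
    · simp only [Matrix.cons_val_one, Matrix.cons_val_fin_one]
      rwa [div_lt_iff₀ hε]
    · simp [mul_div_cancel₀ s hε.ne']

theorem tendsto_collar_integral (h : IsSerrinSolution Ω u) (hN : IsCompOf N (Ω \ MAXset Ω u))
    (hb : IsBoundaryCurve Ω N u c L C s₀ γ n β)
    {K : E2 → E2} {M : ℝ} (hKc : ContinuousOn K (closure N)) (hKM : ∀ x ∈ N, ‖K x‖ ≤ M)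
    {χ χ' : ℝ → ℝ} (hχ : ∀ s, HasDerivAt χ (χ' s) s) (hχ'c : Continuous χ')
    (hχ0 : χ 0 = 0) (hχ2 : χ 2 = 1) (hχ'1 : ∀ s, 1 ≤ s → χ' s = 0)
    {B : ℝ} (hB : ∀ s, |χ' s| ≤ B) :
    Tendsto (fun ε : ℝ => ∫ x in N, χ' (u x / ε) / ε * ⟪gC Ω u x, K x⟫) (𝓝[>] 0)
      (𝓝 (∫ t in (0)..L, ⟪K (γ t), n t⟫)) := by
  obtain ⟨ε₁, hε₁, hcol⟩ := hb.exists_collar_bound h hN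
  have hc := hb.c_pos
  have hNo := h.isOpen_comp hN
  have hNΩ : N ⊆ Ω := fun x hx => (IsSerrinSolution.comp_subset hN hx).1
  have hNc : N ⊆ closure Ω := hNΩ.trans subset_closure
  obtain ⟨G, hG⟩ := h.isCompact_closure.exists_bound_of_continuousOn h.continuousOn_gC
  have hB0 : 0 ≤ B := (abs_nonneg _).trans (hB 0)
  set S : Set E2 := {p : E2 | p 0 ∈ Ico 0 L ∧ p 1 ∈ Ioo 0 (2 / c)} with hS
  have hSm : MeasurableSet S := by
    have h0 : Measurable fun p : E2 => p 0 := (EuclideanSpace.proj 0 : E2 →L[ℝ] ℝ).measurable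
    have h1 : Measurable fun p : E2 => p 1 := (EuclideanSpace.proj 1 : E2 →L[ℝ] ℝ).measurable
    exact (h0 measurableSet_Ico).inter (h1 measurableSet_Ioo)
  have hSb : Bornology.IsBounded S := by
    refine isBounded_iff_forall_norm_le.2 ⟨|L| + |2 / c|, fun p hp => ?_⟩
    have h1 := EuclideanSpace.norm_eq p
    rw [Fin.sum_univ_two] at h1
    rw [h1]
    refine Real.sqrt_le_iff.2 ⟨by positivity, ?_⟩
    have h2 : |p 0| ≤ |L| := abs_le_abs_of_nonneg hp.1.1 hp.1.2.le
    have h3 : |p 1| ≤ |2 / c| := abs_le_abs_of_nonneg hp.2.1.le hp.2.2.le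
    simp only [Real.norm_eq_abs]
    nlinarith [abs_nonneg (p 0), abs_nonneg (p 1)]
  set Φ : ℝ → E2 → E2 := fun ε p => γ (p 0) + (ε * p 1) • n (p 0) with hΦ
  set I : ℝ → E2 → ℝ := fun ε p => |1 + ε * p 1 * β (p 0)| *
    (χ' (u (Φ ε p) / ε) * ⟪gC Ω u (Φ ε p), K (Φ ε p)⟫) with hI
  have hmaps : ∀ ε : ℝ, 0 < ε → ε < ε₁ → MapsTo (Φ ε) S N := fun ε h0 h1 p hp =>
    ((hcol ε h0 h1).1 (p 0) (p 1) hp.2.1 hp.2.2).1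
  have hev : ∀ᶠ ε : ℝ in 𝓝[>] 0, 0 < ε ∧ ε < ε₁ := by
    filter_upwards [self_mem_nhdsWithin, nhdsWithin_le_nhds (gt_mem_nhds hε₁)] with ε h0 h1
    exact ⟨h0, h1⟩
  have hchange : ∀ ε : ℝ, 0 < ε → ε < ε₁ →
      ∫ x in N, χ' (u x / ε) / ε * ⟪gC Ω u x, K x⟫ = ∫ p in S, I ε p := by
    intro ε h0 h1
    obtain ⟨-, hinj, hcov⟩ := hcol ε h0 h1
    have h2 : ∫ x in N, χ' (u x / ε) / ε * ⟪gC Ω u x, K x⟫ =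
        ∫ x in Φ ε '' S, χ' (u x / ε) / ε * ⟪gC Ω u x, K x⟫ := by
      refine setIntegral_eq_of_subset_of_forall_sdiff_eq_zero hNo.measurableSet
        (hmaps ε h0 h1).image_subset fun x hx => ?_
      have h3 : ε ≤ u x := by
        by_contra hlt
        exact hx.2 (hcov x hx.1 (not_le.1 hlt))
      rw [hχ'1 _ ((one_le_div h0).2 h3), zero_div, zero_mul]
    rw [h2, integral_image_eq_integral_abs_det_fderiv_smul volume hSm
      (fun p _ => (hb.hasFDerivAt_collar ε p).hasFDerivWithinAt) hinj]
    refine setIntegral_congr_fun hSm fun p _ => ?_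
    simp only [hI, hΦ, det_collarDeriv _ _ (hb.norm_normal _), abs_neg, abs_mul, abs_of_pos h0,
      smul_eq_mul]
    field_simp
  have hgoal : ∫ t in (0)..L, ⟪K (γ t), n t⟫ =
      ∫ p in S, ⟪K (γ (p 0)), n (p 0)⟫ * (c * χ' (c * p 1)) := by
    rw [hS, setIntegral_E2_mul (Ico 0 L) (Ioo 0 (2 / c)) (fun t => ⟪K (γ t), n t⟫)
      (fun σ => c * χ' (c * σ)), intervalIntegral.integral_of_le hb.L_pos.le,
      integral_Ico_eq_integral_Ioc, ← integral_Ioc_eq_integral_Ioo,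
      ← intervalIntegral.integral_of_le (by positivity : (0 : ℝ) ≤ 2 / c)]
    have h1 : ∫ σ in (0)..(2 / c), c * χ' (c * σ) = χ (c * (2 / c)) - χ (c * 0) := by
      refine intervalIntegral.integral_eq_sub_of_hasDerivAt (f := fun σ => χ (c * σ))
        (fun σ _ => ?_) (Continuous.intervalIntegrable (by fun_prop) _ _)
      have := (hχ (c * σ)).comp σ ((hasDerivAt_id σ).const_mul c)
      simpa [mul_comm, Function.comp_def] using this
    rw [h1, mul_div_cancel₀ _ hc.ne', mul_zero, hχ0, hχ2, sub_zero, mul_one]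
  rw [hgoal]
  refine (tendsto_congr' (hev.mono fun ε hε => hchange ε hε.1 hε.2)).2 ?_
  have hΦc : ∀ ε, Continuous (Φ ε) := fun ε => continuous_iff_continuousAt.2 fun p =>
    (hb.hasFDerivAt_collar ε p).continuousAt
  refine tendsto_integral_filter_of_dominated_convergence (fun _ => 2 * (B * (G * M))) ?_ ?_ ?_ ?_
  · filter_upwards [hev] with ε hε
    refine ContinuousOn.aestronglyMeasurable ?_ hSm
    have hm := hmaps ε hε.1 hε.2
    have h1 : ContinuousOn (fun p : E2 => |1 + ε * p 1 * β (p 0)|) S := by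
      have h0 : Continuous fun p : E2 => p 0 := (EuclideanSpace.proj 0 : E2 →L[ℝ] ℝ).continuous
      have h1 : Continuous fun p : E2 => p 1 := (EuclideanSpace.proj 1 : E2 →L[ℝ] ℝ).continuous
      have h2 : Continuous fun p : E2 => β (p 0) := hb.continuous_curvature.comp h0
      exact (continuous_const.add ((continuous_const.mul h1).mul h2)).abs.continuousOn
    have h2 : ContinuousOn (fun p => u (Φ ε p)) S :=
      h.continuousOn.comp (hΦc ε).continuousOn fun p hp => hNc (hm hp)
    have h3 : ContinuousOn (fun p => gC Ω u (Φ ε p)) S :=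
      h.continuousOn_gC.comp (hΦc ε).continuousOn fun p hp => hNc (hm hp)
    have h4 : ContinuousOn (fun p => K (Φ ε p)) S :=
      hKc.comp (hΦc ε).continuousOn fun p hp => subset_closure (hm hp)
    exact h1.mul ((hχ'c.comp_continuousOn (h2.div_const ε)).mul (h3.inner h4))
  · filter_upwards [hev] with ε hε
    refine (ae_restrict_iff' hSm).2 (Eventually.of_forall fun p hp => ?_)
    have hm := hmaps ε hε.1 hε.2 hp
    have h1 := ((hcol ε hε.1 hε.2).1 (p 0) (p 1) hp.2.1 hp.2.2).2
    have h2 := hG _ (hNc hm)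
    have h5 : ‖⟪gC Ω u (Φ ε p), K (Φ ε p)⟫‖ ≤ G * M := (norm_inner_le_norm _ _).trans
      (mul_le_mul h2 (hKM _ hm) (norm_nonneg _) ((norm_nonneg _).trans h2))
    simp only [hI]
    rw [norm_mul, norm_mul, norm_abs_eq_norm]
    exact mul_le_mul h1 (mul_le_mul (hB _) h5 (norm_nonneg _) hB0) (by positivity) (by norm_num)
  · exact integrableOn_const hSb.measure_lt_top.ne
  · refine (ae_restrict_iff' hSm).2 (Eventually.of_forall fun p hp => ?_)
    have hid : Tendsto (fun ε : ℝ => ε) (𝓝[>] 0) (𝓝 0) := tendsto_id.mono_left nhdsWithin_le_nhds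
    have hΦ0 : Tendsto (fun ε => Φ ε p) (𝓝[>] 0) (𝓝 (γ (p 0))) := by
      have := ((hid.mul_const (p 1)).smul_const (n (p 0))).const_add (γ (p 0))
      simpa using this
    have hΦN : ∀ᶠ ε in 𝓝[>] (0 : ℝ), Φ ε p ∈ N := hev.mono fun ε hε => hmaps ε hε.1 hε.2 hp
    have h1 : Tendsto (fun ε : ℝ => |1 + ε * p 1 * β (p 0)|) (𝓝[>] 0) (𝓝 1) := by
      have := (((hid.mul_const (p 1)).mul_const (β (p 0))).const_add 1).abs
      simpa using this
    have h2 : Tendsto (fun ε => χ' (u (Φ ε p) / ε)) (𝓝[>] 0) (𝓝 (χ' (c * p 1))) :=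
      (hχ'c.tendsto _).comp (hb.tendsto_div h hN (p 0) hp.2.1)
    have h3 : Tendsto (fun ε => gC Ω u (Φ ε p)) (𝓝[>] 0) (𝓝 (gC Ω u (γ (p 0)))) :=
      (h.continuousOn_gC _ (hb.mem_closure _)).tendsto.comp
        (tendsto_nhdsWithin_iff.2 ⟨hΦ0, hΦN.mono fun ε hε => hNc hε⟩)
    have h4 : Tendsto (fun ε => K (Φ ε p)) (𝓝[>] 0) (𝓝 (K (γ (p 0)))) :=
      (hKc _ (frontier_subset_closure (hb.mem _).1)).tendsto.comp
        (tendsto_nhdsWithin_iff.2 ⟨hΦ0, hΦN.mono fun ε hε => subset_closure hε⟩)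
    have h5 := h1.mul (h2.mul (h3.inner (𝕜 := ℝ) h4))
    rw [hb.gC_eq, inner_smul_left, real_inner_comm, conj_trivial, one_mul] at h5
    convert h5 using 2
    ring

theorem integral_planeTrace (h : IsSerrinSolution Ω u) (hN : IsCompOf N (Ω \ MAXset Ω u))
    (hb : IsBoundaryCurve Ω N u c L C s₀ γ n β)
    {K : E2 → E2} {K' : E2 → E2 →L[ℝ] E2} {M : ℝ}
    (hK : ∀ x ∈ N, HasFDerivAt K (K' x) x) (hKc : ContinuousOn K (closure N))
    (hK'c : ContinuousOn K' N) (hKM : ∀ x ∈ N, ‖K x‖ ≤ M) (hK'M : ∀ x ∈ N, ‖K' x‖ ≤ M)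
    (hmax : ∀ x ∈ closure N ∩ MAXset Ω u, K =O[𝓝[N] x] fun y => ‖y - x‖ ^ 2) :
    ∫ x in N, planeTrace (K' x) = -∫ t in (0)..L, ⟪K (γ t), n t⟫ := by
  obtain ⟨χ, χ', hχ, hχ'c, hχ0, hχ1, hχb, hχ'1, B, hB⟩ := exists_cutoff
  have hNo := h.isOpen_comp hN
  have hNΩ : N ⊆ Ω := fun x hx => (IsSerrinSolution.comp_subset hN hx).1
  have hNb : Bornology.IsBounded N := h.bounded.subset hNΩ
  have hχc : Continuous χ := continuous_iff_continuousAt.2 fun s => (hχ s).continuousAt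
  have huN : ContinuousOn u N := h.continuousOn.mono (hNΩ.trans subset_closure)
  have h1 := hb.tendsto_collar_integral h hN hKc hKM hχ hχ'c (hχ0 0 (by norm_num))
    (hχ1 2 one_le_two) hχ'1 hB
  have hid : Tendsto (fun ε : ℝ => ε) (𝓝[>] 0) (𝓝 0) := tendsto_id.mono_left nhdsWithin_le_nhds
  have h2 : Tendsto (fun ε : ℝ => ∫ x in N, χ (u x / ε) * planeTrace (K' x)) (𝓝[>] 0)
      (𝓝 (∫ x in N, planeTrace (K' x))) := by
    refine tendsto_integral_filter_of_dominated_convergence (fun _ => 2 * M)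
      (Eventually.of_forall fun ε => ?_) (Eventually.of_forall fun ε => ?_)
      (integrableOn_const hNb.measure_lt_top.ne) ?_
    · exact ((hχc.comp_continuousOn (huN.div_const ε)).mul
        (continuous_planeTrace.comp_continuousOn hK'c)).aestronglyMeasurable hNo.measurableSet
    · refine (ae_restrict_iff' hNo.measurableSet).2 (Eventually.of_forall fun x hx => ?_)
      rw [norm_mul]
      have h2 := (abs_planeTrace_le (K' x)).trans (mul_le_mul_of_nonneg_left (hK'M x hx) two_pos.le)
      exact (mul_le_mul (hχb _) h2 (abs_nonneg _) zero_le_one).trans_eq (one_mul _)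
    · refine (ae_restrict_iff' hNo.measurableSet).2 (Eventually.of_forall fun x hx => ?_)
      refine tendsto_const_nhds.congr' ?_
      filter_upwards [self_mem_nhdsWithin, hid.eventually (gt_mem_nhds (h.pos (hNΩ hx)))] with ε h0 hlt
      rw [hχ1 _ ((one_le_div h0).2 hlt.le), one_mul]
  have h3 := h2.add h1
  have h4 : Tendsto (fun _ : ℝ => (0 : ℝ)) (𝓝[>] (0 : ℝ)) (𝓝 0) := tendsto_const_nhds
  have h5 := tendsto_nhds_unique (h4.congr' ?_) h3
  · linarith
  · filter_upwards [self_mem_nhdsWithin] with ε hε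
    exact (h.integral_cutoff hN hK hK'c hKM hK'M hmax hχ hχ'c hχ0 hχb hB hε).symm

end IsBoundaryCurve

theorem planeTrace_sub (A B : E2 →L[ℝ] E2) :
    planeTrace (A - B) = planeTrace A - planeTrace B := by
  simp only [planeTrace, sub_apply, PiLp.sub_apply]; ring

theorem planeTrace_id : planeTrace (ContinuousLinearMap.id ℝ E2) = 2 := by
  norm_num [planeTrace]

/-- The Pohozaev-type field attached to a plane vector field `g`, with potential term `a`. -/
def pohozaevField (Ω : Set E2) (u : E2 → ℝ) (m : ℝ) (x : E2) : E2 :=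
  ⟪x, gC Ω u x⟫ • gC Ω u x - (⟪gC Ω u x, gC Ω u x⟫ / 2 + 2 * (m - u x)) • x

/-- The differential of `pohozaevField`. -/
def pohozaevDeriv (Ω : Set E2) (u : E2 → ℝ) (m : ℝ) (x : E2) : E2 →L[ℝ] E2 :=
  ⟪x, gC Ω u x⟫ • hC Ω u x
    + (innerSL ℝ (gC Ω u x) + (innerSL ℝ x).comp (hC Ω u x)).smulRight (gC Ω u x)
    - ((⟪gC Ω u x, gC Ω u x⟫ / 2 + 2 * (m - u x)) • ContinuousLinearMap.id ℝ E2
      + ((innerSL ℝ (gC Ω u x)).comp (hC Ω u x) - (2 : ℝ) • innerSL ℝ (gC Ω u x)).smulRight x)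

namespace IsSerrinSolution

variable {Ω N : Set E2} {u : E2 → ℝ}

theorem hasFDerivAt_pohozaevField (h : IsSerrinSolution Ω u) (m : ℝ) {x : E2} (hx : x ∈ Ω) :
    HasFDerivAt (pohozaevField Ω u m) (pohozaevDeriv Ω u m x) x := by
  have hg := h.hasFDerivAt_gC hx
  have hu := h.hasFDerivAt hx
  have h1 := ((hasFDerivAt_id x).inner ℝ hg).smul hg
  have h2 := (((hg.inner ℝ hg).const_mul (1 / 2)).add ((hu.const_sub m).const_mul 2)).smul
    (hasFDerivAt_id x)
  refine ((h1.sub h2).congr_of_eventuallyEq (Eventually.of_forall fun y => ?_)).congr_fderiv ?_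
  · simp only [pohozaevField, Pi.sub_apply, Pi.smul_apply', id, Pi.add_apply]
    congr 2; ring
  · ext w i
    simp [pohozaevDeriv, fderivInnerCLM_apply]
    rw [real_inner_comm (hC Ω u x w) (gC Ω u x), real_inner_comm w (gC Ω u x)]
    ring

theorem planeTrace_hC (h : IsSerrinSolution Ω u) {x : E2} (hx : x ∈ Ω) :
    planeTrace (hC Ω u x) = -2 := h.trace_hC_of_mem hx

theorem planeTrace_comp_smulRight (A : E2 →L[ℝ] E2) (v w : E2) :
    planeTrace (((innerSL ℝ v).comp A).smulRight w) = ⟪v, A w⟫ := by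
  conv_rhs => rw [E2_eq w, map_add, map_smul, map_smul, inner_add_right, inner_smul_right,
    inner_smul_right]
  simp [planeTrace]
  ring

theorem planeTrace_pohozaevDeriv (h : IsSerrinSolution Ω u) (m : ℝ) {x : E2} (hx : x ∈ Ω) :
    planeTrace (pohozaevDeriv Ω u m x) = -4 * (m - u x) := by
  have hs := h.hC_symm hx (gC Ω u x) x
  have e1 : (innerSL ℝ (gC Ω u x) + (innerSL ℝ x).comp (hC Ω u x)).smulRight (gC Ω u x) =
      (innerSL ℝ (gC Ω u x)).smulRight (gC Ω u x) +
        ((innerSL ℝ x).comp (hC Ω u x)).smulRight (gC Ω u x) := by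
    ext w i; simp; ring
  have e2 : ((innerSL ℝ (gC Ω u x)).comp (hC Ω u x) -
      (2 : ℝ) • innerSL ℝ (gC Ω u x)).smulRight x =
      ((innerSL ℝ (gC Ω u x)).comp (hC Ω u x)).smulRight x -
        (2 : ℝ) • (innerSL ℝ (gC Ω u x)).smulRight x := by
    ext w i; simp; ring
  rw [pohozaevDeriv, planeTrace_sub, planeTrace_add, planeTrace_add, e1, e2, planeTrace_add,
    planeTrace_sub, planeTrace_smul, planeTrace_smul, planeTrace_smul, planeTrace_id,
    planeTrace_smulRight, planeTrace_smulRight, planeTrace_comp_smulRight,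
    planeTrace_comp_smulRight, h.planeTrace_hC hx, real_inner_comm (hC Ω u x (gC Ω u x)) x] at *
  rw [hs, real_inner_comm (hC Ω u x x) (gC Ω u x), real_inner_comm x (gC Ω u x)]
  ring

theorem continuousOn_pohozaevField (h : IsSerrinSolution Ω u) (m : ℝ) :
    ContinuousOn (pohozaevField Ω u m) (closure Ω) := by
  have hg := h.continuousOn_gC
  have hu := h.continuousOn
  have hx : ContinuousOn (fun x : E2 => x) (closure Ω) := continuousOn_id
  have h1 : ContinuousOn (fun x => ⟪x, gC Ω u x⟫) (closure Ω) := hx.inner hg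
  have h2 : ContinuousOn (fun x => ⟪gC Ω u x, gC Ω u x⟫) (closure Ω) := hg.inner hg
  unfold pohozaevField
  fun_prop

theorem continuousOn_pohozaevDeriv (h : IsSerrinSolution Ω u) (m : ℝ) :
    ContinuousOn (pohozaevDeriv Ω u m) (closure Ω) := by
  have hg := h.continuousOn_gC
  have hu := h.continuousOn
  have hh := h.continuousOn_hC
  have hx : ContinuousOn (fun x : E2 => x) (closure Ω) := continuousOn_id
  have h1 : ContinuousOn (fun x => ⟪x, gC Ω u x⟫) (closure Ω) := hx.inner hg
  have h2 : ContinuousOn (fun x => ⟪gC Ω u x, gC Ω u x⟫) (closure Ω) := hg.inner hg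
  have hig : ContinuousOn (fun x => innerSL ℝ (gC Ω u x)) (closure Ω) :=
    (innerSL ℝ).continuous.comp_continuousOn hg
  have hix : ContinuousOn (fun x : E2 => innerSL ℝ x) (closure Ω) :=
    (innerSL ℝ).continuous.continuousOn
  have hsm : ∀ {φ : E2 → E2 →L[ℝ] ℝ} {w : E2 → E2}, ContinuousOn φ (closure Ω) →
      ContinuousOn w (closure Ω) → ContinuousOn (fun x => (φ x).smulRight (w x)) (closure Ω) :=
    fun hφ hw =>
      ((ContinuousLinearMap.smulRightL ℝ E2 E2).continuous.comp_continuousOn hφ).clm_apply hw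
  have h3 : ContinuousOn (fun x => (innerSL ℝ x).comp (hC Ω u x)) (closure Ω) := hix.clm_comp hh
  have h4 : ContinuousOn (fun x => (innerSL ℝ (gC Ω u x)).comp (hC Ω u x)) (closure Ω) :=
    hig.clm_comp hh
  have h5 := hsm (hig.add h3) hg
  have h6 := hsm (h4.sub (hig.const_smul (2 : ℝ))) hx
  have h7 : ContinuousOn (fun x => ⟪x, gC Ω u x⟫ • hC Ω u x) (closure Ω) := h1.smul hh
  have h8 : ContinuousOn (fun x => (⟪gC Ω u x, gC Ω u x⟫ / 2 + 2 * (m - u x)) •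
      ContinuousLinearMap.id ℝ E2) (closure Ω) := by
    fun_prop
  unfold pohozaevDeriv
  exact (h7.add h5).sub (h8.add h6)

theorem gC_isBigO (h : IsSerrinSolution Ω u) {x : E2} (hx : x ∈ MAXset Ω u) :
    gC Ω u =O[𝓝 x] fun y => y - x := by
  have := (h.hasFDerivAt_gC hx.1).isBigO_sub
  simpa [h.gC_eq_zero_of_mem_MAXset hx] using this

theorem umax_sub_isBigO (h : IsSerrinSolution Ω u) {x : E2} (hx : x ∈ MAXset Ω u) :
    (fun y => umax Ω u - u y) =O[𝓝 x] fun y => ‖y - x‖ ^ 2 := by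
  obtain ⟨B, hB⟩ := (h.gC_isBigO hx).bound
  obtain ⟨r, hr, hball⟩ := Metric.eventually_nhds_iff_ball.1 (hB.and (h.isOpen.mem_nhds hx.1))
  refine Asymptotics.IsBigO.of_bound |B| ?_
  filter_upwards [Metric.ball_mem_nhds x hr] with y hy
  have hsub : Metric.closedBall x ‖y - x‖ ⊆ Metric.ball x r := by
    refine Metric.closedBall_subset_ball ?_
    rwa [← dist_eq_norm]
  have := (convex_closedBall x ‖y - x‖).norm_image_sub_le_of_norm_hasFDerivWithin_le
    (f := u) (f' := fun y => innerSL ℝ (gC Ω u y)) (C := |B| * ‖y - x‖)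
    (fun z hz => (h.hasFDerivAt (hball z (hsub hz)).2).hasFDerivWithinAt)
    (fun z hz => by
      rw [innerSL_apply_norm]
      refine (hball z (hsub hz)).1.trans ?_
      have h1 : ‖z - x‖ ≤ ‖y - x‖ := by rw [← dist_eq_norm]; exact hz
      exact mul_le_mul (le_abs_self B) h1 (norm_nonneg _) (abs_nonneg B))
    (Metric.mem_closedBall_self (norm_nonneg _)) (show y ∈ Metric.closedBall x ‖y - x‖ by
      rw [Metric.mem_closedBall, dist_eq_norm])
  rw [norm_sub_rev, hx.2] at this
  rw [norm_pow, norm_norm]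
  linarith [this]

theorem pohozaevField_isBigO (h : IsSerrinSolution Ω u) {x : E2} (hx : x ∈ MAXset Ω u) :
    pohozaevField Ω u (umax Ω u) =O[𝓝 x] fun y => ‖y - x‖ ^ 2 := by
  have hg := (h.gC_isBigO hx).norm_right
  have hi : (fun y : E2 => y) =O[𝓝 x] fun _ => (1 : ℝ) :=
    (continuous_id.tendsto x).isBigO_one ℝ
  have h1 : (fun y => ⟪y, gC Ω u y⟫) =O[𝓝 x] fun y => ‖y - x‖ := by
    refine (Asymptotics.IsBigO.of_bound 1 (Eventually.of_forall fun y => ?_)).trans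
      (by simpa using hi.norm_left.mul hg.norm_left)
    simpa using norm_inner_le_norm (𝕜 := ℝ) y (gC Ω u y)
  have h2 : (fun y => ⟪gC Ω u y, gC Ω u y⟫) =O[𝓝 x] fun y => ‖y - x‖ ^ 2 := by
    have := hg.norm_left.pow 2
    simpa only [real_inner_self_eq_norm_sq] using this
  have h3 : (fun y => ⟪y, gC Ω u y⟫ • gC Ω u y) =O[𝓝 x] fun y => ‖y - x‖ ^ 2 := by
    simpa only [sq, smul_eq_mul] using h1.smul hg
  have h4 : (fun y => ⟪gC Ω u y, gC Ω u y⟫ / 2 + 2 * (umax Ω u - u y)) =O[𝓝 x]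
      fun y => ‖y - x‖ ^ 2 := by
    have := (h2.const_mul_left (1 / 2)).add ((h.umax_sub_isBigO hx).const_mul_left 2)
    refine this.congr_left fun y => ?_
    ring
  refine h3.sub ?_
  simpa using h4.smul hi

end IsSerrinSolution

namespace IsBoundaryCurve

variable {Ω N : Set E2} {u : E2 → ℝ} {c L C s₀ : ℝ} {γ n : ℝ → E2} {β : ℝ → ℝ}

theorem pohozaev_identity (h : IsSerrinSolution Ω u) (hN : IsCompOf N (Ω \ MAXset Ω u))
    (hb : IsBoundaryCurve Ω N u c L C s₀ γ n β) {η η' : ℝ → ℝ} {B : ℝ}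
    (hη : ∀ s ∈ Ioo 0 (umax Ω u), HasDerivAt η (η' s) s)
    (hηc : ContinuousOn η (Icc 0 (umax Ω u))) (hη'c : ContinuousOn η' (Ioo 0 (umax Ω u)))
    (hη'b : ∀ s ∈ Ioo 0 (umax Ω u), |η' s| ≤ B)
    (hηb : ∀ s ∈ Icc 0 (umax Ω u), |η s| ≤ 2 * (umax Ω u - s)) :
    ∫ x in N, (2 * η (u x) - 4 * (umax Ω u - u x) - η' (u x) * ‖gC Ω u x‖ ^ 2) =
      η 0 * c * L - (c ^ 2 / 2 - 2 * umax Ω u) * ∫ t in (0)..L, ⟪γ t, n t⟫ := by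
  set m := umax Ω u with hm
  have hNΩ : N ⊆ Ω := fun x hx => (IsSerrinSolution.comp_subset hN hx).1
  have hNc : N ⊆ closure Ω := hNΩ.trans subset_closure
  have hclc : closure N ⊆ closure Ω := IsSerrinSolution.closure_comp_subset hN
  have huI : ∀ x ∈ N, u x ∈ Ioo 0 m := fun x hx =>
    ⟨h.pos (hNΩ hx), lt_of_le_of_ne (h.le_umax (hNc hx)) fun heq =>
      (IsSerrinSolution.comp_subset hN hx).2 ⟨hNΩ hx, heq⟩⟩
  have huI' : ∀ x ∈ closure Ω, u x ∈ Icc 0 m := fun x hx => ⟨h.nonneg hx, h.le_umax hx⟩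
  have hm0 : 0 < m := h.umax_pos
  have hηu : ContinuousOn (fun x => η (u x)) (closure Ω) := hηc.comp h.continuousOn huI'
  obtain ⟨G, hG⟩ := h.isCompact_closure.exists_bound_of_continuousOn h.continuousOn_gC
  obtain ⟨H, hH⟩ := h.isCompact_closure.exists_bound_of_continuousOn h.continuousOn_hC
  obtain ⟨P, hP⟩ := h.isCompact_closure.exists_bound_of_continuousOn
    (h.continuousOn_pohozaevField m)
  obtain ⟨P', hP'⟩ := h.isCompact_closure.exists_bound_of_continuousOn
    (h.continuousOn_pohozaevDeriv m)
  set K : E2 → E2 := fun x => pohozaevField Ω u m x - η (u x) • gC Ω u x with hKdef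
  set K' : E2 → E2 →L[ℝ] E2 := fun x => pohozaevDeriv Ω u m x -
    (η (u x) • hC Ω u x + (η' (u x)) • (innerSL ℝ (gC Ω u x)).smulRight (gC Ω u x)) with hK'def
  have hK : ∀ x ∈ N, HasFDerivAt K (K' x) x := fun x hx => by
    have h1 := (hη (u x) (huI x hx)).comp_hasFDerivAt x (h.hasFDerivAt (hNΩ hx))
    have h2 := h1.smul (h.hasFDerivAt_gC (hNΩ hx))
    refine ((h.hasFDerivAt_pohozaevField m (hNΩ hx)).sub h2).congr_fderiv ?_
    ext w i
    simp [hK'def]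
    ring
  have hKc : ContinuousOn K (closure Ω) :=
    (h.continuousOn_pohozaevField m).sub (hηu.smul h.continuousOn_gC)
  have hgN := h.continuousOn_gC.mono hNc
  have hK'c : ContinuousOn K' N := by
    have h1 : ContinuousOn (fun x => innerSL ℝ (gC Ω u x)) N :=
      (innerSL ℝ).continuous.comp_continuousOn hgN
    exact ((h.continuousOn_pohozaevDeriv m).mono hNc).sub
      (((hηu.mono hNc).smul (h.continuousOn_hC.mono hNc)).add
        ((hη'c.comp (h.continuousOn.mono hNc) huI).smul
          (((ContinuousLinearMap.smulRightL ℝ E2 E2).continuous.comp_continuousOn h1).clm_apply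
            hgN)))
  obtain ⟨M₁, hM₁⟩ := h.isCompact_closure.exists_bound_of_continuousOn hKc
  have hK'b : ∀ x ∈ N, ‖K' x‖ ≤ P' + (2 * m * H + B * (G * G)) := by
    intro x hx
    have hxc := hNc hx
    refine (norm_sub_le _ _).trans (add_le_add (hP' x hxc) ((norm_add_le _ _).trans
      (add_le_add ?_ ?_)))
    · rw [norm_smul]
      have h1 := hηb _ (huI' x hxc)
      have h2 := (huI' x hxc).1
      exact mul_le_mul (by rw [Real.norm_eq_abs]; linarith) (hH x hxc) (norm_nonneg _)
        (by positivity)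
    · rw [norm_smul, ContinuousLinearMap.norm_smulRight_apply, innerSL_apply_norm]
      have h1 := hη'b _ (huI x hx)
      have h2 := hG x hxc
      exact mul_le_mul h1 (mul_le_mul h2 h2 (norm_nonneg _) ((norm_nonneg _).trans h2))
        (by positivity) ((abs_nonneg _).trans h1)
  have hmax : ∀ x ∈ closure N ∩ MAXset Ω u, K =O[𝓝[N] x] fun y => ‖y - x‖ ^ 2 := by
    intro x hx
    refine ((h.pohozaevField_isBigO hx.2).mono nhdsWithin_le_nhds).sub ?_
    have h1 : (fun y => η (u y)) =O[𝓝[N] x] fun y => ‖y - x‖ ^ 2 := by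
      refine Asymptotics.IsBigO.trans ?_ ((h.umax_sub_isBigO hx.2).mono nhdsWithin_le_nhds)
      refine Asymptotics.IsBigO.of_bound 2 ?_
      filter_upwards [self_mem_nhdsWithin] with y hy
      have h2 := huI' y (hNc hy)
      rw [Real.norm_eq_abs, Real.norm_of_nonneg (by linarith [h2.2])]
      exact hηb _ h2
    have h2 : gC Ω u =O[𝓝[N] x] fun _ => (1 : ℝ) :=
      (((h.hasFDerivAt_gC hx.2.1).continuousAt.tendsto).isBigO_one ℝ).mono nhdsWithin_le_nhds
    simpa using h1.smul h2
  have hfin := hb.integral_planeTrace h hN (M := max M₁ (P' + (2 * m * H + B * (G * G)))) hK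
    (hKc.mono hclc) hK'c (fun x hx => (hM₁ x (hNc hx)).trans (le_max_left _ _))
    (fun x hx => (hK'b x hx).trans (le_max_right _ _)) hmax
  have h1 : ∀ x ∈ N, planeTrace (K' x) =
      2 * η (u x) - 4 * (m - u x) - η' (u x) * ‖gC Ω u x‖ ^ 2 := fun x hx => by
    rw [hK'def]
    simp only []
    rw [planeTrace_sub, planeTrace_add, planeTrace_smul, planeTrace_smul, planeTrace_smulRight,
      h.planeTrace_pohozaevDeriv m (hNΩ hx), h.planeTrace_hC (hNΩ hx), real_inner_self_eq_norm_sq]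
    ring
  rw [setIntegral_congr_fun (h.isOpen_comp hN).measurableSet h1] at hfin
  rw [hfin]
  have h2 : ∀ t, ⟪K (γ t), n t⟫ = (c ^ 2 / 2 - 2 * m) * ⟪γ t, n t⟫ - η 0 * c := fun t => by
    simp only [hKdef, pohozaevField, hb.gC_eq, hb.u_eq_zero h, inner_sub_left, inner_smul_left,
      inner_smul_right, real_inner_self_eq_norm_sq, norm_smul, mul_pow, Real.norm_eq_abs, sq_abs,
      hb.norm_normal, conj_trivial]
    ring
  have hγn : Continuous fun t => ⟪γ t, n t⟫ := hb.continuous.inner hb.continuous_normal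
  simp only [h2]
  rw [intervalIntegral.integral_sub ((hγn.const_mul _).intervalIntegrable _ _)
    (continuous_const.intervalIntegrable _ _), intervalIntegral.integral_const_mul,
    intervalIntegral.integral_const]
  simp only [sub_zero, smul_eq_mul]
  ring

end IsBoundaryCurve

theorem second_deriv_nonpos_of_isLocalMax {f f' : ℝ → ℝ} {x d : ℝ}
    (hf : ∀ᶠ t in 𝓝 x, HasDerivAt f (f' t) t) (hf' : HasDerivAt f' d x) (hmax : IsLocalMax f x) :
    d ≤ 0 := by
  by_contra! hpos
  have hd : deriv f =ᶠ[𝓝 x] f' := hf.mono fun t ht => ht.deriv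
  have h0 : f' x = 0 := hmax.hasDerivAt_eq_zero hf.self_of_nhds
  have hmin : IsLocalMin f x := isLocalMin_of_deriv_deriv_pos
    (by rw [hd.deriv_eq, hf'.deriv]; exact hpos) (by rw [hd.eq_of_nhds, h0])
    hf.self_of_nhds.continuousAt
  have hconst : f =ᶠ[𝓝 x] fun _ => f x := by
    filter_upwards [hmax, hmin] with t h1 h2 using le_antisymm h1 h2
  have h5 : f' =ᶠ[𝓝 x] fun _ => 0 := by
    filter_upwards [hconst.eventuallyEq_nhds, hf] with t ht1 ht2
    have := ht1.deriv_eq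
    rwa [ht2.deriv, deriv_const] at this
  have h6 : HasDerivAt f' 0 x := (hasDerivAt_const x (0 : ℝ)).congr_of_eventuallyEq h5
  exact hpos.ne (h6.unique hf')

namespace IsSerrinSolution

variable {Ω N : Set E2} {u : E2 → ℝ}

theorem hasFDerivAt_hC (h : IsSerrinSolution Ω u) {x : E2} (hx : x ∈ Ω) :
    HasFDerivAt (hC Ω u) (fderiv ℝ (hC Ω u) x) x := by
  have h1 : ContDiffOn ℝ 1 (hC Ω u) (closure Ω) :=
    h.contDiffOn_gC.fderivWithin h.uniqueDiffOn (WithTop.coe_le_coe.2 (le_top (a := (2 : ℕ∞))))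
  exact ((h1.contDiffAt (h.mem_nhds hx)).differentiableAt (by simp)).hasFDerivAt

theorem fderiv_hC_symm (h : IsSerrinSolution Ω u) {x : E2} (hx : x ∈ Ω) (v w : E2) :
    fderiv ℝ (hC Ω u) x v w = fderiv ℝ (hC Ω u) x w v := by
  refine second_derivative_symmetric_of_eventually_of_real (f := gC Ω u) ?_ (h.hasFDerivAt_hC hx)
    v w
  filter_upwards [h.isOpen.mem_nhds hx] with y hy using h.hasFDerivAt_gC hy

theorem hasFDerivAt_inner_hC (h : IsSerrinSolution Ω u) {x : E2} (hx : x ∈ Ω) (v w : E2) :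
    ∃ A : E2 →L[ℝ] ℝ, HasFDerivAt (fun y => ⟪hC Ω u y v, w⟫) A x ∧
      ∀ z, A z = ⟪fderiv ℝ (hC Ω u) x z v, w⟫ := by
  have h1 := (h.hasFDerivAt_hC hx).clm_apply (hasFDerivAt_const v x)
  have h2 := h1.inner ℝ (hasFDerivAt_const w x)
  exact ⟨_, h2, fun z => by simp [fderivInnerCLM_apply]⟩

theorem inner_fderiv_hC_symm (h : IsSerrinSolution Ω u) {x : E2} (hx : x ∈ Ω) (z v w : E2) :
    ⟪fderiv ℝ (hC Ω u) x z v, w⟫ = ⟪fderiv ℝ (hC Ω u) x z w, v⟫ := by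
  obtain ⟨A, hA, hA'⟩ := h.hasFDerivAt_inner_hC hx v w
  obtain ⟨B, hB, hB'⟩ := h.hasFDerivAt_inner_hC hx w v
  have heq : (fun y => ⟪hC Ω u y v, w⟫) =ᶠ[𝓝 x] fun y => ⟪hC Ω u y w, v⟫ := by
    filter_upwards [h.isOpen.mem_nhds hx] with y hy using h.hC_symm hy v w
  rw [← hA', ← hB', hA.unique (hB.congr_of_eventuallyEq heq)]

theorem trace_fderiv_hC (h : IsSerrinSolution Ω u) {x : E2} (hx : x ∈ Ω) {n : E2} (hn : ‖n‖ = 1)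
    (z : E2) : ⟪fderiv ℝ (hC Ω u) x z n, n⟫ +
      ⟪fderiv ℝ (hC Ω u) x z (rotJ n), rotJ n⟫ = 0 := by
  obtain ⟨A, hA, hA'⟩ := h.hasFDerivAt_inner_hC hx n n
  obtain ⟨B, hB, hB'⟩ := h.hasFDerivAt_inner_hC hx (rotJ n) (rotJ n)
  have heq : (fun y => ⟪hC Ω u y n, n⟫ + ⟪hC Ω u y (rotJ n), rotJ n⟫) =ᶠ[𝓝 x] fun _ => -2 := by
    filter_upwards [h.isOpen.mem_nhds hx] with y hy using h.trace_hC_unit (subset_closure hy) hn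
  have := (hA.add hB).unique ((hasFDerivAt_const (-2 : ℝ) x).congr_of_eventuallyEq heq)
  rw [← hA', ← hB', ← add_apply, this]
  rfl

/-- The sum of a pure third derivative of `u` in the gradient direction: the derivative of the
Laplacian vanishes. -/
theorem inner_fderiv_hC_add (h : IsSerrinSolution Ω u) {x : E2} (hx : x ∈ Ω) {n : E2}
    (hn : ‖n‖ = 1) (w : E2) : ⟪fderiv ℝ (hC Ω u) x n n, w⟫ +
      ⟪fderiv ℝ (hC Ω u) x (rotJ n) (rotJ n), w⟫ = 0 := by
  rw [h.inner_fderiv_hC_symm hx, h.inner_fderiv_hC_symm hx _ _ w, h.fderiv_hC_symm hx n w,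
    h.fderiv_hC_symm hx _ w, h.trace_fderiv_hC hx hn w]

/-- The second-order condition along a line at a local maximum of `|∇u|² - H(u)`. -/
theorem second_order_condition (h : IsSerrinSolution Ω u) {x : E2} (hx : x ∈ Ω)
    {H H' : ℝ → ℝ} {H2 : ℝ} (hH : ∀ᶠ s in 𝓝 (u x), HasDerivAt H (H' s) s)
    (hH' : HasDerivAt H' H2 (u x))
    (hmax : IsLocalMax (fun y => ‖gC Ω u y‖ ^ 2 - H (u y)) x) (e : E2) :
    2 * ⟪gC Ω u x, hC Ω u x e⟫ = H' (u x) * ⟪gC Ω u x, e⟫ ∧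
    2 * (⟪hC Ω u x e, hC Ω u x e⟫ + ⟪fderiv ℝ (hC Ω u) x e e, gC Ω u x⟫)
      - (H2 * ⟪gC Ω u x, e⟫ ^ 2 + H' (u x) * ⟪hC Ω u x e, e⟫) ≤ 0 := by
  have hline : ∀ t : ℝ, HasDerivAt (fun t : ℝ => x + t • e) e t := fun t => by
    simpa using ((hasDerivAt_id t).smul_const e).const_add x
  have htend : Tendsto (fun t : ℝ => x + t • e) (𝓝 0) (𝓝 x) := by
    have : Continuous fun t : ℝ => x + t • e := by fun_prop
    have := this.tendsto 0
    rwa [zero_smul, add_zero] at this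
  have hx0 : x + (0 : ℝ) • e = x := by simp
  have hg : ∀ t : ℝ, x + t • e ∈ Ω →
      HasDerivAt (fun t => gC Ω u (x + t • e)) (hC Ω u (x + t • e) e) t := fun t ht => by
    have h1 := h.hasFDerivAt_gC ht
    exact h1.comp_hasDerivAt (f := fun t : ℝ => x + t • e) t (hline t)
  have hu : ∀ t : ℝ, x + t • e ∈ Ω →
      HasDerivAt (fun t => u (x + t • e)) ⟪gC Ω u (x + t • e), e⟫ t := fun t ht => by
    have h1 := h.hasFDerivAt ht
    exact h1.comp_hasDerivAt (f := fun t : ℝ => x + t • e) t (hline t)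
  have hcu : Tendsto (fun t : ℝ => u (x + t • e)) (𝓝 0) (𝓝 (u x)) :=
    (h.hasFDerivAt hx).continuousAt.tendsto.comp htend
  have hf : ∀ᶠ t : ℝ in 𝓝 0, HasDerivAt
      (fun t : ℝ => ‖gC Ω u (x + t • e)‖ ^ 2 - H (u (x + t • e)))
      (2 * ⟪gC Ω u (x + t • e), hC Ω u (x + t • e) e⟫ -
        H' (u (x + t • e)) * ⟪gC Ω u (x + t • e), e⟫) t := by
    filter_upwards [htend.eventually (h.isOpen.mem_nhds hx), hcu.eventually hH] with t h1 h2
    exact ((hg t h1).norm_sq).sub (h2.comp t (hu t h1))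
  have hx0' : x + (0 : ℝ) • e ∈ Ω := by rwa [hx0]
  have hg0 := hg 0 hx0'
  have hu0 := hu 0 hx0'
  have hh0 : HasDerivAt (fun t : ℝ => hC Ω u (x + t • e) e) (fderiv ℝ (hC Ω u) x e e) 0 := by
    have h1 := (h.hasFDerivAt_hC hx).clm_apply (hasFDerivAt_const e x)
    have h2 : HasFDerivAt (fun y => hC Ω u y e) ((fderiv ℝ (hC Ω u) x).flip e)
        (x + (0 : ℝ) • e) := by
      rw [hx0]
      refine h1.congr_fderiv ?_
      ext w i
      simp
    exact h2.comp_hasDerivAt (f := fun t : ℝ => x + t • e) (0 : ℝ) (hline 0)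
  have hH0 : HasDerivAt (fun t : ℝ => H' (u (x + t • e))) (H2 * ⟪gC Ω u x, e⟫) 0 := by
    have h1 : HasDerivAt H' H2 (u (x + (0 : ℝ) • e)) := by rwa [hx0]
    have h2 := h1.comp (0 : ℝ) hu0
    rw [hx0] at h2
    exact h2
  have hf' := ((hg0.inner ℝ hh0).const_mul 2).sub
    (hH0.mul (hg0.inner ℝ (hasDerivAt_const (0 : ℝ) e)))
  have hloc : IsLocalMax (fun t : ℝ => ‖gC Ω u (x + t • e)‖ ^ 2 - H (u (x + t • e))) 0 := by
    have h1 := htend.eventually hmax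
    filter_upwards [h1] with t ht
    simpa using ht
  have hd2 := second_deriv_nonpos_of_isLocalMax hf hf' hloc
  have hd1 := hloc.hasDerivAt_eq_zero hf.self_of_nhds
  simp only [hx0, inner_zero_right, zero_add] at hd1 hd2
  refine ⟨by linarith, ?_⟩
  rw [← real_inner_comm (gC Ω u x) (fderiv ℝ (hC Ω u) x e e)] at hd2
  linarith

theorem touching_inequality (h : IsSerrinSolution Ω u) {x : E2} (hx : x ∈ Ω)
    {H H' : ℝ → ℝ} {H2 : ℝ} (hH : ∀ᶠ s in 𝓝 (u x), HasDerivAt H (H' s) s)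
    (hH' : HasDerivAt H' H2 (u x))
    (hmax : IsLocalMax (fun y => ‖gC Ω u y‖ ^ 2 - H (u y)) x) (hne : gC Ω u x ≠ 0) :
    (H' (u x) + 2) * (H' (u x) + 4) - H2 * ‖gC Ω u x‖ ^ 2 ≤ 0 := by
  set g := gC Ω u x with hgdef
  set w := ‖g‖ with hw
  have hw0 : 0 < w := norm_pos_iff.2 hne
  set n : E2 := w⁻¹ • g with hn
  have hn1 : ‖n‖ = 1 := by
    rw [hn, norm_smul, norm_inv, Real.norm_of_nonneg hw0.le, ← hw, inv_mul_cancel₀ hw0.ne']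
  have hgn : g = w • n := by rw [hn, smul_smul, mul_inv_cancel₀ hw0.ne', one_smul]
  clear_value n
  have hnn : ⟪n, n⟫ = 1 := by rw [real_inner_self_eq_norm_sq, hn1, one_pow]
  have hnJ : ⟪n, rotJ n⟫ = 0 := by rw [inner_rotJ_self]
  obtain ⟨-, hc1⟩ := h.second_order_condition hx hH hH' hmax n
  obtain ⟨-, hc2⟩ := h.second_order_condition hx hH hH' hmax (rotJ n)
  have hkey : ∀ e, 2 * ⟪hC Ω u x n, e⟫ = H' (u x) * ⟪n, e⟫ := fun e => by
    have h1 := (h.second_order_condition hx hH hH' hmax e).1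
    rw [← hgdef, hgn, inner_smul_left, inner_smul_left, real_inner_comm, h.hC_symm hx] at h1
    simp only [conj_trivial] at h1
    have : w * (2 * ⟪hC Ω u x n, e⟫) = w * (H' (u x) * ⟪n, e⟫) := by linarith
    exact mul_left_cancel₀ hw0.ne' this
  have htr := h.trace_hC_unit (subset_closure hx) hn1
  have h1 := hkey n
  have h2 := hkey (rotJ n)
  have h3 : ⟪hC Ω u x (rotJ n), n⟫ = ⟪hC Ω u x n, rotJ n⟫ := h.hC_symm hx _ _
  have hpars : ∀ v : E2, ⟪v, v⟫ = ⟪v, n⟫ ^ 2 + ⟪v, rotJ n⟫ ^ 2 := fun v => by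
    have hn2 : n 0 ^ 2 + n 1 ^ 2 = 1 := by rw [← E2_norm_sq, hn1, one_pow]
    simp only [E2_inner, rotJ_zero, rotJ_one]
    linear_combination (-(v 0 ^ 2 + v 1 ^ 2)) * hn2
  have hthird := h.inner_fderiv_hC_add hx hn1 g
  rw [hpars (hC Ω u x n)] at hc1
  rw [hpars (hC Ω u x (rotJ n)), h3] at hc2
  have e1 : ⟪g, n⟫ = w := by rw [hgn, inner_smul_left, hnn]; simp
  have e2 : ⟪g, rotJ n⟫ = 0 := by rw [hgn, inner_smul_left, hnJ]; simp
  rw [← hgdef, e1] at hc1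
  rw [← hgdef, e2] at hc2
  rw [hnn] at h1
  rw [hnJ] at h2
  generalize ⟪hC Ω u x n, n⟫ = a at *
  generalize ⟪hC Ω u x n, rotJ n⟫ = b at *
  generalize ⟪hC Ω u x (rotJ n), rotJ n⟫ = d at *
  have ha : a = H' (u x) / 2 := by linarith
  have hb : b = 0 := by linarith
  have hd : d = -2 - H' (u x) / 2 := by linarith
  subst ha hb hd
  nlinarith [hc1, hc2, hthird]

end IsSerrinSolution

namespace IsSerrinSolution

variable {Ω N : Set E2} {u : E2 → ℝ} {c : ℝ}

theorem mem_Ioo_of_mem_comp (h : IsSerrinSolution Ω u) (hN : IsCompOf N (Ω \ MAXset Ω u)) {x : E2}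
    (hx : x ∈ N) : u x ∈ Ioo 0 (umax Ω u) := by
  have h1 := comp_subset hN hx
  exact ⟨h.pos h1.1, lt_of_le_of_ne (h.le_umax (subset_closure h1.1)) fun heq => h1.2 ⟨h1.1, heq⟩⟩

theorem mem_Icc_of_mem_closure_comp (h : IsSerrinSolution Ω u)
    (hN : IsCompOf N (Ω \ MAXset Ω u)) {x : E2} (hx : x ∈ closure N) :
    u x ∈ Icc 0 (umax Ω u) :=
  ⟨h.nonneg (closure_comp_subset hN hx), h.le_umax (closure_comp_subset hN hx)⟩

theorem isCompact_closure_comp (h : IsSerrinSolution Ω u)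
    (hN : IsCompOf N (Ω \ MAXset Ω u)) : IsCompact (closure N) :=
  h.isCompact_closure.of_isClosed_subset isClosed_closure (closure_comp_subset hN)

theorem gradient_sq_le_of_barrier (h : IsSerrinSolution Ω u) (hN : IsCompOf N (Ω \ MAXset Ω u))
    (hc : ∀ x ∈ frontier N ∩ frontier Ω, ‖gC Ω u x‖ = c) {H H' H'' : ℝ → ℝ}
    (hH : ∀ s ∈ Ioo 0 (umax Ω u), HasDerivAt H (H' s) s)
    (hH' : ∀ s ∈ Ioo 0 (umax Ω u), HasDerivAt H' (H'' s) s)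
    (hHc : ContinuousOn H (Icc 0 (umax Ω u))) (hH0 : ∀ s ∈ Icc 0 (umax Ω u), 0 ≤ H s)
    (hcH : c ^ 2 ≤ H 0)
    (hstrict : ∀ s ∈ Ioo 0 (umax Ω u), ∀ w, H s < w → 0 < (H' s + 2) * (H' s + 4) - H'' s * w) :
    ∀ x ∈ closure N, ‖gC Ω u x‖ ^ 2 ≤ H (u x) := by
  by_contra! hcon
  obtain ⟨x₀, hx₀, hlt⟩ := hcon
  have hcl := closure_comp_subset hN
  have hQ : ContinuousOn (fun x => ‖gC Ω u x‖ ^ 2 - H (u x)) (closure N) :=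
    ((h.continuousOn_gC.mono hcl).norm.pow 2).sub
      (hHc.comp (h.continuousOn.mono hcl) fun x hx => h.mem_Icc_of_mem_closure_comp hN hx)
  obtain ⟨p, hp, hmax⟩ := (h.isCompact_closure_comp hN).exists_isMaxOn ⟨x₀, hx₀⟩ hQ
  have hQp : H (u p) < ‖gC Ω u p‖ ^ 2 := by
    have := hmax hx₀
    simp only [mem_ofPred_eq] at this
    linarith
  have hp0 := hH0 _ (h.mem_Icc_of_mem_closure_comp hN hp)
  have hne : gC Ω u p ≠ 0 := fun h0 => by
    rw [h0, norm_zero] at hQp; norm_num at hQp; linarith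
  rcases h.closure_comp_cases hN hp with hpN | hpΓ | hpM
  · have hpΩ := (comp_subset hN hpN).1
    have hI := h.mem_Ioo_of_mem_comp hN hpN
    have hloc : IsLocalMax (fun y => ‖gC Ω u y‖ ^ 2 - H (u y)) p := by
      filter_upwards [(h.isOpen_comp hN).mem_nhds hpN] with y hy using hmax (subset_closure hy)
    have h1 := h.touching_inequality hpΩ
      (by filter_upwards [isOpen_Ioo.mem_nhds hI] with s hs using hH s hs) (hH' _ hI) hloc hne
    linarith [hstrict _ hI _ hQp]
  · rw [hc p hpΓ, h.bdry p hpΓ.2] at hQp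
    linarith
  · exact hne (h.gC_eq_zero_of_mem_MAXset hpM)

theorem gradient_sq_le_of_model_barrier (h : IsSerrinSolution Ω u)
    (hN : IsCompOf N (Ω \ MAXset Ω u))
    (hc : ∀ x ∈ frontier N ∩ frontier Ω, ‖gC Ω u x‖ = c) {P P' P'' : ℝ → ℝ}
    (hP : ∀ s ∈ Ioo 0 (umax Ω u), HasDerivAt P (P' s) s)
    (hP' : ∀ s ∈ Ioo 0 (umax Ω u), HasDerivAt P' (P'' s) s)
    (hPc : ContinuousOn P (Icc 0 (umax Ω u))) (hP0 : ∀ s ∈ Icc 0 (umax Ω u), 0 < P s)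
    (hcP : c ^ 2 ≤ P 0) (hode : ∀ s ∈ Ioo 0 (umax Ω u), P'' s * P s = (P' s + 2) * (P' s + 4))
    (hle : ∀ s ∈ Ioo 0 (umax Ω u), P' s ≤ -4) :
    ∀ x ∈ closure N, ‖gC Ω u x‖ ^ 2 ≤ P (u x) := by
  by_contra! hcon
  obtain ⟨x₀, hx₀, hlt⟩ := hcon
  have hcl := closure_comp_subset hN
  have hI' := fun x (hx : x ∈ closure N) => h.mem_Icc_of_mem_closure_comp hN hx
  have hQ : ContinuousOn (fun x => ‖gC Ω u x‖ ^ 2 / P (u x)) (closure N) :=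
    ((h.continuousOn_gC.mono hcl).norm.pow 2).div
      (hPc.comp (h.continuousOn.mono hcl) hI') fun x hx => (hP0 _ (hI' x hx)).ne'
  obtain ⟨p, hp, hmax⟩ := (h.isCompact_closure_comp hN).exists_isMaxOn ⟨x₀, hx₀⟩ hQ
  set k := ‖gC Ω u p‖ ^ 2 / P (u p) with hk
  have hPp := hP0 _ (hI' p hp)
  have hWp : ‖gC Ω u p‖ ^ 2 = k * P (u p) := by rw [hk]; field_simp
  have hk1 : 1 < k := by
    have h1 : ‖gC Ω u x₀‖ ^ 2 / P (u x₀) ≤ k := hmax hx₀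
    have h2 : 1 < ‖gC Ω u x₀‖ ^ 2 / P (u x₀) := (one_lt_div (hP0 _ (hI' x₀ hx₀))).2 hlt
    linarith
  have hne : gC Ω u p ≠ 0 := fun h0 => by
    rw [h0, norm_zero] at hWp
    have : 0 < k * P (u p) := by positivity
    norm_num at hWp
    rcases hWp with h1 | h1 <;> linarith
  rcases h.closure_comp_cases hN hp with hpN | hpΓ | hpM
  · have hpΩ := (comp_subset hN hpN).1
    have hI := h.mem_Ioo_of_mem_comp hN hpN
    have hloc : IsLocalMax (fun y => ‖gC Ω u y‖ ^ 2 - k * P (u y)) p := by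
      filter_upwards [(h.isOpen_comp hN).mem_nhds hpN] with y hy
      have h1 : ‖gC Ω u y‖ ^ 2 / P (u y) ≤ k := hmax (subset_closure hy)
      rw [div_le_iff₀ (hP0 _ (hI' y (subset_closure hy)))] at h1
      rw [hWp]
      linarith
    have h1 := h.touching_inequality hpΩ (H := fun s => k * P s) (H' := fun s => k * P' s)
      (by filter_upwards [isOpen_Ioo.mem_nhds hI] with s hs using (hP s hs).const_mul k)
      ((hP' _ hI).const_mul k) hloc hne
    have h2 := hode _ hI
    have h3 := hle _ hI
    rw [hWp] at h1
    have h4 : (k * P' (u p) + 2) * (k * P' (u p) + 4) - k * P'' (u p) * (k * P (u p)) =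
        (k - 1) * (-(6 * k * P' (u p)) - 8 - 8 * k) := by
      linear_combination (-k ^ 2) * h2
    have h5 : 0 < -(6 * k * P' (u p)) - 8 - 8 * k := by nlinarith
    have h6 := mul_pos (sub_pos.2 hk1) h5
    linarith
  · rw [hc p hpΓ, h.bdry p hpΓ.2] at hWp
    have := hP0 0 ⟨le_rfl, h.umax_pos.le⟩
    nlinarith
  · exact hne (h.gC_eq_zero_of_mem_MAXset hpM)

end IsSerrinSolution

/-- A strictly increasing differentiable function on a compact interval has a continuous inverse,
differentiable in the interior. -/
theorem exists_inverse_on_Icc {f f' : ℝ → ℝ} {a b : ℝ} (hab : a < b)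
    (hf : ContinuousOn f (Icc a b)) (hd : ∀ x ∈ Ioo a b, HasDerivAt f (f' x) x)
    (hpos : ∀ x ∈ Ioo a b, 0 < f' x) :
    ∃ g : ℝ → ℝ, (∀ x ∈ Icc a b, g (f x) = x) ∧
      (∀ y ∈ Icc (f a) (f b), g y ∈ Icc a b ∧ f (g y) = y) ∧
      ContinuousOn g (Icc (f a) (f b)) ∧
      ∀ y ∈ Ioo (f a) (f b), g y ∈ Ioo a b ∧ HasDerivAt g (f' (g y))⁻¹ y := by
  have hmono : StrictMonoOn f (Icc a b) := by
    refine strictMonoOn_of_deriv_pos (convex_Icc a b) hf fun x hx => ?_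
    rw [interior_Icc] at hx
    rw [(hd x hx).deriv]
    exact hpos x hx
  have ha : a ∈ Icc a b := left_mem_Icc.2 hab.le
  have hb : b ∈ Icc a b := right_mem_Icc.2 hab.le
  set g := Function.invFunOn f (Icc a b) with hg
  have hgf : ∀ x ∈ Icc a b, g (f x) = x := fun x hx =>
    hmono.injOn.leftInvOn_invFunOn hx
  have hfg : ∀ y ∈ Icc (f a) (f b), g y ∈ Icc a b ∧ f (g y) = y := fun y hy => by
    obtain ⟨x, hx, rfl⟩ := intermediate_value_Icc hab.le hf hy
    rw [hgf x hx]
    exact ⟨hx, rfl⟩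
  have hgmono : StrictMonoOn g (Icc (f a) (f b)) := fun y hy z hz hyz => by
    rw [← hmono.lt_iff_lt (hfg y hy).1 (hfg z hz).1, (hfg y hy).2, (hfg z hz).2]
    exact hyz
  have hgI : ∀ y ∈ Ioo (f a) (f b), g y ∈ Ioo a b := fun y hy => by
    have h1 := hfg y (Ioo_subset_Icc_self hy)
    constructor
    · rw [← hmono.lt_iff_lt ha h1.1, h1.2]; exact hy.1
    · rw [← hmono.lt_iff_lt h1.1 hb, h1.2]; exact hy.2
  have hcont : ContinuousOn g (Icc (f a) (f b)) := by
    have hF : Continuous (fun x : Icc a b => f x) := continuousOn_iff_continuous_domRestrict.1 hf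
    have hinj : Function.Injective (fun x : Icc a b => f x) := fun x y hxy =>
      Subtype.ext (hmono.injOn x.2 y.2 hxy)
    have hemb := hF.isClosedEmbedding hinj
    have hg' : Continuous fun y : Icc (f a) (f b) => (⟨g y, (hfg y y.2).1⟩ : Icc a b) := by
      rw [hemb.isInducing.continuous_iff]
      refine continuous_subtype_val.congr fun y => ?_
      exact ((hfg y y.2).2).symm
    exact continuousOn_iff_continuous_domRestrict.2 (continuous_subtype_val.comp hg')
  refine ⟨g, hgf, hfg, hcont, fun y hy => ⟨hgI y hy, ?_⟩⟩
  have hnhds : Icc (f a) (f b) ∈ 𝓝 y := Icc_mem_nhds hy.1 hy.2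
  refine HasDerivAt.of_local_left_inverse (hcont.continuousAt hnhds) (hd _ (hgI y hy))
    (hpos _ (hgI y hy)).ne' ?_
  filter_upwards [hnhds] with z hz using (hfg z hz).2

/-- The drop of the model solution below its maximum, as a function of the radius. -/
def modelDrop (R ρ : ℝ) : ℝ := (ρ ^ 2 - R ^ 2) / 2 - R ^ 2 * (Real.log ρ - Real.log R)

theorem modelDrop_self (R : ℝ) : modelDrop R R = 0 := by simp [modelDrop]

theorem modelDrop_one (R : ℝ) : modelDrop R 1 = modelUmax R := by
  simp [modelDrop, modelUmax]

theorem hasDerivAt_modelDrop (R : ℝ) {ρ : ℝ} (hρ : 0 < ρ) :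
    HasDerivAt (modelDrop R) (ρ - R ^ 2 / ρ) ρ := by
  have h1 := (((hasDerivAt_pow 2 ρ).sub_const (R ^ 2)).div_const 2).sub
    (((Real.hasDerivAt_log hρ.ne').sub_const (Real.log R)).const_mul (R ^ 2))
  refine h1.congr_deriv ?_
  simp
  field_simp

theorem continuousOn_modelDrop {R : ℝ} (hR : 0 ≤ R) : ContinuousOn (modelDrop R) (Ici R) := by
  rcases hR.eq_or_lt with rfl | hR
  · have : modelDrop 0 = fun ρ => ρ ^ 2 / 2 := by ext ρ; simp [modelDrop]
    rw [this]
    fun_prop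
  · exact fun ρ hρ => (hasDerivAt_modelDrop R (hR.trans_le hρ)).continuousAt.continuousWithinAt

theorem modelDrop_deriv_pos {R ρ : ℝ} (hR : 0 ≤ R) (hρ : R < ρ) : 0 < ρ - R ^ 2 / ρ := by
  have h0 : 0 < ρ := hR.trans_lt hρ
  rw [sub_pos, div_lt_iff₀ h0]
  nlinarith

theorem modelDrop_deriv_neg {R ρ : ℝ} (h0 : 0 < ρ) (hρ : ρ < R) : ρ - R ^ 2 / ρ < 0 := by
  rw [sub_neg, lt_div_iff₀ h0]
  nlinarith

theorem modelDrop_strictMonoOn {R : ℝ} (hR : 0 ≤ R) : StrictMonoOn (modelDrop R) (Ici R) := by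
  refine strictMonoOn_of_deriv_pos (convex_Ici R) (continuousOn_modelDrop hR) fun x hx => ?_
  rw [interior_Ici] at hx
  rw [(hasDerivAt_modelDrop R (hR.trans_lt hx)).deriv]
  exact modelDrop_deriv_pos hR hx

theorem modelDrop_nonneg {R ρ : ℝ} (hR : 0 ≤ R) (hρ : R ≤ ρ) : 0 ≤ modelDrop R ρ := by
  rw [← modelDrop_self R]
  exact (modelDrop_strictMonoOn hR).monotoneOn self_mem_Ici hρ hρ

theorem modelDrop_pos {R ρ : ℝ} (hR : 0 ≤ R) (hρ : R < ρ) : 0 < modelDrop R ρ := by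
  rw [← modelDrop_self R]
  exact modelDrop_strictMonoOn hR self_mem_Ici hρ.le hρ

theorem modelDrop_strictAntiOn (R : ℝ) : StrictAntiOn (modelDrop R) (Ioc 0 R) := by
  refine strictAntiOn_of_deriv_neg (convex_Ioc 0 R) (fun ρ hρ =>
    (hasDerivAt_modelDrop R hρ.1).continuousAt.continuousWithinAt) fun x hx => ?_
  rw [interior_Ioc] at hx
  rw [(hasDerivAt_modelDrop R hx.1).deriv]
  exact modelDrop_deriv_neg hx.1 hx.2

theorem exists_outer_profile {R : ℝ} (hR : 0 ≤ R) (hR1 : R < 1) :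
    ∃ Ψ : ℝ → ℝ, Ψ 0 = 1 ∧ ContinuousOn Ψ (Icc 0 (modelUmax R)) ∧
      (∀ s ∈ Icc 0 (modelUmax R), R ≤ Ψ s ∧ modelDrop R (Ψ s) = modelUmax R - s) ∧
      ∀ s ∈ Ioo 0 (modelUmax R), R < Ψ s ∧
        HasDerivAt Ψ (-(Ψ s - R ^ 2 / Ψ s)⁻¹) s := by
  have hlt : modelUmax R < modelDrop R 2 := by
    rw [← modelDrop_one]
    exact modelDrop_strictMonoOn hR hR1.le (mem_Ici.2 (by linarith)) (by norm_num)
  obtain ⟨g, hgf, hfg, hgc, hgd⟩ := exists_inverse_on_Icc (f := modelDrop R)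
    (f' := fun ρ => ρ - R ^ 2 / ρ) (show R < 2 by linarith)
    ((continuousOn_modelDrop hR).mono Icc_subset_Ici_self)
    (fun x hx => hasDerivAt_modelDrop R (hR.trans_lt hx.1))
    (fun x hx => modelDrop_deriv_pos hR hx.1)
  rw [modelDrop_self] at hfg hgc hgd
  have hmaps : ∀ s ∈ Icc 0 (modelUmax R), modelUmax R - s ∈ Icc 0 (modelDrop R 2) := fun s hs =>
    ⟨by linarith [hs.2], by linarith [hs.1]⟩
  refine ⟨fun s => g (modelUmax R - s), ?_, ?_, ?_, ?_⟩
  · simp only [sub_zero]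
    rw [← modelDrop_one]
    exact hgf 1 ⟨hR1.le, by norm_num⟩
  · exact hgc.comp (by fun_prop) hmaps
  · exact fun s hs => ⟨(hfg _ (hmaps s hs)).1.1, (hfg _ (hmaps s hs)).2⟩
  · intro s hs
    have h1 := hgd (modelUmax R - s) ⟨by linarith [hs.2], by linarith [hs.1]⟩
    refine ⟨h1.1.1, ?_⟩
    have h2 := h1.2.comp s ((hasDerivAt_id s).const_sub (modelUmax R))
    refine h2.congr_deriv ?_
    simp

theorem exists_inner_profile {R r m : ℝ} (hr : 0 < r) (hrR : r < R) (hm : modelDrop R r = m) :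
    ∃ (Ψ : ℝ → ℝ) (δ : ℝ), 0 < δ ∧ Ψ 0 = r ∧ ContinuousOn Ψ (Icc (-δ) m) ∧
      (∀ s ∈ Icc (-δ) m, 0 < Ψ s) ∧
      ∀ s ∈ Ioo (-δ) m, Ψ s < R ∧ HasDerivAt Ψ (-(Ψ s - R ^ 2 / Ψ s)⁻¹) s := by
  have hr2 : 0 < r / 2 := by positivity
  have hlt : m < modelDrop R (r / 2) := by
    rw [← hm]
    exact modelDrop_strictAntiOn R ⟨hr2, by linarith⟩ ⟨hr, hrR.le⟩ (by linarith)
  obtain ⟨g, hgf, hfg, hgc, hgd⟩ := exists_inverse_on_Icc (f := fun ρ => -modelDrop R ρ)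
    (f' := fun ρ => -(ρ - R ^ 2 / ρ)) (show r / 2 < R by linarith)
    (fun x hx => (hasDerivAt_modelDrop R (hr2.trans_le hx.1)).neg.continuousAt.continuousWithinAt)
    (fun x hx => (hasDerivAt_modelDrop R (hr2.trans hx.1)).neg)
    (fun x hx => neg_pos.2 (modelDrop_deriv_neg (hr2.trans hx.1) hx.2))
  simp only [modelDrop_self, neg_zero] at hfg hgc hgd
  have hmaps : ∀ s ∈ Icc (-(modelDrop R (r / 2) - m)) m,
      s - m ∈ Icc (-modelDrop R (r / 2)) 0 := fun s hs =>
    ⟨by linarith [hs.1], by linarith [hs.2]⟩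
  refine ⟨fun s => g (s - m), modelDrop R (r / 2) - m, by linarith, ?_, ?_, ?_, ?_⟩
  · simp only [zero_sub]
    rw [← hm]
    exact hgf r ⟨by linarith, hrR.le⟩
  · exact hgc.comp (by fun_prop) hmaps
  · exact fun s hs => hr2.trans_le (hfg _ (hmaps s hs)).1.1
  · intro s hs
    have h1 := hgd (s - m) ⟨by linarith [hs.1], by linarith [hs.2]⟩
    refine ⟨h1.1.2, ?_⟩
    have h2 := h1.2.comp s ((hasDerivAt_id s).sub_const m)
    refine h2.congr_deriv ?_
    rw [← inv_neg]
    simp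

theorem hasDerivAt_profile_sq {R s : ℝ} {Ψ : ℝ → ℝ} (h0 : 0 < Ψ s) (hne : Ψ s - R ^ 2 / Ψ s ≠ 0)
    (hΨ : HasDerivAt Ψ (-(Ψ s - R ^ 2 / Ψ s)⁻¹) s) :
    HasDerivAt (fun s => (Ψ s - R ^ 2 / Ψ s) ^ 2) (-2 * (1 + R ^ 2 / Ψ s ^ 2)) s := by
  have h1 : HasDerivAt (fun s => R ^ 2 / Ψ s) _ s := (hasDerivAt_const s (R ^ 2)).div hΨ h0.ne'
  have h2 := (hΨ.sub h1).pow 2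
  refine h2.congr_deriv ?_
  simp only [Pi.sub_apply]
  generalize hq : Ψ s - R ^ 2 / Ψ s = q at *
  field_simp
  ring

theorem hasDerivAt_profile_sq_deriv {R s : ℝ} {Ψ : ℝ → ℝ} (h0 : 0 < Ψ s)
    (hΨ : HasDerivAt Ψ (-(Ψ s - R ^ 2 / Ψ s)⁻¹) s) :
    HasDerivAt (fun s => -2 * (1 + R ^ 2 / Ψ s ^ 2))
      (-4 * R ^ 2 / Ψ s ^ 3 * (Ψ s - R ^ 2 / Ψ s)⁻¹) s := by
  have h1 : HasDerivAt (fun s => R ^ 2 / Ψ s ^ 2) _ s :=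
    (hasDerivAt_const s (R ^ 2)).div (hΨ.pow 2) (pow_pos h0 2).ne'
  refine ((h1.const_add 1).const_mul (-2)).congr_deriv ?_
  generalize Ψ s - R ^ 2 / Ψ s = q at *
  simp
  field_simp
  ring

theorem profile_ode {R ρ : ℝ} (h0 : 0 < ρ) (hne : ρ - R ^ 2 / ρ ≠ 0) :
    -4 * R ^ 2 / ρ ^ 3 * (ρ - R ^ 2 / ρ)⁻¹ * (ρ - R ^ 2 / ρ) ^ 2 =
      (-2 * (1 + R ^ 2 / ρ ^ 2) + 2) * (-2 * (1 + R ^ 2 / ρ ^ 2) + 4) := by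
  have : -4 * R ^ 2 / ρ ^ 3 * (ρ - R ^ 2 / ρ)⁻¹ * (ρ - R ^ 2 / ρ) ^ 2 =
      -4 * R ^ 2 / ρ ^ 3 * (ρ - R ^ 2 / ρ) := by
    generalize ρ - R ^ 2 / ρ = q at *
    field_simp
  rw [this]
  field_simp
  ring

namespace IsSerrinSolution

variable {Ω N : Set E2} {u : E2 → ℝ} {c : ℝ}

theorem gradient_sq_le_inner_profile (h : IsSerrinSolution Ω u)
    (hN : IsCompOf N (Ω \ MAXset Ω u))
    (hc : ∀ x ∈ frontier N ∩ frontier Ω, ‖gC Ω u x‖ = c) {R δ : ℝ} {Ψ : ℝ → ℝ}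
    (hδ : 0 < δ) (hΨc : ContinuousOn Ψ (Icc (-δ) (umax Ω u)))
    (hΨ0 : ∀ s ∈ Icc (-δ) (umax Ω u), 0 < Ψ s)
    (hΨ : ∀ s ∈ Ioo (-δ) (umax Ω u), Ψ s < R ∧ HasDerivAt Ψ (-(Ψ s - R ^ 2 / Ψ s)⁻¹) s)
    (hcΨ : c ^ 2 = (Ψ 0 - R ^ 2 / Ψ 0) ^ 2) :
    ∀ x ∈ closure N, ‖gC Ω u x‖ ^ 2 ≤ (Ψ (u x) - R ^ 2 / Ψ (u x)) ^ 2 := by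
  have hm := h.umax_pos
  set m := umax Ω u
  set G : ℝ → ℝ := fun s => (Ψ s - R ^ 2 / Ψ s) ^ 2 with hG
  have hne : ∀ s ∈ Ioo (-δ) m, Ψ s - R ^ 2 / Ψ s < 0 := fun s hs =>
    modelDrop_deriv_neg (hΨ0 s (Ioo_subset_Icc_self hs)) (hΨ s hs).1
  have hGd : ∀ s ∈ Ioo (-δ) m, HasDerivAt G (-2 * (1 + R ^ 2 / Ψ s ^ 2)) s := fun s hs =>
    hasDerivAt_profile_sq (hΨ0 s (Ioo_subset_Icc_self hs)) (hne s hs).ne (hΨ s hs).2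
  have hle : ∀ s ∈ Ioo (-δ) m, -2 * (1 + R ^ 2 / Ψ s ^ 2) ≤ -4 := fun s hs => by
    have h0 := hΨ0 s (Ioo_subset_Icc_self hs)
    have h1 : 1 ≤ R ^ 2 / Ψ s ^ 2 := by
      rw [le_div_iff₀ (by positivity)]
      nlinarith [(hΨ s hs).1]
    linarith
  have hGc : ContinuousOn G (Icc (-δ) m) :=
    (hΨc.sub (continuousOn_const.div hΨc fun s hs => (hΨ0 s hs).ne')).pow 2
  have hanti : AntitoneOn G (Icc (-δ) m) := by
    refine antitoneOn_of_deriv_nonpos (convex_Icc _ _) hGc (fun s hs => ?_) fun s hs => ?_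
    · rw [interior_Icc] at hs
      exact (hGd s hs).differentiableAt.differentiableWithinAt
    · rw [interior_Icc] at hs
      rw [(hGd s hs).deriv]
      linarith [hle s hs]
  have hσ : ∀ σ ∈ Ioo 0 δ, ∀ x ∈ closure N, ‖gC Ω u x‖ ^ 2 ≤ G (u x - σ) := by
    intro σ hσ
    have hmI : ∀ s ∈ Icc 0 m, s - σ ∈ Ioo (-δ) m := fun s hs =>
      ⟨by linarith [hs.1, hσ.2], by linarith [hs.2, hσ.1]⟩
    have hmI' := fun s (hs : s ∈ Ioo 0 m) => hmI s (Ioo_subset_Icc_self hs)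
    refine h.gradient_sq_le_of_model_barrier hN hc (P := fun s => G (s - σ))
      (P' := fun s => -2 * (1 + R ^ 2 / Ψ (s - σ) ^ 2))
      (P'' := fun s => -4 * R ^ 2 / Ψ (s - σ) ^ 3 * (Ψ (s - σ) - R ^ 2 / Ψ (s - σ))⁻¹)
      (fun s hs => ?_) (fun s hs => ?_) ?_ (fun s hs => ?_) ?_ (fun s hs => ?_) fun s hs => ?_
    · exact (hGd _ (hmI' s hs)).comp_sub_const s σ
    · exact (hasDerivAt_profile_sq_deriv (hΨ0 _ (Ioo_subset_Icc_self (hmI' s hs)))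
        (hΨ _ (hmI' s hs)).2).comp_sub_const s σ
    · exact hGc.comp (by fun_prop) fun s hs => Ioo_subset_Icc_self (hmI s hs)
    · exact sq_pos_of_ne_zero (hne _ (hmI s hs)).ne
    · rw [hcΨ]
      exact hanti (Ioo_subset_Icc_self (hmI 0 ⟨le_rfl, hm.le⟩)) ⟨by linarith, hm.le⟩
        (by linarith [hσ.1])
    · exact profile_ode (hΨ0 _ (Ioo_subset_Icc_self (hmI' s hs))) (hne _ (hmI' s hs)).ne
    · exact hle _ (hmI' s hs)
  intro x hx
  have hux := h.mem_Icc_of_mem_closure_comp hN hx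
  have htend : Tendsto (fun σ : ℝ => G (u x - σ)) (𝓝[>] 0) (𝓝 (G (u x))) := by
    have h1 : ContinuousWithinAt G (Icc (-δ) m) (u x) := hGc _ ⟨by linarith [hux.1], hux.2⟩
    refine h1.tendsto.comp (tendsto_nhdsWithin_iff.2 ⟨?_, ?_⟩)
    · have : Continuous fun σ : ℝ => u x - σ := by fun_prop
      have := this.tendsto 0
      rw [sub_zero] at this
      exact this.mono_left nhdsWithin_le_nhds
    · filter_upwards [Ioo_mem_nhdsGT hδ] with σ hσ
      exact ⟨by linarith [hux.1, hσ.2], by linarith [hux.2, hσ.1]⟩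
  refine ge_of_tendsto htend ?_
  filter_upwards [Ioo_mem_nhdsGT hδ] with σ hσ' using hσ σ hσ' x hx

end IsSerrinSolution

namespace IsBoundaryCurve

variable {Ω N : Set E2} {u : E2 → ℝ} {c L C s₀ : ℝ} {γ n : ℝ → E2} {β : ℝ → ℝ}

/-- If `|∇u|² ≤ G(u)` in `N`, with equality on the boundary, then the normal second derivative
of `u` along the boundary is at most `G'(0) / 2`. -/
theorem normal_second_deriv_le (h : IsSerrinSolution Ω u) (hN : IsCompOf N (Ω \ MAXset Ω u))
    (hb : IsBoundaryCurve Ω N u c L C s₀ γ n β) {G : ℝ → ℝ} {G₀ : ℝ} (hG : HasDerivAt G G₀ 0)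
    (hG0 : G 0 = c ^ 2) (hle : ∀ x ∈ closure N, ‖gC Ω u x‖ ^ 2 ≤ G (u x)) (t : ℝ) :
    ⟪hC Ω u (γ t) (n t), n t⟫ ≤ G₀ / 2 := by
  have hline : HasDerivWithinAt (fun s : ℝ => γ t + s • n t) (n t) (Ioo 0 s₀) 0 := by
    have : HasDerivAt (fun s : ℝ => γ t + s • n t) (n t) 0 := by
      simpa using ((hasDerivAt_id (0 : ℝ)).smul_const (n t)).const_add (γ t)
    exact this.hasDerivWithinAt
  have hmem : ∀ s ∈ Ioo 0 s₀, γ t + s • n t ∈ N := fun s hs => hb.collar_mem t s hs.1 hs.2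
  have hmaps : MapsTo (fun s : ℝ => γ t + s • n t) (Ioo 0 s₀) (closure Ω) := fun s hs =>
    IsSerrinSolution.closure_comp_subset hN (subset_closure (hmem s hs))
  have h00 : γ t + (0 : ℝ) • n t = γ t := by simp
  have hcl := hb.mem_closure t
  have hg : HasDerivWithinAt (fun s : ℝ => gC Ω u (γ t + s • n t)) (hC Ω u (γ t) (n t))
      (Ioo 0 s₀) 0 := by
    have h1 := h.hasFDerivWithinAt_gC hcl
    rw [← h00] at h1
    have h2 := h1.comp_hasDerivWithinAt (f := fun s : ℝ => γ t + s • n t) (0 : ℝ) hline hmaps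
    rwa [h00] at h2
  have hu : HasDerivWithinAt (fun s : ℝ => u (γ t + s • n t)) c (Ioo 0 s₀) 0 := by
    have h1 := h.hasFDerivWithinAt hcl
    rw [← h00] at h1
    have h2 := h1.comp_hasDerivWithinAt (f := fun s : ℝ => γ t + s • n t) (0 : ℝ) hline hmaps
    rw [h00, hb.gC_eq] at h2
    refine h2.congr_deriv ?_
    simp [hb.norm_normal]
  have hw : HasDerivWithinAt (fun s : ℝ => ‖gC Ω u (γ t + s • n t)‖ ^ 2 - G (u (γ t + s • n t)))
      (2 * ⟪gC Ω u (γ t), hC Ω u (γ t) (n t)⟫ - G₀ * c) (Ioo 0 s₀) 0 := by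
    have h1 : HasDerivAt G G₀ (u (γ t + (0 : ℝ) • n t)) := by rwa [h00, hb.u_eq_zero h]
    have h2 := hg.norm_sq.sub (h1.comp_hasDerivWithinAt (0 : ℝ) hu)
    rw [h00] at h2
    exact h2
  have hw0 : ‖gC Ω u (γ t + (0 : ℝ) • n t)‖ ^ 2 - G (u (γ t + (0 : ℝ) • n t)) = 0 := by
    rw [h00, hb.u_eq_zero h, hG0, hb.gC_eq, norm_smul, hb.norm_normal, Real.norm_eq_abs, mul_one,
      sq_abs, sub_self]
  have hslope := (hasDerivWithinAt_iff_tendsto_slope' (by simp)).1 hw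
  have : (𝓝[Ioo 0 s₀] (0 : ℝ)).NeBot := by
    rw [nhdsWithin_Ioo_eq_nhdsGT hb.s₀_pos]; infer_instance
  have hle0 : 2 * ⟪gC Ω u (γ t), hC Ω u (γ t) (n t)⟫ - G₀ * c ≤ 0 := by
    refine le_of_tendsto hslope ?_
    filter_upwards [self_mem_nhdsWithin] with s hs
    rw [slope_def_field, hw0, sub_zero, sub_zero]
    exact div_nonpos_of_nonpos_of_nonneg
      (sub_nonpos.2 (hle _ (subset_closure (hmem s hs)))) hs.1.le
  rw [hb.gC_eq, inner_smul_left, conj_trivial, real_inner_comm] at hle0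
  have := hb.c_pos
  have h3 : c * (2 * ⟪hC Ω u (γ t) (n t), n t⟫ - G₀) ≤ 0 := by linarith
  have h4 := nonpos_of_mul_nonpos_right h3 this
  linarith

theorem length_le_of_inner (h : IsSerrinSolution Ω u) (hN : IsCompOf N (Ω \ MAXset Ω u))
    (hb : IsBoundaryCurve Ω N u c L C s₀ γ n β)
    (hc : ∀ x ∈ frontier N ∩ frontier Ω, ‖gC Ω u x‖ = c) {R r : ℝ} (hr : 0 < r) (hrR : r < R)
    (hm : modelDrop R r = umax Ω u) (hcr : c = R ^ 2 / r - r) : L ≤ 2 * Real.pi * r := by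
  obtain ⟨Ψ, δ, hδ, hΨ00, hΨc, hΨ0, hΨ⟩ := exists_inner_profile hr hrR hm
  have hbound := h.gradient_sq_le_inner_profile hN hc hδ hΨc hΨ0 hΨ (by rw [hΨ00, hcr]; ring)
  have h0I : (0 : ℝ) ∈ Ioo (-δ) (umax Ω u) := ⟨by linarith, h.umax_pos⟩
  have hG := hasDerivAt_profile_sq (hΨ0 0 (Ioo_subset_Icc_self h0I))
    (modelDrop_deriv_neg (hΨ0 0 (Ioo_subset_Icc_self h0I)) (hΨ 0 h0I).1).ne (hΨ 0 h0I).2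
  have hcurv : ∀ t, 1 / r ≤ β t := fun t => by
    have h1 := hb.normal_second_deriv_le h hN hG (by rw [hΨ00, hcr]; ring) hbound t
    have h2 := h.trace_hC_unit (hb.mem_closure t) (hb.norm_normal t)
    rw [hΨ00] at h1
    rw [hb.curvature_eq, ← div_eq_inv_mul, le_div_iff₀ hb.c_pos]
    have h3 : 1 / r * c = R ^ 2 / r ^ 2 - 1 := by rw [hcr]; field_simp
    rw [h3]
    linarith
  have h5 := curvature_bound_mul_length_le hb.L_pos hb.hasDerivAt hb.hasDerivAt_tangent
    hb.continuous_curvature hb.norm_tangent hb.periodic hb.injective hcurv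
  rw [one_div, ← div_eq_inv_mul, div_le_iff₀ hr] at h5
  exact h5

end IsBoundaryCurve

/-- `ρ²(2V - V'²/2)` for the drop `V` of the model solution. -/
def modelEnergy (R ρ : ℝ) : ℝ := 2 * ρ ^ 2 * modelDrop R ρ - (ρ ^ 2 - R ^ 2) ^ 2 / 2

theorem modelEnergy_self (R : ℝ) : modelEnergy R R = 0 := by simp [modelEnergy, modelDrop_self]

theorem hasDerivAt_modelEnergy (R : ℝ) {ρ : ℝ} (hρ : 0 < ρ) :
    HasDerivAt (modelEnergy R) (4 * ρ * modelDrop R ρ) ρ := by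
  have h1 := (((hasDerivAt_pow 2 ρ).const_mul 2).mul (hasDerivAt_modelDrop R hρ)).sub
    ((((hasDerivAt_pow 2 ρ).sub_const (R ^ 2)).pow 2).div_const 2)
  refine h1.congr_deriv ?_
  simp
  field_simp
  ring

theorem continuousOn_modelEnergy {R : ℝ} (hR : 0 ≤ R) : ContinuousOn (modelEnergy R) (Ici R) := by
  have := continuousOn_modelDrop hR
  unfold modelEnergy
  fun_prop

theorem modelEnergy_pos {R ρ : ℝ} (hR : 0 ≤ R) (hρ : R < ρ) : 0 < modelEnergy R ρ := by
  rw [← modelEnergy_self R]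
  refine strictMonoOn_of_deriv_pos (convex_Ici R) (continuousOn_modelEnergy hR) (fun x hx => ?_)
    self_mem_Ici hρ.le hρ
  rw [interior_Ici, mem_Ioi] at hx
  have h0 : 0 < x := hR.trans_lt hx
  rw [(hasDerivAt_modelEnergy R h0).deriv]
  have := modelDrop_pos hR hx
  positivity

theorem modelEnergy_neg {R ρ : ℝ} (h0 : 0 < ρ) (hρ : ρ < R) : modelEnergy R ρ < 0 := by
  rw [← modelEnergy_self R]
  refine strictMonoOn_of_deriv_pos (convex_Ioc 0 R) (fun x hx =>
    (hasDerivAt_modelEnergy R hx.1).continuousAt.continuousWithinAt) (fun x hx => ?_)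
    ⟨h0, hρ.le⟩ ⟨h0.trans hρ, le_rfl⟩ hρ
  rw [interior_Ioc] at hx
  rw [(hasDerivAt_modelEnergy R hx.1).deriv]
  have h1 : 0 < modelDrop R x := by
    rw [← modelDrop_self R]
    exact modelDrop_strictAntiOn R ⟨hx.1, hx.2.le⟩ ⟨h0.trans hρ, le_rfl⟩ hx.2
  have := hx.1
  positivity

/-- `(ρ²-R²)²/2 - 2R²V` for the drop `V` of the model solution. -/
def modelGap (R ρ : ℝ) : ℝ := (ρ ^ 2 - R ^ 2) ^ 2 / 2 - 2 * R ^ 2 * modelDrop R ρ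

theorem hasDerivAt_modelGap (R : ℝ) {ρ : ℝ} (hρ : 0 < ρ) :
    HasDerivAt (modelGap R) (2 * (ρ ^ 2 - R ^ 2) ^ 2 / ρ) ρ := by
  have h1 := ((((hasDerivAt_pow 2 ρ).sub_const (R ^ 2)).pow 2).div_const 2).sub
    ((hasDerivAt_modelDrop R hρ).const_mul (2 * R ^ 2))
  refine h1.congr_deriv ?_
  simp
  field_simp

theorem continuousOn_modelGap {R : ℝ} (hR : 0 ≤ R) : ContinuousOn (modelGap R) (Ici R) := by
  have := continuousOn_modelDrop hR
  unfold modelGap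
  fun_prop

theorem modelGap_nonneg {R ρ : ℝ} (hR : 0 ≤ R) (hρ : R ≤ ρ) : 0 ≤ modelGap R ρ := by
  have h0 : modelGap R R = 0 := by simp [modelGap, modelDrop_self]
  rw [← h0]
  refine monotoneOn_of_deriv_nonneg (convex_Ici R) (continuousOn_modelGap hR) (fun x hx => ?_)
    (fun x hx => ?_) self_mem_Ici hρ hρ
  all_goals
    rw [interior_Ici, mem_Ioi] at hx
    have hx0 : 0 < x := hR.trans_lt hx
  · exact (hasDerivAt_modelGap R hx0).differentiableAt.differentiableWithinAt
  · rw [(hasDerivAt_modelGap R hx0).deriv]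
    positivity

theorem sq_mul_modelGap_le {R ρ : ℝ} (hR : 0 ≤ R) (hρ : R ≤ ρ) :
    ρ ^ 2 * modelGap R ρ ≤ 2 * (ρ ^ 2 - R ^ 2) ^ 3 := by
  set F : ℝ → ℝ := fun ρ => 2 * (ρ ^ 2 - R ^ 2) ^ 3 - ρ ^ 2 * modelGap R ρ with hF
  have h0 : F R = 0 := by simp [hF, modelGap, modelDrop_self]
  have hd : ∀ x : ℝ, 0 < x →
      HasDerivAt F (2 * x * (5 * (x ^ 2 - R ^ 2) ^ 2 - modelGap R x)) x := fun x hx => by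
    have h1 := ((((hasDerivAt_pow 2 x).sub_const (R ^ 2)).pow 3).const_mul 2).sub
      ((hasDerivAt_pow 2 x).mul (hasDerivAt_modelGap R hx))
    refine h1.congr_deriv ?_
    simp
    field_simp
    ring
  have hc : ContinuousOn F (Ici R) := by
    have := continuousOn_modelGap hR
    fun_prop
  have : F R ≤ F ρ := by
    refine monotoneOn_of_deriv_nonneg (convex_Ici R) hc (fun x hx => ?_)
      (fun x hx => ?_) self_mem_Ici hρ hρ
    all_goals
      rw [interior_Ici, mem_Ioi] at hx
      have hx0 : 0 < x := hR.trans_lt hx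
    · exact (hd x hx0).differentiableAt.differentiableWithinAt
    · rw [(hd x hx0).deriv]
      have h2 : modelGap R x ≤ (x ^ 2 - R ^ 2) ^ 2 / 2 := by
        have := modelDrop_nonneg hR hx.le
        have : 0 ≤ 2 * R ^ 2 * modelDrop R x := by positivity
        unfold modelGap
        linarith
      have h3 : 0 ≤ 5 * (x ^ 2 - R ^ 2) ^ 2 - modelGap R x := by
        nlinarith [sq_nonneg (x ^ 2 - R ^ 2)]
      positivity
  rw [h0] at this
  simpa [hF] using this

/-- The multiplier `B / (ρ²-R²)`. -/
def modelMultiplier (R ρ : ℝ) : ℝ := modelEnergy R ρ / (ρ ^ 2 - R ^ 2)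

theorem modelMultiplier_nonneg {R ρ : ℝ} (hR : 0 ≤ R) (hρ : R ≤ ρ) : 0 ≤ modelMultiplier R ρ := by
  rcases hρ.eq_or_lt with rfl | hρ
  · simp [modelMultiplier]
  · exact div_nonneg (modelEnergy_pos hR hρ).le (by nlinarith)

theorem modelMultiplier_le {R ρ : ℝ} (hR : 0 ≤ R) (hρ : R ≤ ρ) :
    modelMultiplier R ρ ≤ 2 * modelDrop R ρ := by
  rcases hρ.eq_or_lt with rfl | hlt
  · simp [modelMultiplier, modelDrop_self]
  · rw [modelMultiplier, div_le_iff₀ (by nlinarith)]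
    have := modelGap_nonneg hR hρ
    unfold modelGap at this
    unfold modelEnergy
    linarith

theorem hasDerivAt_modelMultiplier {R ρ : ℝ} (hR : 0 ≤ R) (hρ : R < ρ) :
    HasDerivAt (modelMultiplier R)
      (2 * modelGap R ρ / (ρ ^ 2 - R ^ 2) ^ 2 * ρ) ρ := by
  have h0 : 0 < ρ := hR.trans_lt hρ
  have hne : 0 < ρ ^ 2 - R ^ 2 := by nlinarith
  have h1 := (hasDerivAt_modelEnergy R h0).div ((hasDerivAt_pow 2 ρ).sub_const (R ^ 2)) hne.ne'
  refine h1.congr_deriv ?_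
  simp only [modelEnergy, modelGap]
  field_simp
  push_cast
  ring

/-- The multiplier as a function of `u`, together with its derivative, for an outer profile. -/
theorem exists_outer_multiplier {R : ℝ} (hR : 0 ≤ R) (hR1 : R < 1) {Ψ : ℝ → ℝ}
    (hΨ0 : Ψ 0 = 1) (hΨc : ContinuousOn Ψ (Icc 0 (modelUmax R)))
    (hΨ : ∀ s ∈ Icc 0 (modelUmax R), R ≤ Ψ s ∧ modelDrop R (Ψ s) = modelUmax R - s)
    (hΨd : ∀ s ∈ Ioo 0 (modelUmax R), R < Ψ s ∧ HasDerivAt Ψ (-(Ψ s - R ^ 2 / Ψ s)⁻¹) s) :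
    ∃ η η' : ℝ → ℝ, (∀ s ∈ Ioo 0 (modelUmax R), HasDerivAt η (η' s) s) ∧
      ContinuousOn η (Icc 0 (modelUmax R)) ∧ ContinuousOn η' (Ioo 0 (modelUmax R)) ∧
      (∀ s ∈ Ioo 0 (modelUmax R), |η' s| ≤ 4) ∧
      (∀ s ∈ Icc 0 (modelUmax R), |η s| ≤ 2 * (modelUmax R - s)) ∧
      (∀ s ∈ Ioo 0 (modelUmax R), η' s ≤ 0) ∧
      (∀ s ∈ Ioo 0 (modelUmax R),
        2 * η s - 4 * (modelUmax R - s) = η' s * (Ψ s - R ^ 2 / Ψ s) ^ 2) ∧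
      η 0 * (1 - R ^ 2) = 2 * modelUmax R - (1 - R ^ 2) ^ 2 / 2 := by
  set m := modelUmax R with hm
  set η : ℝ → ℝ := fun s => modelMultiplier R (Ψ s) with hη
  set η' : ℝ → ℝ := fun s =>
    -(2 * modelGap R (Ψ s) * Ψ s ^ 2 / (Ψ s ^ 2 - R ^ 2) ^ 3) with hη'
  have hη2 : ∀ s ∈ Icc 0 m, |η s| ≤ 2 * (m - s) := fun s hs => by
    obtain ⟨h1, h2⟩ := hΨ s hs
    rw [abs_of_nonneg (modelMultiplier_nonneg hR h1), ← h2]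
    exact modelMultiplier_le hR h1
  have hgap : ∀ s ∈ Ioo 0 m, 0 < Ψ s ∧ 0 < Ψ s ^ 2 - R ^ 2 ∧ 0 ≤ modelGap R (Ψ s) := fun s hs => by
    have h1 := (hΨd s hs).1
    have h0 : 0 < Ψ s := hR.trans_lt h1
    exact ⟨h0, by nlinarith, modelGap_nonneg hR h1.le⟩
  have hηd : ∀ s ∈ Ioo 0 m, HasDerivAt η (η' s) s := fun s hs => by
    obtain ⟨h1, h2⟩ := hΨd s hs
    obtain ⟨h3, h4, -⟩ := hgap s hs
    refine ((hasDerivAt_modelMultiplier hR h1).comp s h2).congr_deriv ?_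
    have h5 : Ψ s - R ^ 2 / Ψ s = (Ψ s ^ 2 - R ^ 2) / Ψ s := by field_simp
    rw [h5, inv_div, hη']
    simp only []
    generalize Ψ s ^ 2 - R ^ 2 = q at *
    field_simp
  have hη'neg : ∀ s ∈ Ioo 0 m, η' s ≤ 0 := fun s hs => by
    obtain ⟨h3, h4, h5⟩ := hgap s hs
    exact neg_nonpos.2 (by positivity)
  refine ⟨η, η', hηd, ?_, ?_, ?_, hη2, hη'neg, ?_, ?_⟩
  · intro s hs
    rcases hs.2.eq_or_lt with rfl | hlt
    · have h1 : η m = 0 := by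
        have := hη2 m hs
        rw [sub_self, mul_zero] at this
        exact abs_nonpos_iff.1 this
      rw [ContinuousWithinAt, h1]
      refine squeeze_zero_norm' (a := fun s => 2 * (m - s)) ?_ ?_
      · filter_upwards [self_mem_nhdsWithin] with s hs using hη2 s hs
      · have : Continuous fun s : ℝ => 2 * (m - s) := by fun_prop
        have := this.tendsto m
        rw [sub_self, mul_zero] at this
        exact this.mono_left nhdsWithin_le_nhds
    · have hlt' : R < Ψ s := by
        obtain ⟨h1, h2⟩ := hΨ s hs
        refine lt_of_le_of_ne h1 fun heq => ?_
        rw [← heq, modelDrop_self] at h2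
        linarith
      exact (hasDerivAt_modelMultiplier hR hlt').continuousAt.comp_continuousWithinAt (hΨc s hs)
  · have h1 : ContinuousOn Ψ (Ioo 0 m) := hΨc.mono Ioo_subset_Icc_self
    have h2 : ContinuousOn (fun s => modelGap R (Ψ s)) (Ioo 0 m) :=
      (continuousOn_modelGap hR).comp h1 fun s hs => (hΨd s hs).1.le
    exact (((continuousOn_const.mul h2).mul (h1.pow 2)).div (((h1.pow 2).sub
      continuousOn_const).pow 3) fun s hs => (pow_pos (hgap s hs).2.1 3).ne').neg
  · intro s hs
    obtain ⟨h3, h4, h5⟩ := hgap s hs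
    rw [abs_of_nonpos (hη'neg s hs), neg_neg, div_le_iff₀ (by positivity)]
    have := sq_mul_modelGap_le hR (hΨd s hs).1.le
    linarith
  · intro s hs
    obtain ⟨h3, h4, -⟩ := hgap s hs
    rw [← (hΨ s (Ioo_subset_Icc_self hs)).2]
    have h5 : Ψ s - R ^ 2 / Ψ s = (Ψ s ^ 2 - R ^ 2) / Ψ s := by field_simp
    rw [h5]
    simp only [hη, hη', modelMultiplier, modelEnergy, modelGap]
    field_simp
    ring
  · have h1 : 0 < 1 - R ^ 2 := by nlinarith
    simp only [hη, hΨ0, modelMultiplier, modelEnergy, modelDrop_one]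
    field_simp
    ring

namespace IsSerrinSolution

variable {Ω N : Set E2} {u : E2 → ℝ} {c : ℝ}

theorem gradient_sq_le_linear (h : IsSerrinSolution Ω u) (hN : IsCompOf N (Ω \ MAXset Ω u))
    (hc : ∀ x ∈ frontier N ∩ frontier Ω, ‖gC Ω u x‖ = c) (hc1 : c ^ 2 ≤ 1)
    (hm : umax Ω u ≤ 1 / 2) :
    ∀ x ∈ closure N, ‖gC Ω u x‖ ^ 2 ≤ 1 - 2 * u x := by
  intro x hx
  have key : ∀ e : ℝ, 0 < e → e < 1 → ‖gC Ω u x‖ ^ 2 ≤ 1 - (2 - 2 * e) * u x := by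
    intro e he he1
    refine h.gradient_sq_le_of_barrier hN hc (H := fun s => 1 - (2 - 2 * e) * s)
      (H' := fun _ => -(2 - 2 * e)) (H'' := fun _ => 0) (fun s _ => ?_)
      (fun s _ => hasDerivAt_const _ _) (by fun_prop) (fun s hs => ?_) (by simpa using hc1)
      (fun s _ w _ => by nlinarith) x hx
    · simpa using ((hasDerivAt_id s).const_mul (2 - 2 * e)).const_sub 1
    · nlinarith [hs.1, hs.2]
  refine ge_of_tendsto (x := 𝓝[>] (0 : ℝ)) (f := fun e => 1 - (2 - 2 * e) * u x) ?_ ?_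
  · have : ContinuousAt (fun e : ℝ => 1 - (2 - 2 * e) * u x) 0 := by fun_prop
    simpa using this.tendsto.mono_left nhdsWithin_le_nhds
  · filter_upwards [Ioo_mem_nhdsGT (zero_lt_one' ℝ)] with e he using key e he.1 he.2

theorem gradient_sq_le_outer_profile (h : IsSerrinSolution Ω u)
    (hN : IsCompOf N (Ω \ MAXset Ω u))
    (hc : ∀ x ∈ frontier N ∩ frontier Ω, ‖gC Ω u x‖ = c) {R : ℝ} (hR : 0 ≤ R)
    (hm : umax Ω u = modelUmax R) (hcR : c = 1 - R ^ 2) {Ψ : ℝ → ℝ}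
    (hΨ0 : Ψ 0 = 1) (hΨc : ContinuousOn Ψ (Icc 0 (modelUmax R)))
    (hΨ : ∀ s ∈ Icc 0 (modelUmax R), R ≤ Ψ s ∧ modelDrop R (Ψ s) = modelUmax R - s)
    (hΨd : ∀ s ∈ Ioo 0 (modelUmax R), R < Ψ s ∧ HasDerivAt Ψ (-(Ψ s - R ^ 2 / Ψ s)⁻¹) s) :
    ∀ x ∈ closure N, ‖gC Ω u x‖ ^ 2 ≤ (Ψ (u x) - R ^ 2 / Ψ (u x)) ^ 2 := by
  rw [← hm] at hΨ hΨd hΨc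
  rcases hR.eq_or_lt with rfl | hR0
  · intro x hx
    have hm2 : umax Ω u = 1 / 2 := by rw [hm]; simp [modelUmax]
    have h1 := (hΨ (u x) (h.mem_Icc_of_mem_closure_comp hN hx)).2
    have h2 := h.gradient_sq_le_linear hN hc (by rw [hcR]; norm_num) hm2.le x hx
    simp only [modelDrop] at h1
    norm_num at h1 ⊢
    linarith
  · have hpos : ∀ s ∈ Icc 0 (umax Ω u), 0 < Ψ s := fun s hs => hR0.trans_le (hΨ s hs).1
    have hne : ∀ s ∈ Ioo 0 (umax Ω u), 0 < Ψ s - R ^ 2 / Ψ s := fun s hs =>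
      modelDrop_deriv_pos hR (hΨd s hs).1
    refine h.gradient_sq_le_of_barrier hN hc (H := fun s => (Ψ s - R ^ 2 / Ψ s) ^ 2)
      (fun s hs => hasDerivAt_profile_sq (hpos s (Ioo_subset_Icc_self hs)) (hne s hs).ne'
        (hΨd s hs).2)
      (fun s hs => hasDerivAt_profile_sq_deriv (hpos s (Ioo_subset_Icc_self hs)) (hΨd s hs).2)
      ((hΨc.sub (continuousOn_const.div hΨc fun s hs => (hpos s hs).ne')).pow 2)
      (fun s _ => sq_nonneg _) (by rw [hcR, hΨ0]; simp) (fun s hs w hw => ?_)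
    rw [← profile_ode (hpos s (Ioo_subset_Icc_self hs)) (hne s hs).ne', ← mul_sub]
    have h0 := hpos s (Ioo_subset_Icc_self hs)
    have h1 : 0 < 4 * R ^ 2 / Ψ s ^ 3 * (Ψ s - R ^ 2 / Ψ s)⁻¹ :=
      mul_pos (by positivity) (inv_pos.2 (hne s hs))
    have h2 : -4 * R ^ 2 / Ψ s ^ 3 * (Ψ s - R ^ 2 / Ψ s)⁻¹ =
      -(4 * R ^ 2 / Ψ s ^ 3 * (Ψ s - R ^ 2 / Ψ s)⁻¹) := by ring
    rw [h2]
    nlinarith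

end IsSerrinSolution

namespace IsBoundaryCurve

variable {Ω N : Set E2} {u : E2 → ℝ} {c L C s₀ : ℝ} {γ n : ℝ → E2} {β : ℝ → ℝ}

theorem length_le_neg_integral_of_outer (h : IsSerrinSolution Ω u)
    (hN : IsCompOf N (Ω \ MAXset Ω u)) (hb : IsBoundaryCurve Ω N u c L C s₀ γ n β)
    (hc : ∀ x ∈ frontier N ∩ frontier Ω, ‖gC Ω u x‖ = c) {R : ℝ} (hR : 0 ≤ R) (hR1 : R < 1)
    (hm : umax Ω u = modelUmax R) (hcR : c = 1 - R ^ 2) :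
    L ≤ -∫ t in (0 : ℝ)..L, ⟪γ t, n t⟫ := by
  obtain ⟨Ψ, hΨ0, hΨc, hΨ, hΨd⟩ := exists_outer_profile hR hR1
  obtain ⟨η, η', hη, hηc, hη'c, hη'b, hηb, hη'0, hηG, hη0⟩ :=
    exists_outer_multiplier hR hR1 hΨ0 hΨc hΨ hΨd
  have hW := h.gradient_sq_le_outer_profile hN hc hR hm hcR hΨ0 hΨc hΨ hΨd
  rw [← hm] at hη hηc hη'c hη'b hηb hη'0 hηG hη0
  have hid := hb.pohozaev_identity h hN hη hηc hη'c hη'b hηb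
  have hle : ∫ x in N, (2 * η (u x) - 4 * (umax Ω u - u x) - η' (u x) * ‖gC Ω u x‖ ^ 2) ≤ 0 := by
    refine setIntegral_nonpos (IsSerrinSolution.isOpen_comp h hN).measurableSet fun x hx => ?_
    have h1 := h.mem_Ioo_of_mem_comp hN hx
    rw [hηG _ h1, ← mul_sub]
    exact mul_nonpos_of_nonpos_of_nonneg (hη'0 _ h1) (sub_nonneg.2 (hW x (subset_closure hx)))
  rw [hid, hcR, hη0] at hle
  have hE := modelEnergy_pos hR hR1
  rw [modelEnergy, modelDrop_one, ← hm] at hE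
  norm_num at hE
  have : (2 * umax Ω u - (1 - R ^ 2) ^ 2 / 2) * (L + ∫ t in (0 : ℝ)..L, ⟪γ t, n t⟫) ≤ 0 := by
    linarith
  have h2 := nonpos_of_mul_nonpos_right this (by linarith)
  linarith

theorem neg_integral_le (hb : IsBoundaryCurve Ω N u c L C s₀ γ n β) :
    -∫ t in (0 : ℝ)..L, ⟪γ t, n t⟫ ≤ L ^ 2 / (2 * Real.pi) := by
  have h1 := isoperimetric_signed hb.L_pos hb.hasDerivAt
    (rotJ.continuous.comp hb.continuous_normal) hb.norm_tangent (by simpa using hb.periodic 0)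
  simpa [rotJ_rotJ, inner_neg_right] using h1

theorem two_pi_le_of_outer (h : IsSerrinSolution Ω u)
    (hN : IsCompOf N (Ω \ MAXset Ω u)) (hb : IsBoundaryCurve Ω N u c L C s₀ γ n β)
    (hc : ∀ x ∈ frontier N ∩ frontier Ω, ‖gC Ω u x‖ = c) {R : ℝ} (hR : 0 ≤ R) (hR1 : R < 1)
    (hm : umax Ω u = modelUmax R) (hcR : c = 1 - R ^ 2) : 2 * Real.pi ≤ L := by
  have h1 := (hb.length_le_neg_integral_of_outer h hN hc hR hR1 hm hcR).trans hb.neg_integral_le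
  have hL := hb.L_pos
  rw [le_div_iff₀ (by positivity), sq] at h1
  exact le_of_mul_le_mul_left h1 hL

theorem integral_nonneg_of_inner (h : IsSerrinSolution Ω u)
    (hN : IsCompOf N (Ω \ MAXset Ω u)) (hb : IsBoundaryCurve Ω N u c L C s₀ γ n β)
    {R r : ℝ} (hr : 0 < r) (hrR : r < R) (hm : modelDrop R r = umax Ω u)
    (hcr : c = R ^ 2 / r - r) :
    0 ≤ ∫ t in (0 : ℝ)..L, ⟪γ t, n t⟫ := by
  have hid := hb.pohozaev_identity h hN (η := fun _ => 0) (η' := fun _ => 0) (B := 0)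
    (fun s _ => hasDerivAt_const s 0) continuousOn_const continuousOn_const (by simp)
    (fun s hs => by simpa using hs.2)
  have hle : ∫ x in N, (2 * (0 : ℝ) - 4 * (umax Ω u - u x) - 0 * ‖gC Ω u x‖ ^ 2) ≤ 0 := by
    refine setIntegral_nonpos (IsSerrinSolution.isOpen_comp h hN).measurableSet fun x hx => ?_
    linarith [(h.mem_Ioo_of_mem_comp hN hx).2]
  rw [hid] at hle
  have hE := modelEnergy_neg hr hrR
  rw [modelEnergy, hm] at hE
  have h1 : 0 < c ^ 2 / 2 - 2 * umax Ω u := by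
    have : r ^ 2 * c ^ 2 = (r ^ 2 - R ^ 2) ^ 2 := by rw [hcr]; field_simp; ring
    have h2 : 0 < r ^ 2 * (c ^ 2 / 2 - 2 * umax Ω u) := by linarith
    exact pos_of_mul_pos_right h2 (by positivity)
  by_contra! hneg
  nlinarith

end IsBoundaryCurve

theorem two_mul_modelUmax (R : ℝ) : 2 * modelUmax R = 1 - R ^ 2 + 2 * R ^ 2 * Real.log R := by
  unfold modelUmax
  ring

theorem innerRadius_spec {R : ℝ} (hR : 0 < R) (hm : 0 < modelUmax R) :
    0 < innerRadius R ∧ innerRadius R < R ∧ modelDrop R (innerRadius R) = modelUmax R := by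
  have hF : ∀ ρ, 1 - ρ ^ 2 + 2 * R ^ 2 * Real.log ρ = 2 * (modelUmax R - modelDrop R ρ) := by
    intro ρ
    unfold modelUmax modelDrop
    ring
  set ρ₀ := Real.exp (-1 / (2 * R ^ 2)) with hρ₀
  have hρ₀0 : 0 < ρ₀ := Real.exp_pos _
  have hF0 : modelUmax R < modelDrop R ρ₀ := by
    have h1 := hF ρ₀
    have h2 : 2 * R ^ 2 * Real.log ρ₀ = -1 := by rw [hρ₀, Real.log_exp]; field_simp
    nlinarith [sq_pos_of_pos hρ₀0]
  have hρ₀R : ρ₀ < R := by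
    by_contra! hle
    have hρ1 : ρ₀ ≤ 1 := Real.exp_le_one_iff.2 (div_nonpos_of_nonpos_of_nonneg (by norm_num)
      (by positivity))
    have := (modelDrop_strictMonoOn hR.le).monotoneOn hle (hle.trans hρ1) hρ1
    rw [modelDrop_one] at this
    linarith
  have hcont : ContinuousOn (modelDrop R) (Icc ρ₀ R) := fun x hx =>
    (hasDerivAt_modelDrop R (hρ₀0.trans_le hx.1)).continuousAt.continuousWithinAt
  obtain ⟨r, hr, hrm⟩ := intermediate_value_Ioo' hρ₀R.le hcont
    (show modelUmax R ∈ Ioo (modelDrop R R) (modelDrop R ρ₀) by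
      rw [modelDrop_self]; exact ⟨hm, hF0⟩)
  have hr0 : 0 < r := hρ₀0.trans hr.1
  have hrad : innerRadius R = r := by
    refine IsLeast.csInf_eq ⟨⟨hr0, by rw [hF, hrm]; ring⟩, fun ρ hρ => ?_⟩
    obtain ⟨hρ0, hρ1⟩ := hρ
    by_contra! hlt
    have := modelDrop_strictAntiOn R ⟨hρ0, (hlt.trans hr.2).le⟩ ⟨hr0, hr.2.le⟩ hlt
    rw [hF] at hρ1
    linarith
  rw [hrad]
  exact ⟨hr0, hr.2, hrm⟩

theorem nwssRegion_eq_div {Ω N : Set E2} {u : E2 → ℝ} {c : ℝ} (h : IsSerrinSolution Ω u)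
    (hN : IsCompOf N (Ω \ MAXset Ω u)) (hne : (frontier N ∩ frontier Ω).Nonempty)
    (hc : ∀ x ∈ frontier N ∩ frontier Ω, ‖gradient u x‖ = c) :
    nwssRegion Ω u N = c / √(2 * umax Ω u) := by
  rw [nwssRegion, nwssOn, ← IsSerrinSolution.frontier_inter_eq h hN,
    image_congr hc, hne.image_const, csSup_singleton]

theorem eq_of_tauOut_eq {R c : ℝ} (hm : 0 < modelUmax R)
    (h : tauOut R = c / √(2 * modelUmax R)) : c = 1 - R ^ 2 := by
  have hs : 0 < √(2 * modelUmax R) := Real.sqrt_pos.2 (by linarith)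
  rw [eq_div_iff hs.ne', tauOut] at h
  split_ifs at h with hR
  · subst hR
    rw [← h]
    simp [modelUmax]
  · rw [← two_mul_modelUmax, div_mul_cancel₀ _ hs.ne'] at h
    exact h.symm

theorem eq_of_tauIn_eq {R c : ℝ} (hR : R ≠ 1) (hm : 0 < modelUmax R) (hr : innerRadius R ≠ 0)
    (h : tauIn R = c / √(2 * modelUmax R)) :
    c = R ^ 2 / innerRadius R - innerRadius R := by
  have hs : 0 < √(2 * modelUmax R) := Real.sqrt_pos.2 (by linarith)
  rw [eq_div_iff hs.ne', tauIn, if_neg hR, ← two_mul_modelUmax] at h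
  rw [← h]
  field_simp

theorem setIntegral_inner_outNormal_eq_zero {S : Set E2} {u : E2 → ℝ}
    (hu : ∀ x ∈ S, gradient u x = 0) : ∫ x in S, ⟪x, outNormal u x⟫ ∂(μH[1]) = 0 :=
  setIntegral_eq_zero_of_forall_eq_zero fun x hx => by simp [outNormal, hu x hx]

namespace IsBoundaryCurve

variable {Ω N : Set E2} {u : E2 → ℝ} {c L C s₀ : ℝ} {γ n : ℝ → E2} {β : ℝ → ℝ}

theorem setIntegral_inner_outNormal (hb : IsBoundaryCurve Ω N u c L C s₀ γ n β)
    (hu : ∀ x ∈ frontier N ∩ frontier Ω, gradient u x = gC Ω u x) :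
    ∫ x in frontier N ∩ frontier Ω, ⟪x, outNormal u x⟫ ∂(μH[1]) =
      -∫ t in (0 : ℝ)..L, ⟪γ t, n t⟫ := by
  rw [← intervalIntegral.integral_neg]
  refine hb.setIntegral_eq fun t => ?_
  rw [outNormal, hu _ (hb.mem t), hb.gC_eq t, norm_smul, hb.norm_normal, mul_one,
    Real.norm_of_nonneg hb.c_pos.le, neg_smul, inv_smul_smul₀ hb.c_pos.ne', inner_neg_right]

end IsBoundaryCurve

/-- length bounds for `Γ_N`: if `Γ_N` is connected, `|∇u|` is constant on
`Γ_N`, and the normalization `u_max = (u_R)_max` is in force, then `H¹(Γ_N) ≥ 2π` when `N`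
is outer and `H¹(Γ_N) ≤ 2π r_i(R)` when `N` is inner. -/
theorem length_bound_Gamma (Ω : Set E2) (u : E2 → ℝ)
    (h : IsSerrinSolution Ω u)
    (N : Set E2) (hN : IsCompOf N (Ω \ MAXset Ω u))
    (hconn : IsConnected (frontier N ∩ frontier Ω))
    (hconst : ∃ c : ℝ, ∀ x ∈ frontier N ∩ frontier Ω, ‖gradient u x‖ = c)
    (R : ℝ) (hnorm : umax Ω u = modelUmax R)
    (hcase :
      (nwssRegion Ω u N < Real.sqrt 2 ∧ R ∈ Ico (0:ℝ) 1 ∧ tauOut R = nwssRegion Ω u N) ∨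
      (Real.sqrt 2 < nwssRegion Ω u N ∧ R ∈ Ioo (0:ℝ) 1 ∧ tauIn R = nwssRegion Ω u N)) :
    (0 < (∫ x in (frontier N ∩ frontier Ω), ⟪x, outNormal u x⟫ ∂(μH[1])) →
      ENNReal.ofReal (2 * Real.pi) ≤ μH[1] (frontier N ∩ frontier Ω)) ∧
    ((∫ x in (frontier N ∩ frontier Ω), ⟪x, outNormal u x⟫ ∂(μH[1])) < 0 →
      μH[1] (frontier N ∩ frontier Ω) ≤ ENNReal.ofReal (2 * Real.pi * innerRadius R)) := by
  obtain ⟨c, hc⟩ := hconst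
  rcases eq_or_ne c 0 with rfl | hc0
  · have h0 := setIntegral_inner_outNormal_eq_zero
      fun (x : E2) (hx : x ∈ frontier N ∩ frontier Ω) => norm_eq_zero.1 (hc x hx)
    rw [h0]
    exact ⟨fun h => absurd h (lt_irrefl _), fun h => absurd h (lt_irrefl _)⟩
  have hcpos : 0 < c := by
    obtain ⟨x, hx⟩ := hconn.nonempty
    exact lt_of_le_of_ne (hc x hx ▸ norm_nonneg _) hc0.symm
  have hgrad : ∀ x ∈ frontier N ∩ frontier Ω, gradient u x = gC Ω u x := fun x hx =>
    h.gradient_eq (frontier_subset_closure hx.2) (norm_ne_zero_iff.1 (by rw [hc x hx]; exact hc0))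
  have hgC : ∀ x ∈ frontier N ∩ frontier Ω, ‖gC Ω u x‖ = c := fun x hx => by
    rw [← hgrad x hx, hc x hx]
  obtain ⟨L, C, s₀, γ, n, β, hb⟩ := h.exists_isBoundaryCurve hN hconn hcpos hgC
  have hm : 0 < modelUmax R := hnorm ▸ h.umax_pos
  rw [nwssRegion_eq_div h hN hconn.nonempty hc, hnorm] at hcase
  rw [hb.setIntegral_inner_outNormal hgrad, hb.hausdorffMeasure_eq]
  rcases hcase with ⟨-, hR, hτ⟩ | ⟨-, hR, hτ⟩
  · have hcR := eq_of_tauOut_eq hm hτ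
    refine ⟨fun _ => ENNReal.ofReal_le_ofReal
      (hb.two_pi_le_of_outer h hN hgC hR.1 hR.2 hnorm hcR), fun hneg => ?_⟩
    have h1 := hb.length_le_neg_integral_of_outer h hN hgC hR.1 hR.2 hnorm hcR
    linarith [hb.L_pos]
  · obtain ⟨hr0, hrR, hrm⟩ := innerRadius_spec hR.1 hm
    have hcr := eq_of_tauIn_eq hR.2.ne hm hr0.ne' hτ
    rw [← hnorm] at hrm
    refine ⟨fun hpos => ?_, fun _ => ENNReal.ofReal_le_ofReal
      (hb.length_le_of_inner h hN hgC hr0 hrR hrm hcr)⟩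
    linarith [hb.integral_nonneg_of_inner h hN hr0 hrR hrm hcr]
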